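/- Let (R,𝔪) → (S,𝔫) be a pure local homomorphism of Noetherian local rings such that S is a regular local ring of mixed characteristic. Then R is Cohen-Macaulay, i.e., some (equivalently, every) system of parameters of R is a regular sequence on R. -/

import Mathlib

/-- A list of elements of a Noetherian local ring is a system of parameters if it consists of
elements of the maximal ideal, has length equal to the Krull dimension, and the radical of the
ideal it generates is the maximal ideal. -/
def IsSOP (R : Type*) [CommRing R] [IsLocalRing R] (xs : List R) : Prop :=
  (∀ x ∈ xs, x ∈ IsLocalRing.maximalIdeal R) ∧
    (xs.length : WithBot ℕ∞) = ringKrullDim R ∧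
    (Ideal.span {x | x ∈ xs}).radical = IsLocalRing.maximalIdeal R

/-- An `R`-algebra `B` is a balanced big Cohen-Macaulay algebra for the local ring `(R, 𝔪)` if
`𝔪 B ≠ B` and every system of parameters of `R` is a regular sequence on `B`, i.e. each
parameter is a nonzerodivisor modulo the previous ones. -/
def IsBalancedBigCM (R B : Type*) [CommRing R] [IsLocalRing R] [CommRing B] [Algebra R B] :
    Prop :=
  (IsLocalRing.maximalIdeal R).map (algebraMap R B) ≠ ⊤ ∧
    ∀ xs : List R, IsSOP R xs → RingTheory.Sequence.IsWeaklyRegular B xs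

/-- A local ring has mixed characteristic if it has characteristic zero and its residue field
has characteristic `p > 0`. -/
def MixedCharLocal (R : Type*) [CommRing R] [IsLocalRing R] : Prop :=
  CharZero R ∧ ∃ p : ℕ, 0 < p ∧ CharP (IsLocalRing.ResidueField R) p

/-- A Noetherian local ring is regular if its maximal ideal can be generated by
`Krull dimension` many elements. -/
def IsRegularLocal (A : Type*) [CommRing A] [IsLocalRing A] : Prop :=
  IsNoetherianRing A ∧
    ∃ s : Finset A, Ideal.span (s : Set A) = IsLocalRing.maximalIdeal A ∧
      (s.card : WithBot ℕ∞) = ringKrullDim A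

open TensorProduct

universe u v

/-- A ring map `R → S` is pure if for every `R`-module `M` the map `m ↦ m ⊗ 1` from `M` to
`M ⊗[R] S` is injective. -/
def IsPureMap (R : Type u) (S : Type v) [CommRing R] [CommRing S] [Algebra R S] : Prop :=
  ∀ (M : Type u) [AddCommGroup M] [Module R M],
    Function.Injective fun m : M => m ⊗ₜ[R] (1 : S)

namespace PureRegular

section

open MvPolynomial

/-- The ideal generated by a family. -/
abbrev gen {A : Type*} [CommRing A] {ι : Type*} (x : ι → A) : Ideal A :=
  Ideal.span (Set.range x)

/-- `x` is quasi-regular modulo the ideal `I`. -/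
def QuasiRegular {A : Type*} [CommRing A] {n : ℕ} (x : Fin n → A) (I : Ideal A) : Prop :=
  ∀ (ν : ℕ) (F : MvPolynomial (Fin n) A), F.IsHomogeneous ν →
    eval x F ∈ gen x ^ (ν + 1) ⊔ I → ∀ α, F.coeff α ∈ gen x ⊔ I

section

variable {A : Type*} [CommRing A] {n : ℕ} {x : Fin n → A} {I : Ideal A}

lemma mem_gen {ι : Type*} (x : ι → A) (i : ι) : x i ∈ gen x := Ideal.subset_span ⟨i, rfl⟩

lemma prod_pow_mem_gen_pow {ι : Type*} (x : ι → A) (α : ι →₀ ℕ) :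
    (α.prod fun i k => x i ^ k) ∈ gen x ^ α.degree := by
  classical
  rw [Finsupp.prod, Finsupp.degree_apply, ← Finset.prod_pow_eq_pow_sum]
  exact Ideal.prod_mem_prod fun i _ => Ideal.pow_mem_pow (mem_gen x i) _

lemma eval_mem_mul {ι : Type*} {x : ι → A} {F : MvPolynomial ι A} {ν : ℕ} (hF : F.IsHomogeneous ν)
    {J : Ideal A} (hJ : ∀ α, F.coeff α ∈ J) : eval x F ∈ J * gen x ^ ν := by
  rw [eval_eq]
  refine Ideal.sum_mem _ fun α hα => Ideal.mul_mem_mul (hJ α) ?_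
  have : α.degree = ν := by
    by_contra hd
    exact mem_support_iff.1 hα (hF.coeff_eq_zero hd)
  rw [← this]
  exact prod_pow_mem_gen_pow x α

lemma eval_mem_pow {ι : Type*} {x : ι → A} {F : MvPolynomial ι A} {ν : ℕ}
    (hF : F.IsHomogeneous ν) : eval x F ∈ gen x ^ ν := by
  simpa using eval_mem_mul (x := x) hF (J := ⊤) (by simp)

lemma exists_homogeneous_of_mem_pow {ι : Type*} [Finite ι] {x : ι → A} (ν : ℕ) :
    ∀ {e : A}, e ∈ gen x ^ ν → ∃ F : MvPolynomial ι A, F.IsHomogeneous ν ∧ eval x F = e := by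
  cases nonempty_fintype ι
  induction ν with
  | zero => exact fun {e} _ => ⟨C e, isHomogeneous_C _ _, by simp⟩
  | succ ν ih =>
    intro e he
    rw [pow_succ] at he
    induction he using Submodule.mul_induction_on' with
    | mem_mul_mem a ha b hb =>
      obtain ⟨F, hF, rfl⟩ := ih ha
      obtain ⟨c, rfl⟩ := Ideal.mem_span_range_iff_exists_fun.1 hb
      refine ⟨F * ∑ i, C (c i) * X i, hF.mul (IsHomogeneous.sum _ _ _ fun i _ => ?_), by simp⟩
      exact isHomogeneous_C_mul_X _ _
    | add a _ b _ ha hb =>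
      obtain ⟨F, hF, rfl⟩ := ha
      obtain ⟨G, hG, rfl⟩ := hb
      exact ⟨F + G, hF.add hG, by simp⟩

lemma eval_mem_pow_succ_sup {ν : ℕ} {F : MvPolynomial (Fin n) A}
    (hF : F.IsHomogeneous ν) (hm : ∀ α, F.coeff α ∈ gen x ⊔ I) :
    eval x F ∈ gen x ^ (ν + 1) ⊔ I := by
  have := eval_mem_mul (x := x) hF hm
  rw [Ideal.sup_mul, ← pow_succ'] at this
  exact (sup_le_sup le_rfl Ideal.mul_le_left :
    gen x ^ (ν + 1) ⊔ I * gen x ^ ν ≤ gen x ^ (ν + 1) ⊔ I) this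

lemma exists_form_of_mem_sup {ν : ℕ} {e : A} (he : e ∈ gen x ^ ν ⊔ I) :
    ∃ F : MvPolynomial (Fin n) A, F.IsHomogeneous ν ∧ e - eval x F ∈ I := by
  obtain ⟨a, ha, b, hb, rfl⟩ := Submodule.mem_sup.1 he
  obtain ⟨F, hF, rfl⟩ := exists_homogeneous_of_mem_pow ν ha
  exact ⟨F, hF, by simpa using hb⟩

lemma gen_pow_mono {ι : Type*} (x : ι → A) {a b : ℕ} (h : a ≤ b) : gen x ^ b ≤ gen x ^ a :=
  Ideal.pow_le_pow_right h

/-- Generic induction: climbing the filtration. -/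
lemma mem_pow_sup_of_step {e : A} {m : ℕ}
    (step : ∀ μ < m, ∀ F : MvPolynomial (Fin n) A, F.IsHomogeneous μ → e - eval x F ∈ I →
      ∀ α, F.coeff α ∈ gen x ⊔ I) : e ∈ gen x ^ m ⊔ I := by
  induction m with
  | zero => simp
  | succ m ih =>
    obtain ⟨F, hF, h⟩ := exists_form_of_mem_sup (ih fun μ hμ => step μ (by omega))
    have := eval_mem_pow_succ_sup hF (step m (by omega) F hF h)
    have h2 := Ideal.add_mem _ (Ideal.mem_sup_right (S := gen x ^ (m+1)) h) this
    simpa using h2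

/-- Adjoining to `I` a nonzerodivisor modulo `(x) + I`. -/
lemma QuasiRegular.sup_span_singleton (h : QuasiRegular x I) {ρ : A}
    (hρ : ∀ f, ρ * f ∈ gen x ⊔ I → f ∈ gen x ⊔ I) : QuasiRegular x (I ⊔ Ideal.span {ρ}) := by
  intro ν F hF hm α
  obtain ⟨a, ha, b, hb, hab⟩ := Submodule.mem_sup.1 hm
  obtain ⟨b₁, hb₁, b₂, hb₂, rfl⟩ := Submodule.mem_sup.1 hb
  obtain ⟨e, rfl⟩ := Ideal.mem_span_singleton'.1 hb₂
  have hFν : eval x F ∈ gen x ^ ν := eval_mem_pow hF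
  have key : e ∈ gen x ^ ν ⊔ I := by
    apply mem_pow_sup_of_step
    intro μ hμ G hG hGe
    have h1 : eval x (C ρ * G) ∈ gen x ^ (μ + 1) ⊔ I := by
      have e1 : eval x (C ρ * G) = eval x F - a - b₁ - ρ * (e - eval x G) := by
        rw [← hab]; simp; ring
      rw [e1]
      refine Ideal.sub_mem _ (Ideal.sub_mem _ (Ideal.sub_mem _ ?_ ?_) ?_) ?_
      · exact Ideal.mem_sup_left (gen_pow_mono x (by omega) hFν)
      · exact Ideal.mem_sup_left (gen_pow_mono x (by omega) ha)
      · exact Ideal.mem_sup_right hb₁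
      · exact Ideal.mem_sup_right (I.mul_mem_left _ hGe)
    have h2 := h μ (C ρ * G) (by simpa using (isHomogeneous_C _ ρ).mul hG) h1
    exact fun α => hρ _ (by simpa [coeff_C_mul] using h2 α)
  obtain ⟨G, hG, hGe⟩ := exists_form_of_mem_sup key
  have h2 : eval x (F - C ρ * G) ∈ gen x ^ (ν + 1) ⊔ I := by
    have e1 : eval x (F - C ρ * G) = a + (b₁ + ρ * (e - eval x G)) := by
      simp only [map_sub, map_mul, eval_C, ← hab]; ring
    rw [e1]
    exact Ideal.add_mem _ (Ideal.mem_sup_left ha)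
      (Ideal.mem_sup_right (I.add_mem hb₁ (I.mul_mem_left _ hGe)))
  have h3 := h ν _ (hF.sub (by simpa using (isHomogeneous_C _ ρ).mul hG)) h2 α
  rw [coeff_sub, coeff_C_mul] at h3
  have h4 : F.coeff α = (F.coeff α - ρ * G.coeff α) + G.coeff α * ρ := by ring
  rw [h4]
  refine Ideal.add_mem _ ?_ ?_
  · exact (sup_le_sup le_rfl le_sup_left : gen x ⊔ I ≤ _) h3
  · exact Ideal.mem_sup_right (Ideal.mem_sup_right (Ideal.mem_span_singleton'.2 ⟨_, rfl⟩))

lemma QuasiRegular.of_directed {ι : Type*} (ρ : ι → A)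
    (h : ∀ s : Finset ι, QuasiRegular x (I ⊔ Ideal.span (ρ '' s))) :
    QuasiRegular x (I ⊔ Ideal.span (Set.range ρ)) := by
  classical
  intro ν F hF hm α
  have : ∃ s : Finset ι, eval x F ∈ gen x ^ (ν + 1) ⊔ (I ⊔ Ideal.span (ρ '' s)) := by
    obtain ⟨a, ha, b, hb, hab⟩ := Submodule.mem_sup.1 hm
    obtain ⟨b₁, hb₁, b₂, hb₂, rfl⟩ := Submodule.mem_sup.1 hb
    obtain ⟨t, ht, hbt⟩ := Submodule.mem_span_finite_of_mem_span hb₂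
    obtain ⟨s, -, -, rfl⟩ := Finset.exists_subset_injOn_image_eq_of_surjOn
      (f := ρ) Set.univ t (by intro y hy; simpa using ht hy)
    refine ⟨s, hab ▸ Ideal.add_mem _ (Ideal.mem_sup_left ha) (Ideal.mem_sup_right
      (Ideal.add_mem _ (Ideal.mem_sup_left hb₁) (Ideal.mem_sup_right ?_)))⟩
    simpa using hbt
  obtain ⟨s, hs⟩ := this
  have := h s ν F hF hs α
  exact (sup_le_sup le_rfl (sup_le_sup le_rfl
    (Ideal.span_mono (Set.image_subset_range ρ s)))) this

end

end

section

open MvPolynomial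

variable {A : Type*} [CommRing A] {n : ℕ}

lemma map_gen {B ι : Type*} [CommRing B] (f : A →+* B) (x : ι → A) :
    (gen x).map f = gen (f ∘ x) := by
  rw [gen, gen, Ideal.map_span, Set.range_comp]

lemma map_gen_pow {B ι : Type*} [CommRing B] (f : A →+* B) (x : ι → A) (M : ℕ) :
    (gen x ^ M).map f = gen (f ∘ x) ^ M := by
  rw [Ideal.map_pow, map_gen]

lemma mem_gen_pow_map {B ι : Type*} [CommRing B] (f : A →+* B) (x : ι → A) {M : ℕ} {a : A}
    (h : a ∈ gen x ^ M) : f a ∈ gen (f ∘ x) ^ M := by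
  rw [← map_gen_pow]; exact Ideal.mem_map_of_mem f h

lemma eval_map_comp {B ι : Type*} [CommRing B] (f : A →+* B) (x : ι → A) (F : MvPolynomial ι A) :
    eval (f ∘ x) (MvPolynomial.map f F) = f (eval x F) := by
  rw [eval_map, eval₂_comp]

/-- Quasi-regularity can be checked after a surjection. -/
lemma QuasiRegular.comap {B : Type*} [CommRing B] {f : A →+* B} (hf : Function.Surjective f)
    {x : Fin n → A} {I : Ideal B} (h : QuasiRegular (f ∘ x) I) : QuasiRegular x (I.comap f) := by
  intro ν F hF hm α
  have hmap : (gen x ^ (ν+1) ⊔ I.comap f).map f ≤ gen (f ∘ x) ^ (ν + 1) ⊔ I := by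
    rw [Ideal.map_sup, map_gen_pow]
    exact sup_le_sup le_rfl Ideal.map_comap_le
  have h1 := h ν (MvPolynomial.map f F) (hF.map f) (by
    rw [eval_map_comp]; exact hmap (Ideal.mem_map_of_mem f hm)) α
  rw [coeff_map] at h1
  obtain ⟨a, ha, b, hb, hab⟩ := Submodule.mem_sup.1 h1
  rw [← map_gen] at ha
  obtain ⟨a', ha', rfl⟩ := (Ideal.mem_map_iff_of_surjective f hf).1 ha
  have : F.coeff α = a' + (F.coeff α - a') := by ring
  rw [this]
  refine Ideal.add_mem _ (Ideal.mem_sup_left ha') (Ideal.mem_sup_right ?_)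
  rw [Ideal.mem_comap, map_sub, ← hab]; simpa using hb

/-- Quasi-regularity modulo the kernel of a surjection descends to the quotient. -/
lemma QuasiRegular.of_surjective {B : Type*} [CommRing B] {f : A →+* B}
    (hf : Function.Surjective f) {x : Fin n → A} {I : Ideal A} (hI : RingHom.ker f ≤ I)
    (h : QuasiRegular x I) : QuasiRegular (f ∘ x) (I.map f) := by
  intro ν F hF hm α
  obtain ⟨G, hG, rfl⟩ : ∃ G : MvPolynomial (Fin n) A, G.IsHomogeneous ν ∧
      MvPolynomial.map f G = F := by
    obtain ⟨G, rfl⟩ := map_surjective f hf F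
    refine ⟨homogeneousComponent ν G, homogeneousComponent_isHomogeneous _ _, ?_⟩
    ext d
    rw [coeff_map, coeff_homogeneousComponent]
    split_ifs with hd
    · rw [coeff_map]
    · rw [map_zero, hF.coeff_eq_zero hd]
  rw [eval_map_comp, ← map_gen_pow, ← Ideal.map_sup,
    Ideal.mem_map_iff_of_surjective f hf] at hm
  obtain ⟨a, ha, hae⟩ := hm
  have h1 : eval x G ∈ gen x ^ (ν + 1) ⊔ I := by
    have : eval x G = a + (eval x G - a) := by ring
    rw [this]
    refine Ideal.add_mem _ ha (Ideal.mem_sup_right (hI ?_))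
    rw [RingHom.mem_ker, map_sub, hae, sub_self]
  have := Ideal.mem_map_of_mem f (h ν G hG h1 α)
  rwa [Ideal.map_sup, map_gen, ← coeff_map] at this

lemma gen_fin_succ (x : Fin (n + 1) → A) :
    gen x = Ideal.span {x 0} ⊔ gen (fun i : Fin n => x i.succ) := by
  apply le_antisymm
  · rw [gen, Ideal.span_le]
    rintro _ ⟨i, rfl⟩
    refine Fin.cases ?_ (fun i => ?_) i
    · exact Ideal.mem_sup_left (Ideal.mem_span_singleton_self _)
    · exact Ideal.mem_sup_right (mem_gen (fun i : Fin n => x i.succ) i)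
  · refine sup_le ?_ ?_
    · rw [Ideal.span_singleton_le_iff_mem]; exact mem_gen x 0
    · rw [gen, Ideal.span_le]; rintro _ ⟨i, rfl⟩; exact mem_gen x _

lemma gen_tail_le (x : Fin (n + 1) → A) : gen (fun i : Fin n => x i.succ) ≤ gen x := by
  rw [gen_fin_succ x]; exact le_sup_right

lemma QuasiRegular.tail {x : Fin (n + 1) → A} {I : Ideal A} (h : QuasiRegular x I) :
    QuasiRegular (fun i : Fin n => x i.succ) (I ⊔ Ideal.span {x 0}) := by
  intro ν F hF hm α
  have hgen : gen x ⊔ I = gen (fun i : Fin n => x i.succ) ⊔ (I ⊔ Ideal.span {x 0}) := by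
    rw [gen_fin_succ x]; ac_rfl
  rw [← hgen]
  set y := fun i : Fin n => x i.succ
  set F' := rename Fin.succ F with hF'
  have hF'h : F'.IsHomogeneous ν := hF.rename_isHomogeneous
  have hev : eval x F' = eval y F := by rw [hF', eval_rename]; rfl
  have hco : F'.coeff (α.mapDomain Fin.succ) = F.coeff α :=
    coeff_rename_mapDomain _ (Fin.succ_injective _) _ _
  obtain ⟨a, ha, b, hb, hab⟩ := Submodule.mem_sup.1 hm
  obtain ⟨b₁, hb₁, b₂, hb₂, rfl⟩ := Submodule.mem_sup.1 hb
  obtain ⟨e, rfl⟩ := Ideal.mem_span_singleton'.1 hb₂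
  have ha' : a ∈ gen x ^ (ν + 1) := Ideal.pow_right_mono (gen_tail_le x) _ ha
  cases ν with
  | zero =>
    rw [← hco]
    refine h 0 F' hF'h ?_ _
    rw [hev, ← hab, zero_add, pow_one]
    refine Ideal.add_mem _ (Ideal.mem_sup_left (by simpa using ha')) (Ideal.add_mem _
      (Ideal.mem_sup_right hb₁) (Ideal.mem_sup_left (Ideal.mul_mem_left _ _ (mem_gen x 0))))
  | succ ν =>
    have key : e ∈ gen x ^ ν ⊔ I := by
      apply mem_pow_sup_of_step
      intro μ hμ G hG hGe α
      have h1 : eval x (X 0 * G) ∈ gen x ^ (1 + μ + 1) ⊔ I := by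
        have e1 : eval x (X 0 * G) = eval x F' - a - b₁ - x 0 * (e - eval x G) := by
          rw [hev, ← hab]; simp; ring
        rw [e1]
        refine Ideal.sub_mem _ (Ideal.sub_mem _ (Ideal.sub_mem _ ?_ ?_) ?_) ?_
        · exact Ideal.mem_sup_left (gen_pow_mono x (by omega) (eval_mem_pow hF'h))
        · exact Ideal.mem_sup_left (gen_pow_mono x (by omega) ha')
        · exact Ideal.mem_sup_right hb₁
        · exact Ideal.mem_sup_right (I.mul_mem_left _ hGe)
      have h2 := h _ (X 0 * G) ((isHomogeneous_X _ _).mul hG) h1 (Finsupp.single 0 1 + α)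
      rwa [coeff_X_mul] at h2
    obtain ⟨G, hG, hGe⟩ := exists_form_of_mem_sup key
    have h2 : eval x (F' - X 0 * G) ∈ gen x ^ (ν + 1 + 1) ⊔ I := by
      have e1 : eval x (F' - X 0 * G) = a + (b₁ + x 0 * (e - eval x G)) := by
        simp only [map_sub, map_mul, eval_X, hev, ← hab]; ring
      rw [e1]
      exact Ideal.add_mem _ (Ideal.mem_sup_left ha')
        (Ideal.mem_sup_right (I.add_mem hb₁ (I.mul_mem_left _ hGe)))
    have h3 := h _ _ (hF'h.sub (by
      simpa [add_comm] using (isHomogeneous_X A (0 : Fin (n+1))).mul hG)) h2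
      (α.mapDomain Fin.succ)
    rw [coeff_sub, hco, coeff_X_mul', if_neg, sub_zero] at h3
    · exact h3
    · intro h0
      have := Finsupp.mapDomain_support h0
      simp at this

/-- Invariance of quasi-regularity under an invertible linear substitution. -/
lemma QuasiRegular.substitute {y y' : Fin n → A} {I : Ideal A} (h : QuasiRegular y I)
    (hgen : gen y' = gen y) (g g' : Fin n → MvPolynomial (Fin n) A)
    (hg : ∀ i, (g i).IsHomogeneous 1) (hgy : ∀ i, eval y (g i) = y' i)
    (hgg : ∀ i, aeval g' (g i) = X i) : QuasiRegular y' I := by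
  intro ν F hF hm α
  rw [hgen] at hm ⊢
  have hF2 : (aeval g F).IsHomogeneous ν := by simpa using hF.aeval g (n := 1) hg
  have hev : eval y (aeval g F) = eval y' F := by
    have : (eval y).comp ((aeval g : _ →ₐ[A] MvPolynomial (Fin n) A) : _ →+* _) = eval y' := by
      apply ringHom_ext
      · intro a; simp
      · intro i; simp [hgy]
    exact DFunLike.congr_fun this F
  have hco := h ν _ hF2 (by rw [hev]; exact hm)
  have hinv : aeval g' (aeval g F) = F := by
    have : ((aeval g').comp (aeval g) : MvPolynomial (Fin n) A →ₐ[A] _) = AlgHom.id A _ := by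
      apply algHom_ext
      intro i
      rw [AlgHom.comp_apply, aeval_X, hgg]; rfl
    exact DFunLike.congr_fun this F
  have hmem : aeval g F ∈ (gen y ⊔ I).map (C : A →+* MvPolynomial (Fin n) A) := by
    rw [mem_map_C_iff]; exact hco
  have h5 : (gen y ⊔ I).map (C : A →+* MvPolynomial (Fin n) A) ≤
      ((gen y ⊔ I).map (C : A →+* MvPolynomial (Fin n) A)).comap
        (aeval g' : MvPolynomial (Fin n) A →ₐ[A] MvPolynomial (Fin n) A) := by
    rw [Ideal.map_le_iff_le_comap]
    intro a ha
    rw [Ideal.mem_comap, Ideal.mem_comap, aeval_C]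
    exact Ideal.mem_map_of_mem _ ha
  have h4 := h5 hmem
  rw [Ideal.mem_comap, hinv] at h4
  exact mem_map_C_iff.1 h4 α

lemma gen_cons (t : A) (x : Fin n → A) :
    gen (Fin.cons t x : Fin (n + 1) → A) = Ideal.span {t} ⊔ gen x := by
  rw [gen_fin_succ]; simp

lemma gen_cons_sub (t : A) (x : Fin n → A) {s : A} (hs : s ∈ gen x) :
    gen (Fin.cons (t - s) x : Fin (n + 1) → A) = gen (Fin.cons t x : Fin (n + 1) → A) := by
  rw [gen_cons, gen_cons]
  apply le_antisymm
  · refine sup_le ?_ le_sup_right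
    rw [Ideal.span_singleton_le_iff_mem]
    exact Ideal.sub_mem _ (Ideal.mem_sup_left (Ideal.mem_span_singleton_self _))
      (Ideal.mem_sup_right hs)
  · refine sup_le ?_ le_sup_right
    rw [Ideal.span_singleton_le_iff_mem]
    have h1 := Ideal.add_mem (Ideal.span {t - s} ⊔ gen x)
      (Ideal.mem_sup_left (Ideal.mem_span_singleton_self _)) (Ideal.mem_sup_right hs)
    rwa [sub_add_cancel] at h1

/-- Replacing the first element by itself minus a combination of the others. -/
lemma QuasiRegular.cons_sub {t : A} {x : Fin n → A} {I : Ideal A}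
    (h : QuasiRegular (Fin.cons t x : Fin (n + 1) → A) I) (σ : Fin n → A) :
    QuasiRegular (Fin.cons (t - ∑ i, σ i * x i) x : Fin (n + 1) → A) I := by
  refine h.substitute (gen_cons_sub t x
      (Ideal.sum_mem _ fun i _ => Ideal.mul_mem_left _ _ (mem_gen x i)))
    (Fin.cons (X 0 - ∑ i : Fin n, C (σ i) * X i.succ) (fun i => X i.succ))
    (Fin.cons (X 0 + ∑ i : Fin n, C (σ i) * X i.succ) (fun i => X i.succ)) ?_ ?_ ?_
  · refine Fin.cases ?_ (fun i => ?_)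
    · rw [Fin.cons_zero]
      exact (isHomogeneous_X _ _).sub (IsHomogeneous.sum _ _ _ fun i _ => isHomogeneous_C_mul_X _ _)
    · exact isHomogeneous_X _ _
  · refine Fin.cases ?_ (fun i => ?_)
    · simp only [Fin.cons_zero, map_sub, map_sum, map_mul, eval_X, eval_C, Fin.cons_succ]
    · simp only [Fin.cons_succ, eval_X]
  · refine Fin.cases ?_ (fun i => ?_)
    · simp only [Fin.cons_zero, map_sub, map_sum, map_mul, aeval_X, aeval_C, Fin.cons_succ,
        MvPolynomial.algebraMap_eq, add_sub_cancel_right]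
    · simp only [Fin.cons_succ, aeval_X]

/-- Colon property for an initial segment of a quasi-regular sequence. -/
lemma QuasiRegular.colon {x : Fin n → A} {I : Ideal A} (h : QuasiRegular x I) (j : Fin n) {u : A}
    (hu : x j * u ∈ I ⊔ Ideal.span (x '' {i | i < j})) (M : ℕ) :
    u ∈ gen x ^ M ⊔ (I ⊔ Ideal.span (x '' {i | i < j})) := by
  induction n generalizing I with
  | zero => exact j.elim0
  | succ n ih =>
    cases j using Fin.cases with
    | zero =>
      simp only [Fin.not_lt_zero, Set.ofPred_false, Set.image_empty, Ideal.span_empty,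
        sup_bot_eq] at hu ⊢
      apply mem_pow_sup_of_step
      intro μ _ G hG hGe α
      have h1 : eval x (X 0 * G) ∈ gen x ^ (1 + μ + 1) ⊔ I := by
        refine Ideal.mem_sup_right ?_
        have e1 : eval x (X 0 * G) = x 0 * u - x 0 * (u - eval x G) := by simp; ring
        rw [e1]; exact I.sub_mem hu (I.mul_mem_left _ hGe)
      have h2 := h _ (X 0 * G) ((isHomogeneous_X _ _).mul hG) h1 (Finsupp.single 0 1 + α)
      rwa [coeff_X_mul] at h2
    | succ j =>
      have hset : I ⊔ Ideal.span (x '' {i | i < j.succ}) =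
          I ⊔ Ideal.span {x 0} ⊔ Ideal.span ((fun i : Fin n => x i.succ) '' {i | i < j}) := by
        rw [sup_assoc, ← Ideal.span_union]
        congr 2
        ext a
        constructor
        · rintro ⟨i, hi, rfl⟩
          cases i using Fin.cases with
          | zero => exact Or.inl rfl
          | succ i => exact Or.inr ⟨i, by simpa using hi, rfl⟩
        · rintro (rfl | ⟨i, hi, rfl⟩)
          · exact ⟨0, Fin.succ_pos _, rfl⟩
          · exact ⟨i.succ, by simpa using hi, rfl⟩
      rw [hset] at hu ⊢
      have := ih h.tail j hu
      exact (sup_le_sup (Ideal.pow_right_mono (gen_tail_le x) _) le_rfl :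
        gen (fun i : Fin n => x i.succ) ^ M ⊔ _ ≤ _) this

end

section

open MvPolynomial

variable {A : Type*} [CommRing A] {n : ℕ}

lemma sup_pow_succ_le (T X : Ideal A) (k : ℕ) :
    (T ⊔ X) ^ (k + 1) ≤ T * (T ⊔ X) ^ k ⊔ X ^ (k + 1) := by
  induction k with
  | zero => simp
  | succ k ih =>
    calc (T ⊔ X) ^ (k + 1 + 1) = T * (T ⊔ X) ^ (k + 1) ⊔ X * (T ⊔ X) ^ (k + 1) := by
          rw [pow_succ' _ (k + 1), Ideal.sup_mul]
      _ ≤ T * (T ⊔ X) ^ (k + 1) ⊔ X * (T * (T ⊔ X) ^ k ⊔ X ^ (k + 1)) :=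
          sup_le_sup le_rfl (Ideal.mul_mono_right ih)
      _ ≤ _ := by
          rw [Ideal.mul_sup, ← pow_succ' X]
          refine sup_le le_sup_left (sup_le (le_sup_of_le_left ?_) le_sup_right)
          rw [mul_left_comm, pow_succ' (T ⊔ X)]
          exact Ideal.mul_mono_right (Ideal.mul_mono_left le_sup_right)

lemma QuasiRegular.colon_first {t : A} {x : Fin n → A} (h : QuasiRegular x (Ideal.span {t}))
    (hT : ∀ K, ∃ K', ∀ u, t * u ∈ gen x ^ K' →
      u ∈ gen (Fin.cons t x : Fin (n + 1) → A) ^ K) {k : ℕ} {u : A}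
    (hu : t * u ∈ gen (Fin.cons t x : Fin (n + 1) → A) ^ (k + 1)) :
    u ∈ gen (Fin.cons t x : Fin (n + 1) → A) ^ k := by
  have hx : gen x ≤ gen (Fin.cons t x : Fin (n + 1) → A) := by rw [gen_cons]; exact le_sup_right
  have key : ∀ m, ∃ b ∈ gen (Fin.cons t x : Fin (n + 1) → A) ^ k,
      t * (u - b) ∈ gen x ^ (k + 1 + m) := by
    intro m
    induction m with
    | zero =>
      rw [gen_cons] at hu ⊢
      obtain ⟨a, ha, e, he, hae⟩ := Submodule.mem_sup.1 (sup_pow_succ_le _ _ _ hu)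
      obtain ⟨b, hb, rfl⟩ := Ideal.mem_span_singleton_mul.1 ha
      refine ⟨b, hb, ?_⟩
      have : t * (u - b) = e := by rw [mul_sub, ← hae]; ring
      rw [this]; exact he
    | succ m ih =>
      obtain ⟨b, hb, hm⟩ := ih
      obtain ⟨E, hE, hEe⟩ := exists_homogeneous_of_mem_pow _ hm
      have hc := h _ E hE (by
        rw [hEe]
        exact Ideal.mem_sup_right (Ideal.mul_mem_right _ _ (Ideal.mem_span_singleton_self t)))
      have h1 := eval_mem_mul (x := x) hE hc
      rw [hEe, Ideal.sup_mul] at h1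
      obtain ⟨e, he, c, hc, hec⟩ := Submodule.mem_sup.1 h1
      obtain ⟨d, hd, rfl⟩ := Ideal.mem_span_singleton_mul.1 hc
      refine ⟨b + d, Ideal.add_mem _ hb ?_, ?_⟩
      · exact Ideal.pow_right_mono hx _ (gen_pow_mono x (by omega) hd)
      · have : t * (u - (b + d)) = e := by
          rw [← sub_sub, mul_sub, ← hec]; ring
        rw [this, ← add_assoc, pow_succ']; exact he
  obtain ⟨K', hK'⟩ := hT k
  obtain ⟨b, hb, hm⟩ := key K'
  have := hK' _ (gen_pow_mono x (by omega) hm)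
  simpa using Ideal.add_mem _ this hb

lemma exists_eq_rename_add_X_mul {F : MvPolynomial (Fin (n + 1)) A} {ν : ℕ}
    (hF : F.IsHomogeneous (ν + 1)) : ∃ (F₀ : MvPolynomial (Fin n) A)
      (G : MvPolynomial (Fin (n + 1)) A), F₀.IsHomogeneous (ν + 1) ∧ G.IsHomogeneous ν ∧
      F = rename Fin.succ F₀ + X 0 * G := by
  classical
  set F₀ := (finSuccEquiv A n F).coeff 0
  have hF₀ : F₀.IsHomogeneous (ν + 1) := hF.finSuccEquiv_coeff_isHomogeneous 0 (ν + 1) (by simp)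
  have hd : (X 0 : MvPolynomial (Fin (n + 1)) A) ∣ F - rename Fin.succ F₀ := by
    rw [X_dvd_iff_modMonomial_eq_zero]
    ext d
    by_cases h0 : Finsupp.single 0 1 ≤ d
    · rw [coeff_modMonomial_of_le _ h0, coeff_zero]
    · rw [coeff_modMonomial_of_not_le _ h0, coeff_zero, coeff_sub]
      have hd0 : d 0 = 0 := by
        by_contra hne
        exact h0 (Finsupp.single_le_iff.2 (Nat.one_le_iff_ne_zero.2 hne))
      have hd1 : d = (Finsupp.tail d).mapDomain Fin.succ := by
        ext i
        refine Fin.cases ?_ (fun i => ?_) i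
        · rw [hd0, Finsupp.mapDomain_of_notMem_range]; simp
        · rw [Finsupp.mapDomain_apply (Fin.succ_injective _)]; rfl
      have hd2 : d = (Finsupp.tail d).cons 0 := by rw [← hd0, Finsupp.cons_tail]
      conv_lhs => rw [hd1]
      rw [coeff_rename_mapDomain _ (Fin.succ_injective _), ← hd1, finSuccEquiv_coeff_coeff, ← hd2,
        sub_self]
  obtain ⟨G, hG⟩ := hd
  refine ⟨F₀, G, hF₀, ?_, by rw [← hG]; ring⟩
  intro d hd
  have hh : (X 0 * G).IsHomogeneous (ν + 1) := by
    rw [← hG]; exact hF.sub hF₀.rename_isHomogeneous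
  have h3 := @hh (Finsupp.single 0 1 + d) (by rwa [coeff_X_mul])
  rw [map_add] at h3
  simp only [Pi.one_apply, Finsupp.weight_single, smul_eq_mul, mul_one] at h3
  omega

/-- Quasi-regularity of `t, x` from that of `x` modulo `t` and a colon condition. -/
lemma QuasiRegular.cons_of_colon {t : A} {x : Fin n → A} (h : QuasiRegular x (Ideal.span {t}))
    (hT : ∀ K, ∃ K', ∀ u, t * u ∈ gen x ^ K' →
      u ∈ gen (Fin.cons t x : Fin (n + 1) → A) ^ K) :
    QuasiRegular (Fin.cons t x : Fin (n + 1) → A) ⊥ := by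
  set y : Fin (n + 1) → A := Fin.cons t x with hy
  have hyt : y 0 = t := rfl
  have hyx : y ∘ Fin.succ = x := rfl
  have hgen : gen y = Ideal.span {t} ⊔ gen x := gen_cons t x
  intro ν
  induction ν with
  | zero =>
    intro F hF hm α
    have hF0 : F = C (coeff 0 F) :=
      totalDegree_eq_zero_iff_eq_C.1 (Nat.le_zero.1 hF.totalDegree_le)
    rw [hF0, eval_C, zero_add, pow_one] at hm
    rw [hF0, coeff_C]
    split_ifs
    · exact hm
    · exact Ideal.zero_mem _
  | succ ν ih =>
    intro F hF hm α
    obtain ⟨F₀, G, hF₀, hG, hFG⟩ := exists_eq_rename_add_X_mul hF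
    have hev : eval y F = eval x F₀ + t * eval y G := by
      rw [hFG]; simp [eval_rename, hyx, hyt]
    rw [sup_bot_eq] at hm ⊢
    have hm' : eval y F ∈ Ideal.span {t} * gen y ^ (ν + 1) ⊔ gen x ^ (ν + 1 + 1) := by
      rw [hgen] at hm ⊢; exact sup_pow_succ_le _ _ _ hm
    have hc0 : ∀ α, F₀.coeff α ∈ gen x ⊔ Ideal.span {t} := by
      refine h _ F₀ hF₀ ?_
      obtain ⟨a, ha, b, hb, hab⟩ := Submodule.mem_sup.1 hm'
      have : eval x F₀ = b + (a - t * eval y G) := by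
        have := hab.trans hev; linear_combination -this
      rw [this]
      refine Ideal.add_mem _ (Ideal.mem_sup_left hb) (Ideal.mem_sup_right (Ideal.sub_mem _ ?_ ?_))
      · exact Ideal.mul_le_left ha
      · exact Ideal.mul_mem_right _ _ (Ideal.mem_span_singleton_self t)
    rw [sup_comm, ← hgen] at hc0
    have hF0m : eval x F₀ ∈ gen y ^ (ν + 1 + 1) := by
      have h1 := eval_mem_mul (x := x) hF₀ hc0
      rw [pow_succ']
      have hxy : gen x ≤ gen y := by rw [hgen]; exact le_sup_right
      exact Ideal.mul_mono_right (Ideal.pow_right_mono hxy _) h1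
    have hG2 : eval y G ∈ gen y ^ (ν + 1) := by
      refine h.colon_first hT ?_
      have : t * eval y G = eval y F - eval x F₀ := by rw [hev]; ring
      rw [this]
      exact Ideal.sub_mem _ hm hF0m
    have hcG := ih G hG (by rwa [sup_bot_eq])
    rw [sup_bot_eq] at hcG
    rw [hFG, coeff_add]
    refine Ideal.add_mem _ ?_ ?_
    · by_cases hα : ∃ β : Fin n →₀ ℕ, β.mapDomain Fin.succ = α
      · obtain ⟨β, rfl⟩ := hα
        rw [coeff_rename_mapDomain _ (Fin.succ_injective _)]; exact hc0 β
      · rw [coeff_rename_eq_zero]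
        · exact Ideal.zero_mem _
        · intro β hβ; exact absurd ⟨β, hβ⟩ hα
    · rw [coeff_X_mul']
      split_ifs
      · exact hcG _
      · exact Ideal.zero_mem _

end

section

open MvPolynomial

variable {A B : Type*} [CommRing A] [CommRing B] {n : ℕ}

lemma QuasiRegular.of_map {x : Fin n → A} {f : A →+* B} (h : QuasiRegular (f ∘ x) ⊥)
    (h1 : ∀ a, f a ∈ gen (f ∘ x) → a ∈ gen x) : QuasiRegular x ⊥ := by
  intro ν F hF hm α
  rw [sup_bot_eq] at hm ⊢
  have := h ν (MvPolynomial.map f F) (hF.map f) (by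
    rw [eval_map_comp, sup_bot_eq]; exact mem_gen_pow_map f x hm) α
  exact h1 _ (by simpa [coeff_map] using this)

/-- Quasi-regularity passes along a ring map that is an isomorphism modulo powers. -/
lemma QuasiRegular.map_of_dense {x : Fin n → A} (h : QuasiRegular x ⊥) {f : A →+* B}
    (hc : ∀ M a, f a ∈ gen (f ∘ x) ^ M → a ∈ gen x ^ M)
    (hd : ∀ b, ∃ a, b - f a ∈ gen (f ∘ x)) : QuasiRegular (f ∘ x) ⊥ := by
  classical
  intro ν F hF hm α
  rw [sup_bot_eq] at hm ⊢
  choose s hs using hd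
  set G : MvPolynomial (Fin n) A := ∑ d ∈ F.support, monomial d (s (F.coeff d))
  have hcG : ∀ d, F.coeff d - f (G.coeff d) ∈ gen (f ∘ x) := by
    intro d
    have : G.coeff d = if d ∈ F.support then s (F.coeff d) else 0 := by
      simp only [G, coeff_sum, coeff_monomial, Finset.sum_ite_eq']
    rw [this]
    split_ifs with hd
    · exact hs _
    · rw [notMem_support_iff.1 hd]; simp
  have hG : G.IsHomogeneous ν := by
    refine IsHomogeneous.sum _ _ _ fun d hd => isHomogeneous_monomial _ ?_
    by_contra hne
    exact mem_support_iff.1 hd (hF.coeff_eq_zero hne)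
  have hdiff : eval (f ∘ x) (F - MvPolynomial.map f G) ∈ gen (f ∘ x) ^ (ν + 1) := by
    rw [pow_succ']
    exact eval_mem_mul (hF.sub (hG.map f)) fun d => by rw [coeff_sub, coeff_map]; exact hcG d
  have h2 : eval x G ∈ gen x ^ (ν + 1) := by
    refine hc _ _ ?_
    rw [← eval_map_comp]
    have := Ideal.sub_mem _ hm hdiff
    rwa [map_sub, sub_sub_cancel] at this
  have h3 := h ν G hG (by rwa [sup_bot_eq]) α
  rw [sup_bot_eq] at h3
  have h4 : f (G.coeff α) ∈ gen (f ∘ x) := by rw [← map_gen]; exact Ideal.mem_map_of_mem f h3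
  simpa using Ideal.add_mem _ (hcG α) h4

lemma QuasiRegular.map_C {x : Fin n → A} (h : QuasiRegular x ⊥) (σ : Type*) :
    QuasiRegular ((C : A →+* MvPolynomial σ A) ∘ x) ⊥ := by
  classical
  intro ν F hF hm α
  rw [sup_bot_eq] at hm ⊢
  rw [← map_gen_pow, mem_map_C_iff] at hm
  rw [← map_gen, mem_map_C_iff]
  intro m
  set G : MvPolynomial (Fin n) A := ∑ d ∈ F.support, monomial d ((F.coeff d).coeff m)
  have hcG : ∀ d, G.coeff d = (F.coeff d).coeff m := by
    intro d
    simp only [G, coeff_sum, coeff_monomial, Finset.sum_ite_eq']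
    split_ifs with hd
    · rfl
    · rw [notMem_support_iff.1 hd]; simp
  have hG : G.IsHomogeneous ν := by
    refine IsHomogeneous.sum _ _ _ fun d hd => isHomogeneous_monomial _ ?_
    by_contra hne
    exact mem_support_iff.1 hd (hF.coeff_eq_zero hne)
  have hev : eval x G = (eval ((C : A →+* MvPolynomial σ A) ∘ x) F).coeff m := by
    rw [eval_eq (⇑(C : A →+* MvPolynomial σ A) ∘ x) F, coeff_sum]
    simp only [G, map_sum, eval_monomial, Finsupp.prod]
    refine Finset.sum_congr rfl fun d _ => ?_
    have : (∏ i ∈ d.support, ((C : A →+* MvPolynomial σ A) ∘ x) i ^ d i) =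
        C (∏ i ∈ d.support, x i ^ d i) := by simp
    rw [this, mul_comm, mul_comm (coeff d F), coeff_C_mul]
  rw [← hcG]
  have := h ν G hG (by rw [sup_bot_eq, hev]; exact hm m) α
  rwa [sup_bot_eq] at this

/-- A monic polynomial over `N` is a nonzerodivisor modulo ideals extended from `N`. -/
lemma mem_span_of_monic_mul_mem_aux {M N : Type*} [CommRing M] [CommRing N]
    (e : M ≃+* Polynomial N) (ψ : N →+* M) (he : ∀ q, e (ψ q) = Polynomial.C q) (v : M)
    (hv : e v = Polynomial.X) (P : Polynomial N) (hP : P.Monic) (T : Set M)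
    (hT : T ⊆ Set.range ψ) {f : M} (hf : P.eval₂ ψ v * f ∈ Ideal.span T) : f ∈ Ideal.span T := by
  have he3 : e (P.eval₂ ψ v) = P := by
    have h1 := Polynomial.hom_eval₂ P ψ (e : M →+* Polynomial N) v
    have h2 : (e : M →+* Polynomial N).comp ψ = Polynomial.C := RingHom.ext he
    rw [h2, RingHom.coe_coe, hv, Polynomial.eval₂_C_X] at h1
    exact h1
  let 𝔱 : Ideal N := Ideal.span (ψ ⁻¹' T)
  have hmap : (Ideal.span T).map (e : M →+* Polynomial N) = 𝔱.map Polynomial.C := by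
    rw [Ideal.map_span, Ideal.map_span]
    congr 1
    ext q
    constructor
    · rintro ⟨t, ht, rfl⟩
      obtain ⟨q, rfl⟩ := hT ht
      exact ⟨q, ht, (he q).symm⟩
    · rintro ⟨q, hq, rfl⟩
      exact ⟨_, hq, he q⟩
  have hmem : ∀ g, g ∈ Ideal.span T ↔ e g ∈ 𝔱.map Polynomial.C := by
    intro g
    rw [← hmap]
    constructor
    · exact fun h => Ideal.mem_map_of_mem (e : M →+* Polynomial N) h
    · intro h
      rw [Ideal.mem_map_iff_of_surjective (e : M →+* Polynomial N) e.surjective] at h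
      obtain ⟨g', hg', hgg⟩ := h
      have : g' = g := e.injective hgg
      exact this ▸ hg'
  rw [hmem, map_mul, he3] at hf
  rw [hmem]
  have hker : ∀ q : Polynomial N, q ∈ 𝔱.map Polynomial.C ↔
      q.map (Ideal.Quotient.mk 𝔱) = 0 := by
    intro q
    rw [Ideal.mem_map_C_iff, Polynomial.ext_iff]
    simp [Ideal.Quotient.eq_zero_iff_mem]
  rw [hker, Polynomial.map_mul] at hf
  rw [hker]
  exact ((hP.map _).mul_right_eq_zero_iff).1 hf

/-- A polynomial monic in the variable `v` is a nonzerodivisor modulo polynomials not involving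
`v`. -/
lemma mem_span_of_monic_mul_mem {σ : Type*} {D : Type*} [CommRing D] (v : σ)
    (P : Polynomial (MvPolynomial {y // y ≠ v} D)) (hP : P.Monic)
    (T : Set (MvPolynomial σ D)) (hT : T ⊆ Set.range (rename (Subtype.val : {y // y ≠ v} → σ)))
    {f : MvPolynomial σ D}
    (hf : P.eval₂ (rename (Subtype.val : {y // y ≠ v} → σ)).toRingHom (X v) * f ∈ Ideal.span T) :
    f ∈ Ideal.span T := by
  classical
  let e : MvPolynomial σ D ≃ₐ[D] Polynomial (MvPolynomial {y // y ≠ v} D) :=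
    (renameEquiv D (Equiv.optionSubtypeNe v).symm).trans (optionEquivLeft D _)
  have he1 : ∀ q : MvPolynomial {y // y ≠ v} D,
      e (rename Subtype.val q) = Polynomial.C q := by
    intro q
    induction q using MvPolynomial.induction_on with
    | C a =>
      rw [rename_C]
      simp [e, optionEquivLeft_C]
    | add p q hp hq => rw [map_add, map_add, hp, hq, map_add]
    | mul_X p i hp =>
      rw [map_mul, map_mul, hp, map_mul, rename_X]
      congr 1
      simp [e, Equiv.optionSubtypeNe_symm_of_ne i.2, optionEquivLeft_X_some]
  have he2 : e (X v) = Polynomial.X := by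
    simp [e, optionEquivLeft_X_none]
  exact mem_span_of_monic_mul_mem_aux e.toRingEquiv _ he1 (X v) he2 P hP T hT hf

/-- Quasi-regularity is preserved by adjoining variables and imposing relations each of which is
monic in its own variable. -/
lemma QuasiRegular.of_monic_relations {ι σ : Type*} {x : Fin n → A} (h : QuasiRegular x ⊥)
    (ρ : ι → MvPolynomial σ A) (v : ι → σ) (r : ι → ℕ)
    (hmon : ∀ j, ∃ P : Polynomial (MvPolynomial {y // y ≠ v j} (A ⧸ gen x)), P.Monic ∧
      MvPolynomial.map (Ideal.Quotient.mk (gen x)) (ρ j) =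
        P.eval₂ (rename (Subtype.val : {y // y ≠ v j} → σ)).toRingHom (X (v j)))
    (hfree : ∀ i j, i ≠ j → r i ≤ r j → MvPolynomial.map (Ideal.Quotient.mk (gen x)) (ρ i) ∈
      Set.range (rename (Subtype.val : {y // y ≠ v j} → σ))) :
    QuasiRegular ((C : A →+* MvPolynomial σ A) ∘ x) (Ideal.span (Set.range ρ)) := by
  classical
  rw [← bot_sup_eq (Ideal.span (Set.range ρ))]
  apply QuasiRegular.of_directed
  intro s
  rw [bot_sup_eq]
  induction hn : s.card generalizing s with
  | zero =>
    rw [Finset.card_eq_zero.1 hn]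
    simpa using h.map_C σ
  | succ N ih =>
    have hne : s.Nonempty := by rw [← Finset.card_pos]; omega
    obtain ⟨j, hj, hmax⟩ := s.exists_max_image r hne
    have hs : Ideal.span (ρ '' (s : Set ι)) =
        Ideal.span (ρ '' ((s.erase j : Finset ι) : Set ι)) ⊔ Ideal.span {ρ j} := by
      rw [← Ideal.span_union]
      congr 1
      conv_lhs => rw [← Finset.insert_erase hj]
      rw [Finset.coe_insert, Set.image_insert_eq, Set.union_singleton]
    rw [hs]
    refine (ih (s.erase j) (by rw [Finset.card_erase_of_mem hj]; omega)).sup_span_singleton ?_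
    set φ := MvPolynomial.map (σ := σ) (Ideal.Quotient.mk (gen x))
    have hφ : Function.Surjective φ := map_surjective _ Ideal.Quotient.mk_surjective
    have hker : RingHom.ker φ = gen ((C : A →+* MvPolynomial σ A) ∘ x) := by
      rw [← map_gen, ker_map, Ideal.mk_ker]
    have hmem : ∀ f, f ∈ gen ((C : A →+* MvPolynomial σ A) ∘ x) ⊔
        Ideal.span (ρ '' ((s.erase j : Finset ι) : Set ι)) ↔
        φ f ∈ Ideal.span ((fun i => φ (ρ i)) '' ((s.erase j : Finset ι) : Set ι)) := by
      intro f
      have h1 : Ideal.span ((fun i => φ (ρ i)) '' ((s.erase j : Finset ι) : Set ι)) =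
          (Ideal.span (ρ '' ((s.erase j : Finset ι) : Set ι))).map φ := by
        rw [Ideal.map_span, Set.image_image]
      rw [h1, ← Ideal.mem_comap, Ideal.comap_map_of_surjective φ hφ, ← RingHom.ker_eq_comap_bot,
        hker, sup_comm]
    intro f hf
    rw [hmem] at hf ⊢
    obtain ⟨P, hP, hPe⟩ := hmon j
    rw [map_mul, hPe] at hf
    refine mem_span_of_monic_mul_mem (v j) P hP _ ?_ hf
    rintro _ ⟨i, hi, rfl⟩
    rw [Finset.mem_coe, Finset.mem_erase] at hi
    exact hfree i j hi.1 (hmax i hi.2)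

end

section

open MvPolynomial

universe w

variable {Λ : Type*} {E : Type w} [CommRing Λ] [CommRing E] [Algebra Λ E] {n : ℕ} {z : Fin n → Λ}

lemma mem_pow_smul_top {I : Ideal Λ} {M : ℕ} {z : Fin n → Λ} (hI : I = gen z) {e : E} :
    e ∈ (I ^ M • ⊤ : Submodule Λ E) ↔ e ∈ gen (algebraMap Λ E ∘ z) ^ M := by
  subst hI
  rw [Ideal.smul_top_eq_map, Submodule.restrictScalars_mem, map_gen_pow]

/-- If `z` generates a maximal ideal and is quasi-regular on the algebra `E`, then `E` is
free modulo each power of `(z)`, with a basis independent of the power. -/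
lemma exists_free_family (hmax : (gen z).IsMaximal)
    (h : QuasiRegular (algebraMap Λ E ∘ z) ⊥) :
    ∃ (ι : Type w) (b : ι → E), ∀ M,
      (⊤ : Submodule Λ E) ≤ Submodule.span Λ (Set.range b) ⊔ (gen z ^ M • ⊤) ∧
      ∀ l : ι →₀ Λ, Finsupp.linearCombination Λ b l ∈ gen (algebraMap Λ E ∘ z) ^ M →
        ∀ i, l i ∈ gen z ^ M := by
  classical
  set I := gen z with hI
  let _ : Field (Λ ⧸ I) := Ideal.Quotient.field I
  let Q := E ⧸ (I • ⊤ : Submodule Λ E)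
  let β := Module.Basis.ofVectorSpace (Λ ⧸ I) Q
  have hb : ∀ i, ∃ e : E, Submodule.Quotient.mk e = β i := fun i =>
    Submodule.Quotient.mk_surjective _ _
  choose b hb using hb
  have hsmul : ∀ (l : Λ) (e : E), (Submodule.Quotient.mk (l • e) : Q) =
      (Ideal.Quotient.mk I l) • (Submodule.Quotient.mk e : Q) := fun l e => rfl
  have hmem1 : ∀ e : E, (Submodule.Quotient.mk e : Q) = 0 ↔ e ∈ gen (algebraMap Λ E ∘ z) := by
    intro e
    rw [Submodule.Quotient.mk_eq_zero, ← pow_one I, mem_pow_smul_top hI, pow_one]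
  have hlin : ∀ l : _ →₀ Λ, (Submodule.Quotient.mk (Finsupp.linearCombination Λ b l) : Q) =
      Finsupp.linearCombination (Λ ⧸ I) β (l.mapRange (Ideal.Quotient.mk I) (map_zero _)) := by
    intro l
    induction l using Finsupp.induction_linear with
    | zero => simp
    | add f g hf hg =>
      rw [map_add, Submodule.Quotient.mk_add, hf, hg, ← map_add]
      congr 1
      ext i
      simp
    | single i a =>
      rw [Finsupp.linearCombination_single, hsmul, hb, Finsupp.mapRange_single,
        Finsupp.linearCombination_single]
  have hspan1 : (⊤ : Submodule Λ E) ≤ Submodule.span Λ (Set.range b) ⊔ (I • ⊤) := by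
    intro e _
    let c := β.repr (Submodule.Quotient.mk e)
    obtain ⟨l, hl⟩ := Finsupp.mapRange_surjective (α := Module.Basis.ofVectorSpaceIndex (Λ ⧸ I) Q)
      (Ideal.Quotient.mk I) (map_zero _) Ideal.Quotient.mk_surjective c
    have h1 : (Submodule.Quotient.mk (e - Finsupp.linearCombination Λ b l) : Q) = 0 := by
      rw [Submodule.Quotient.mk_sub, hlin, hl, Module.Basis.linearCombination_repr, sub_self]
    rw [Submodule.Quotient.mk_eq_zero] at h1
    rw [← sub_add_cancel e (Finsupp.linearCombination Λ b l), add_comm]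
    refine Submodule.add_mem_sup ?_ h1
    rw [Finsupp.mem_span_range_iff_exists_finsupp]
    exact ⟨l, rfl⟩
  have hind1 : ∀ l : _ →₀ Λ, Finsupp.linearCombination Λ b l ∈ gen (algebraMap Λ E ∘ z) →
      ∀ i, l i ∈ I := by
    intro l hl i
    rw [← hmem1, hlin] at hl
    have := linearIndependent_iff.1 β.linearIndependent _ hl
    have := DFunLike.congr_fun this i
    simpa [Ideal.Quotient.eq_zero_iff_mem] using this
  refine ⟨_, b, fun M => ⟨?_, ?_⟩⟩
  · induction M with
    | zero =>
      rw [pow_zero, Ideal.one_eq_top, Submodule.top_smul]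
      exact le_sup_right
    | succ M ih =>
      refine ih.trans (sup_le le_sup_left ?_)
      calc (I ^ M • ⊤ : Submodule Λ E) ≤ I ^ M • (Submodule.span Λ (Set.range b) ⊔ (I • ⊤)) :=
            Submodule.smul_mono le_rfl hspan1
        _ = I ^ M • Submodule.span Λ (Set.range b) ⊔ I ^ M • (I • ⊤) := Submodule.smul_sup _ _ _
        _ ≤ _ := by
          refine sup_le_sup Submodule.smul_le_right ?_
          rw [← Submodule.mul_smul, pow_succ]
  · induction M with
    | zero => simp
    | succ M ih =>
      intro l hl i
      have h1 := ih l (gen_pow_mono _ (by omega) hl)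
      choose F hF hFe using fun j => exists_homogeneous_of_mem_pow M (h1 j)
      have hm := h M (∑ j ∈ l.support, C (b j) * MvPolynomial.map (algebraMap Λ E) (F j))
        (IsHomogeneous.sum _ _ _ fun j _ => by
          simpa using (isHomogeneous_C (Fin n) (b j)).mul ((hF j).map _)) (by
          rw [sup_bot_eq]
          convert hl using 1
          rw [map_sum, Finsupp.linearCombination_apply, Finsupp.sum]
          refine Finset.sum_congr rfl fun j _ => ?_
          rw [map_mul, eval_C, eval_map_comp, hFe]
          exact (mul_comm _ _).trans (Algebra.smul_def _ _).symm)
      by_cases hi : i ∈ l.support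
      · rw [← hFe i, pow_succ']
        refine eval_mem_mul (hF i) fun α => ?_
        have h2 := hm α
        rw [sup_bot_eq] at h2
        have h3 := hind1 (∑ j ∈ l.support, Finsupp.single j ((F j).coeff α)) (by
            convert h2 using 1
            simp only [map_sum, Finsupp.linearCombination_single, coeff_sum, coeff_C_mul,
              coeff_map]
            refine Finset.sum_congr rfl fun j _ => ?_
            exact (Algebra.smul_def _ _).trans (mul_comm _ _)) i
        simp only [Finsupp.finsetSum_apply,
          Finsupp.single_apply, Finset.sum_ite_eq', if_pos hi] at h3
        exact h3
      · rw [Finsupp.notMem_support_iff.1 hi]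
        exact zero_mem _

lemma mem_of_linearCombination_mem_map {ι : Type*} {b : ι → E} {M : ℕ}
    (hb : (⊤ : Submodule Λ E) ≤ Submodule.span Λ (Set.range b) ⊔ (gen z ^ M • ⊤))
    (hi : ∀ l : ι →₀ Λ, Finsupp.linearCombination Λ b l ∈ gen (algebraMap Λ E ∘ z) ^ M →
        ∀ i, l i ∈ gen z ^ M) {J : Ideal Λ} (hJ : gen z ^ M ≤ J) (l : ι →₀ Λ)
    (hl : Finsupp.linearCombination Λ b l ∈ J.map (algebraMap Λ E)) (i : ι) : l i ∈ J := by
  have h1 : Finsupp.linearCombination Λ b l ∈ (J • ⊤ : Submodule Λ E) := by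
    rw [Ideal.smul_top_eq_map]; exact hl
  have h2 : (J • ⊤ : Submodule Λ E) ≤
      J • Submodule.span Λ (Set.range b) ⊔ (gen z ^ M • ⊤) := by
    refine (Submodule.smul_mono le_rfl hb).trans ?_
    rw [Submodule.smul_sup]
    exact sup_le_sup le_rfl Submodule.smul_le_right
  obtain ⟨y, hy, w, hw, hyw⟩ := Submodule.mem_sup.1 (h2 h1)
  rw [Submodule.mem_ideal_smul_span_iff_exists_sum] at hy
  obtain ⟨a, ha, rfl⟩ := hy
  rw [mem_pow_smul_top rfl] at hw
  have h3 := hi (l - a) (by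
    rw [map_sub, ← hyw, Finsupp.linearCombination_apply, add_sub_cancel_left]; exact hw) i
  rw [← sub_add_cancel (l i) (a i)]
  exact Ideal.add_mem _ (hJ h3) (ha i)

/-- Colons by elements outside `J` in a quasi-regular algebra. -/
lemma mem_gen_of_mul_mem_map (hmax : (gen z).IsMaximal)
    (h : QuasiRegular (algebraMap Λ E ∘ z) ⊥) {J : Ideal Λ} {M : ℕ} (hJ : gen z ^ M ≤ J)
    {s : Λ} (hs : s ∉ J) {e : E} (he : algebraMap Λ E s * e ∈ J.map (algebraMap Λ E)) :
    e ∈ gen (algebraMap Λ E ∘ z) := by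
  obtain ⟨ι, b, hb⟩ := exists_free_family hmax h
  obtain ⟨y, hy, w, hw, hyw⟩ := Submodule.mem_sup.1 ((hb (M + 1)).1 (Submodule.mem_top (x := e)))
  rw [mem_pow_smul_top rfl] at hw
  rw [Finsupp.mem_span_range_iff_exists_finsupp] at hy
  obtain ⟨l, rfl⟩ := hy
  have hwJ : w ∈ J.map (algebraMap Λ E) := by
    refine Ideal.map_mono hJ ?_
    rw [map_gen_pow]
    exact gen_pow_mono _ (Nat.le_succ M) hw
  have h1 : ∀ i, s * l i ∈ J := by
    intro i
    refine mem_of_linearCombination_mem_map (hb M).1 (hb M).2 hJ (s • l) ?_ i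
    rw [map_smul, Algebra.smul_def, Finsupp.linearCombination_apply, eq_sub_of_add_eq hyw, mul_sub]
    exact Ideal.sub_mem _ he (Ideal.mul_mem_left _ _ hwJ)
  have h2 : ∀ i, l i ∈ gen z := by
    intro i
    by_contra hi
    obtain ⟨c, hc⟩ :=
      Ideal.Quotient.maximal_ideal_iff_isField_quotient _ |>.1 hmax |>.mul_inv_cancel
      (a := Ideal.Quotient.mk _ (l i)) (by rwa [Ne, Ideal.Quotient.eq_zero_iff_mem])
    obtain ⟨c, rfl⟩ := Ideal.Quotient.mk_surjective c
    rw [← map_mul, ← map_one (Ideal.Quotient.mk (gen z)), Ideal.Quotient.eq] at hc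
    -- `l i * c = 1 + ν`, and `ν` is nilpotent modulo `J`.
    have h4 : IsCoprime (l i) (l i * c - 1) := ⟨c, -1, by ring⟩
    obtain ⟨u, v, huv⟩ := (h4.pow_right (n := M))
    refine hs ?_
    have : s = u * (s * l i) + (v * s) * (l i * c - 1) ^ M := by linear_combination -s * huv
    rw [this]
    exact Ideal.add_mem _ (Ideal.mul_mem_left _ _ (h1 i))
      (Ideal.mul_mem_left _ _ (hJ (Ideal.pow_mem_pow hc M)))
  rw [← hyw]
  refine Ideal.add_mem _ ?_ (by simpa using gen_pow_mono _ (Nat.le_add_left 1 M) hw)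
  rw [Finsupp.sum]
  refine Ideal.sum_mem _ fun i _ => ?_
  rw [Algebra.smul_def, ← map_gen]
  exact Ideal.mul_mem_right _ _ (Ideal.mem_map_of_mem _ (h2 i))

lemma mem_of_algebraMap_mem_map (hmax : (gen z).IsMaximal)
    (h : QuasiRegular (algebraMap Λ E ∘ z) ⊥) (hE : gen (algebraMap Λ E ∘ z) ≠ ⊤)
    {J : Ideal Λ} {M : ℕ} (hJ : gen z ^ M ≤ J)
    {s : Λ} (he : algebraMap Λ E s ∈ J.map (algebraMap Λ E)) : s ∈ J := by
  by_contra hs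
  exact hE ((Ideal.eq_top_iff_one _).2
    (mem_gen_of_mul_mem_map hmax h hJ hs (e := 1) (by rwa [mul_one])))

end

section

open MvPolynomial

variable {k : Type*} {n : ℕ}

lemma mem_gen_X_iff [CommRing k] {f : MvPolynomial (Fin n) k} :
    f ∈ gen (X : Fin n → MvPolynomial (Fin n) k) ↔ f.coeff 0 = 0 := by
  have := mem_pow_idealOfVars_iff' (σ := Fin n) 1 f
  rw [pow_one] at this
  refine this.trans ⟨fun h => h 0 (by simp), fun h x hx => ?_⟩
  have : x = 0 := (Finsupp.degree_eq_zero_iff x).1 (by omega)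
  rw [this, h]

lemma quasiRegular_X [CommRing k] : QuasiRegular (X : Fin n → MvPolynomial (Fin n) k) ⊥ := by
  classical
  intro ν F hF hm α
  rw [sup_bot_eq] at hm ⊢
  rw [mem_gen_X_iff]
  by_cases hα : α.degree = ν
  swap
  · rw [hF.coeff_eq_zero hα, coeff_zero]
  have h1 := (mem_pow_idealOfVars_iff' (σ := Fin n) (ν + 1) _).1 hm α (by omega)
  have h2 : eval X F = ∑ d ∈ F.support, F.coeff d * monomial d 1 := by
    rw [eval_eq]
    refine Finset.sum_congr rfl fun d _ => ?_
    rw [monomial_eq, C_1, one_mul, Finsupp.prod]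
  rw [h2, coeff_sum] at h1
  by_cases hs : α ∈ F.support
  · rw [Finset.sum_eq_single α] at h1
    · rw [coeff_mul_monomial', if_pos le_rfl, tsub_self, mul_one] at h1
      exact h1
    · intro d hd hne
      rw [coeff_mul_monomial', if_neg]
      intro hle
      have : d.degree = ν := by
        by_contra hdn
        exact mem_support_iff.1 hd (hF.coeff_eq_zero hdn)
      obtain ⟨c, rfl⟩ := exists_add_of_le hle
      rw [map_add] at hα
      exact hne (by rw [(Finsupp.degree_eq_zero_iff c).1 (by omega), add_zero])
    · exact fun h => absurd hs h
  · rw [notMem_support_iff.1 hs, coeff_zero]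

lemma gen_X_isMaximal [Field k] : (gen (X : Fin n → MvPolynomial (Fin n) k)).IsMaximal := by
  have : gen (X : Fin n → MvPolynomial (Fin n) k) =
      RingHom.ker (constantCoeff : MvPolynomial (Fin n) k →+* k) := by
    ext f
    rw [mem_gen_X_iff, RingHom.mem_ker, constantCoeff_eq]
  rw [this]
  exact RingHom.ker_isMaximal_of_surjective _ fun a => ⟨C a, by simp⟩

lemma quasiRegular_X_pow [CommRing k] {q : ℕ} :
    QuasiRegular (fun i => (X i : MvPolynomial (Fin n) k) ^ q) ⊥ := by
  let A := MvPolynomial (Fin n) k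
  let ρ : Fin n → MvPolynomial (Fin n) A := fun i => X i ^ q - C (X i)
  have h1 := QuasiRegular.of_monic_relations (quasiRegular_X (k := k) (n := n)) ρ id (fun _ => 0)
    (by
      intro j
      refine ⟨Polynomial.X ^ q, Polynomial.monic_X_pow q, ?_⟩
      have : Ideal.Quotient.mk (gen (X : Fin n → A)) (X j) = 0 :=
        Ideal.Quotient.eq_zero_iff_mem.2 (mem_gen _ j)
      simp [ρ, this])
    (by
      intro i j hij _
      refine ⟨X ⟨i, hij⟩ ^ q, ?_⟩
      have : Ideal.Quotient.mk (gen (X : Fin n → A)) (X i) = 0 :=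
        Ideal.Quotient.eq_zero_iff_mem.2 (mem_gen _ i)
      simp [ρ, this])
  let φ : MvPolynomial (Fin n) A →+* MvPolynomial (Fin n) k :=
    eval₂Hom (eval₂Hom C fun i => X i ^ q) X
  have hφC : ∀ c, φ (C (C c)) = C c := fun c => by
    change eval₂Hom _ _ _ = _
    rw [eval₂Hom_C, eval₂Hom_C]
  have hφCX : ∀ i, φ (C (X i)) = X i ^ q := fun i => by
    change eval₂Hom _ _ _ = _
    rw [eval₂Hom_C, eval₂Hom_X']
  have hφX : ∀ i, φ (X i) = X i := fun i => eval₂Hom_X' _ _ i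
  have hφ : Function.Surjective φ := by
    intro f
    refine ⟨MvPolynomial.map C f, ?_⟩
    simp only [φ, coe_eval₂Hom]
    rw [eval₂_map]
    have : (eval₂Hom C fun i => (X i : MvPolynomial (Fin n) k) ^ q).comp C = C := by
      ext; simp
    rw [this, eval₂_eta]
  have hker : RingHom.ker φ ≤ Ideal.span (Set.range ρ) := by
    have h2 : (Ideal.Quotient.mk (Ideal.span (Set.range ρ))).comp
        ((MvPolynomial.map (C : k →+* A)).comp φ) = Ideal.Quotient.mk _ := by
      apply MvPolynomial.ringHom_ext'
      · apply MvPolynomial.ringHom_ext'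
        · ext c
          simp only [RingHom.comp_apply]
          rw [hφC, map_C]
        · intro i
          simp only [RingHom.comp_apply]
          rw [hφCX, map_pow, map_X, Ideal.Quotient.eq]
          exact Ideal.subset_span ⟨i, rfl⟩
      · intro i
        simp only [RingHom.comp_apply]
        rw [hφX, map_X]
    intro f hf
    rw [RingHom.mem_ker] at hf
    have h3 := RingHom.congr_fun h2 f
    rw [RingHom.comp_apply, RingHom.comp_apply, hf, map_zero, map_zero] at h3
    exact Ideal.Quotient.eq_zero_iff_mem.1 h3.symm
  have h4 := h1.of_surjective hφ hker
  have h5 : (Ideal.span (Set.range ρ)).map φ = ⊥ := by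
    rw [eq_bot_iff, Ideal.map_span, Ideal.span_le]
    rintro _ ⟨_, ⟨i, rfl⟩, rfl⟩
    simp [ρ, hφX, hφCX]
  rw [h5] at h4
  convert h4 using 2
  exact (hφCX _).symm

/-- Powers of a quasi-regular sequence in an algebra over a field. -/
lemma QuasiRegular.pow_of_field [Field k] {A : Type*} [CommRing A] [Algebra k A] {Z : Fin n → A}
    (h : QuasiRegular Z ⊥) {q : ℕ} : QuasiRegular (fun i => Z i ^ q) ⊥ := by
  classical
  let Λ := MvPolynomial (Fin n) k
  let _ : Algebra Λ A := (aeval Z : Λ →ₐ[k] A).toAlgebra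
  have hX : algebraMap Λ A ∘ (X : Fin n → Λ) = Z := funext fun i => aeval_X Z i
  have hXq : algebraMap Λ A ∘ (fun i => (X i : Λ) ^ q) = fun i => Z i ^ q :=
    funext fun i => by
      rw [Function.comp_apply, map_pow]
      exact congrArg (· ^ q) (aeval_X Z i)
  obtain ⟨ι, b, hb⟩ := exists_free_family (z := (X : Fin n → Λ)) (E := A) gen_X_isMaximal
    (by rwa [hX])
  rw [hX] at hb
  intro ν F hF hm α
  rw [sup_bot_eq] at hm ⊢
  obtain ⟨M, hM⟩ : ∃ M, gen (X : Fin n → Λ) ^ M ≤ gen (fun i => (X i : Λ) ^ q) ^ (ν + 1) := by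
    refine Ideal.exists_pow_le_of_le_radical_of_fg ?_ (idealOfVars_fg (Fin n) k)
    rw [Ideal.radical_pow _ (by omega), Ideal.span_le]
    rintro _ ⟨i, rfl⟩
    exact ⟨q, mem_gen (fun i => (X i : Λ) ^ q) i⟩
  have hMA : gen Z ^ M ≤ gen (fun i => Z i ^ q) ^ (ν + 1) := by
    have := Ideal.map_mono (f := algebraMap Λ A) hM
    rwa [map_gen_pow, map_gen_pow, hX, hXq] at this
  have hc : ∀ a : A, ∃ l : ι →₀ Λ, a - Finsupp.linearCombination Λ b l ∈ gen Z ^ M := by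
    intro a
    obtain ⟨y, hy, w, hw, hyw⟩ := Submodule.mem_sup.1 ((hb M).1 (Submodule.mem_top (x := a)))
    rw [mem_pow_smul_top rfl, hX] at hw
    rw [Finsupp.mem_span_range_iff_exists_finsupp] at hy
    obtain ⟨l, rfl⟩ := hy
    exact ⟨l, by rw [← hyw, Finsupp.linearCombination_apply, add_sub_cancel_left]; exact hw⟩
  choose l hl using hc
  let G : ι → MvPolynomial (Fin n) Λ := fun i => ∑ d ∈ F.support, monomial d (l (F.coeff d) i)
  have hG : ∀ i, (G i).IsHomogeneous ν := fun i => by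
    refine IsHomogeneous.sum _ _ _ fun d hd => isHomogeneous_monomial _ ?_
    by_contra hne
    exact mem_support_iff.1 hd (hF.coeff_eq_zero hne)
  -- the combination of the evaluations of the `G i`
  let L : ι →₀ Λ := ∑ d ∈ F.support, (∏ i, (X i ^ q) ^ d i : Λ) • l (F.coeff d)
  have hL : ∀ i, L i = eval (fun i => (X i : Λ) ^ q) (G i) := by
    intro i
    simp only [L, G, Finsupp.finsetSum_apply, map_sum, eval_monomial, Finsupp.smul_apply,
      smul_eq_mul]
    refine Finset.sum_congr rfl fun d _ => ?_
    rw [mul_comm, Finsupp.prod_fintype _ _ (by simp)]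
  have hLF : eval (fun i => Z i ^ q) F - Finsupp.linearCombination Λ b L ∈ gen Z ^ M := by
    simp only [L, map_sum, map_smul]
    rw [eval_eq', ← Finset.sum_sub_distrib]
    refine Ideal.sum_mem _ fun d _ => ?_
    have : (∏ i, (X i ^ q) ^ d i : Λ) • Finsupp.linearCombination Λ b (l (F.coeff d)) =
        (∏ i, (Z i ^ q) ^ d i) * Finsupp.linearCombination Λ b (l (F.coeff d)) := by
      rw [Algebra.smul_def, map_prod]
      congr 1
      refine Finset.prod_congr rfl fun i _ => ?_
      rw [map_pow]
      exact congrArg (· ^ d i) (congrFun hXq i)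
    rw [this, mul_comm, ← mul_sub]
    exact Ideal.mul_mem_left _ _ (hl _)
  have hLm : Finsupp.linearCombination Λ b L ∈ gen (fun i => Z i ^ q) ^ (ν + 1) := by
    have := Ideal.sub_mem _ hm (hMA hLF)
    rwa [sub_sub_cancel] at this
  have hLi : ∀ i, L i ∈ gen (fun i => (X i : Λ) ^ q) ^ (ν + 1) := fun i => by
    refine mem_of_linearCombination_mem_map (z := (X : Fin n → Λ)) (M := M) (hb M).1 (by
      rw [hX]; exact (hb M).2) hM L ?_ i
    rwa [map_gen_pow, hXq]
  have hGc : ∀ i d, (G i).coeff d ∈ gen (fun i => (X i : Λ) ^ q) := fun i d => by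
    have := quasiRegular_X_pow (k := k) (n := n) (q := q) ν (G i) (hG i)
      (by rw [sup_bot_eq, ← hL]; exact hLi i) d
    rwa [sup_bot_eq] at this
  by_cases hα : α ∈ F.support
  swap
  · rw [notMem_support_iff.1 hα]; exact zero_mem _
  have hl2 : ∀ i, l (F.coeff α) i ∈ gen (fun i => (X i : Λ) ^ q) := by
    intro i
    have := hGc i α
    simpa [G, coeff_sum, coeff_monomial, Finset.sum_ite_eq', hα] using this
  have hfin : gen Z ^ M ≤ gen (fun i => Z i ^ q) :=
    hMA.trans ((gen_pow_mono _ (Nat.succ_le_succ (Nat.zero_le ν))).trans (by rw [pow_one]))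
  have h6 : Finsupp.linearCombination Λ b (l (F.coeff α)) ∈ gen (fun i => Z i ^ q) := by
    rw [Finsupp.linearCombination_apply, Finsupp.sum]
    refine Ideal.sum_mem _ fun i _ => ?_
    rw [Algebra.smul_def, ← hXq, ← map_gen]
    exact Ideal.mul_mem_right _ _ (Ideal.mem_map_of_mem _ (hl2 i))
  have := Ideal.add_mem _ (hfin (hl (F.coeff α))) h6
  rwa [sub_add_cancel] at this

end

section

open MvPolynomial

/-- Completeness and separatedness for the `I`-adic topology, in elementary terms. -/
def Complete {A : Type*} [CommRing A] (I : Ideal A) : Prop :=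
  (∀ a, (∀ M, a ∈ I ^ M) → a = 0) ∧
    ∀ u : ℕ → A, (∀ k, u (k + 1) - u k ∈ I ^ k) → ∃ L, ∀ k, L - u k ∈ I ^ k

variable {A B O : Type*} [CommRing A] [CommRing B] [CommRing O]

lemma Complete.eq_of_sub_mem {I : Ideal A} (h : Complete I) {a b : A}
    (hab : ∀ M, a - b ∈ I ^ M) : a = b := sub_eq_zero.1 (h.1 _ hab)

lemma complete_of_isAdicComplete (I : Ideal A) [h : IsAdicComplete I A] : Complete I := by
  have hI : ∀ k (a : A), a ∈ (I ^ k • ⊤ : Submodule A A) ↔ a ∈ I ^ k := fun k a => by simp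
  constructor
  · intro a ha
    refine h.haus' a fun n => ?_
    rw [SModEq.zero, hI]
    exact ha n
  · intro u hu
    have hmono : ∀ {m n : ℕ}, m ≤ n → u m - u n ∈ I ^ m := by
      intro m n hmn
      induction n, hmn using Nat.le_induction with
      | base => simp
      | succ n hn ih =>
        have := Ideal.sub_mem _ ih (Ideal.pow_le_pow_right hn (hu n))
        convert this using 1
        ring
    obtain ⟨L, hL⟩ := h.prec' u fun {m n} hmn => by
      rw [SModEq.sub_mem, hI]
      exact hmono hmn
    refine ⟨L, fun k => ?_⟩
    have := hL k
    rw [SModEq.sub_mem, hI] at this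
    rw [← neg_sub]
    exact neg_mem this

/-- A map `f` is `I`-adically dense and an isomorphism modulo powers of `I`. -/
structure AdicDense (f : A →+* B) (I : Ideal A) : Prop where
  mem : ∀ M a, f a ∈ (I.map f) ^ M → a ∈ I ^ M
  dense : ∀ M b, ∃ a, b - f a ∈ (I.map f) ^ M

universe w

lemma exists_completion {A : Type w} [CommRing A] (I : Ideal A) (hI : I.FG) :
    ∃ (B : Type w) (_ : CommRing B) (f : A →+* B), Complete (I.map f) ∧ AdicDense f I := by
  let f := algebraMap A (AdicCompletion I A)
  have hmap : ∀ (M : ℕ) (b : AdicCompletion I A), b ∈ (I.map f) ^ M ↔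
      b ∈ (I ^ M • ⊤ : Submodule A (AdicCompletion I A)) := by
    intro M b
    rw [Ideal.smul_top_eq_map, Submodule.restrictScalars_mem, Ideal.map_pow]
  have hker : ∀ (M : ℕ) (b : AdicCompletion I A), b ∈ (I.map f) ^ M ↔
      AdicCompletion.eval I A M b = 0 := by
    intro M b
    rw [hmap, AdicCompletion.pow_smul_top_eq_ker_eval hI, LinearMap.mem_ker]
  refine ⟨AdicCompletion I A, inferInstance, f, ?_, ?_, ?_⟩
  · have h := AdicCompletion.isAdicComplete (M := A) hI
    have h2 : IsAdicComplete (I.map f) (AdicCompletion I A) := by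
      have := (IsAdicComplete.map_algebraMap_iff (I := I) (S := AdicCompletion I A)
        (M := AdicCompletion I A)).2 h
      exact this
    exact complete_of_isAdicComplete _
  · intro M a ha
    rw [hker] at ha
    have : AdicCompletion.eval I A M (AdicCompletion.of I A a) = 0 := ha
    rw [AdicCompletion.eval_of, Submodule.mkQ_apply, Submodule.Quotient.mk_eq_zero] at this
    simpa using this
  · intro M b
    obtain ⟨a, ha⟩ := Submodule.mkQ_surjective _ (AdicCompletion.eval I A M b)
    refine ⟨a, ?_⟩
    rw [hker, map_sub, ← ha]
    have : AdicCompletion.eval I A M (f a) = _ := AdicCompletion.eval_of I A M a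
    rw [this, sub_self]

lemma map_pow_le {f : A →+* B} {I : Ideal A} {K : Ideal B} (h : I.map f ≤ K) {M : ℕ} {a : A}
    (ha : a ∈ I ^ M) : f a ∈ K ^ M := by
  have := Ideal.mem_map_of_mem f ha
  rw [Ideal.map_pow] at this
  exact Ideal.pow_right_mono h M this

lemma AdicDense.exists_lift {f : A →+* B} {I : Ideal A} (h : AdicDense f I) {K : Ideal O}
    (hO : Complete K) {g : A →+* O} (hg : I.map g ≤ K) :
    ∃ g' : B →+* O, g'.comp f = g ∧ (I.map f).map g' ≤ K := by
  have h1 : ∀ b : B, ∃ L : O, ∀ M a, b - f a ∈ (I.map f) ^ M → L - g a ∈ K ^ M := by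
    intro b
    choose u hu using fun M => h.dense M b
    have hab : ∀ M a a', b - f a ∈ (I.map f) ^ M → b - f a' ∈ (I.map f) ^ M →
        g a - g a' ∈ K ^ M := by
      intro M a a' ha ha'
      rw [← map_sub]
      refine map_pow_le hg (h.mem M _ ?_)
      rw [map_sub]
      have := Ideal.sub_mem _ ha' ha
      rwa [sub_sub_sub_cancel_left] at this
    obtain ⟨L, hL⟩ := hO.2 (fun k => g (u k)) fun k =>
      hab k _ _ (Ideal.pow_le_pow_right (Nat.le_succ k) (hu (k + 1))) (hu k)
    refine ⟨L, fun M a ha => ?_⟩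
    have := Ideal.add_mem _ (hL M) (hab M _ _ (hu M) ha)
    rwa [sub_add_sub_cancel] at this
  choose L hL using h1
  have huniq : ∀ b L', (∀ M, ∃ a, b - f a ∈ (I.map f) ^ M ∧ L' - g a ∈ K ^ M) → L b = L' := by
    intro b L' hL'
    refine hO.eq_of_sub_mem fun M => ?_
    obtain ⟨a, ha, ha'⟩ := hL' M
    have := Ideal.sub_mem _ (hL b M a ha) ha'
    rwa [sub_sub_sub_cancel_right] at this
  have hLf : ∀ a, L (f a) = g a := fun a => huniq _ _ fun M => ⟨a, by simp, by simp⟩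
  let g' : B →+* O :=
    { toFun := L
      map_one' := by rw [← map_one f, hLf, map_one]
      map_zero' := by rw [← map_zero f, hLf, map_zero]
      map_add' := fun b c => huniq _ _ fun M => by
        obtain ⟨a, ha⟩ := h.dense M b
        obtain ⟨a', ha'⟩ := h.dense M c
        refine ⟨a + a', ?_, ?_⟩
        · rw [map_add, add_sub_add_comm]; exact Ideal.add_mem _ ha ha'
        · rw [map_add, add_sub_add_comm]; exact Ideal.add_mem _ (hL _ _ _ ha) (hL _ _ _ ha')
      map_mul' := fun b c => huniq _ _ fun M => by
        obtain ⟨a, ha⟩ := h.dense M b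
        obtain ⟨a', ha'⟩ := h.dense M c
        refine ⟨a * a', ?_, ?_⟩
        · rw [map_mul, show b * c - f a * f a' = (b - f a) * c + f a * (c - f a') by ring]
          exact Ideal.add_mem _ (Ideal.mul_mem_right _ _ ha) (Ideal.mul_mem_left _ _ ha')
        · rw [map_mul, show L b * L c - g a * g a' = (L b - g a) * L c + g a * (L c - g a') by ring]
          exact Ideal.add_mem _ (Ideal.mul_mem_right _ _ (hL _ _ _ ha))
            (Ideal.mul_mem_left _ _ (hL _ _ _ ha')) }
  refine ⟨g', RingHom.ext hLf, ?_⟩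
  rw [Ideal.map_map, show g'.comp f = g from RingHom.ext hLf]
  exact hg

lemma AdicDense.hom_ext {f : A →+* B} {I : Ideal A} (h : AdicDense f I) {K : Ideal O}
    (hO : ∀ a, (∀ M, a ∈ K ^ M) → a = 0) {g₁ g₂ : B →+* O} (hg : (I.map f).map g₁ ≤ K)
    (he : g₁.comp f = g₂.comp f) : g₁ = g₂ := by
  have hg2 : (I.map f).map g₂ ≤ K := by rwa [Ideal.map_map, ← he, ← Ideal.map_map]
  ext b
  refine sub_eq_zero.1 (hO _ fun M => ?_)
  obtain ⟨a, ha⟩ := h.dense M b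
  have h1 := map_pow_le hg ha
  have h2 := map_pow_le hg2 ha
  have := Ideal.sub_mem _ h1 h2
  rwa [map_sub, map_sub, show g₁ (f a) = g₂ (f a) from RingHom.congr_fun he a,
    sub_sub_sub_cancel_right] at this

lemma QuasiRegular.completion {n : ℕ} {x : Fin n → A} (h : QuasiRegular x ⊥) {f : A →+* B}
    (hf : AdicDense f (gen x)) : QuasiRegular (f ∘ x) ⊥ := by
  refine h.map_of_dense (f := f) (fun M a ha => hf.mem M a ?_) fun b => ?_
  · rwa [map_gen]
  · simpa [map_gen] using hf.dense 1 b

lemma AdicDense.ne_top {f : A →+* B} {I : Ideal A} (h : AdicDense f I) (hI : I ≠ ⊤) :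
    I.map f ≠ ⊤ := by
  intro ht
  refine hI ((Ideal.eq_top_iff_one _).2 ?_)
  simpa using h.mem 1 1 (by rw [ht]; simp)

end

section

open MvPolynomial

section

universe w

variable {n : ℕ}

lemma exists_gen_pow_le {A : Type*} [CommRing A] (Z : Fin n → A) (Q : ℕ) :
    ∃ M, gen Z ^ M ≤ gen (fun i => Z i ^ Q) := by
  classical
  refine Ideal.exists_pow_le_of_le_radical_of_fg ?_ ⟨Finset.univ.image Z, by simp⟩
  rw [Ideal.span_le]
  rintro _ ⟨i, rfl⟩
  exact ⟨Q, mem_gen (fun i => Z i ^ Q) i⟩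

variable {B : Type*} [CommRing B] (p : ℕ) [Fact p.Prime] [CharP B p]

lemma mem_gen_of_pow_mem [PerfectRing B p] {Z : Fin n → B} {m : ℕ} {a : B}
    (h : a ^ p ^ m ∈ gen (fun i => Z i ^ p ^ m)) : a ∈ gen Z := by
  have h1 : gen (fun i => Z i ^ p ^ m) =
      (gen Z).map (iterateFrobeniusEquiv B p m : B →+* B) := by
    rw [map_gen]; rfl
  rw [h1] at h
  replace h := (Ideal.mem_map_iff_of_surjective (iterateFrobeniusEquiv B p m : B →+* B)
    (iterateFrobeniusEquiv B p m).surjective).1 h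
  obtain ⟨b, hb, hba⟩ := h
  have : b = a := (iterateFrobeniusEquiv B p m).injective hba
  rwa [← this]

lemma exists_root [PerfectRing B p] (m : ℕ) (a : B) : ∃ b, b ^ p ^ m = a :=
  (iterateFrobeniusEquiv B p m).surjective a

lemma pow_eq_pow [PerfectRing B p] {m : ℕ} {a b : B} (h : a ^ p ^ m = b ^ p ^ m) : a = b :=
  (iterateFrobeniusEquiv B p m).injective h

/-- In a perfect ring, roots of elements of a high power of an ideal are in a high power. -/
lemma exists_mem_of_pow_mem [PerfectRing B p] (Z : Fin n → B) (m N : ℕ) :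
    ∃ M, ∀ a : B, a ^ p ^ m ∈ gen Z ^ M → a ∈ gen Z ^ N := by
  obtain ⟨M, hM⟩ := exists_gen_pow_le Z (N * p ^ m)
  refine ⟨M, fun a ha => ?_⟩
  have h1 : a ∈ gen (fun i => Z i ^ N) :=
    mem_gen_of_pow_mem p (m := m) (by simpa only [← pow_mul] using hM ha)
  refine (Ideal.span_le.2 ?_ : gen (fun i => Z i ^ N) ≤ gen Z ^ N) h1
  rintro _ ⟨i, rfl⟩
  exact Ideal.pow_mem_pow (mem_gen Z i) N

end

section

variable {n : ℕ} {A : Type*} [CommRing A] (p : ℕ) [Fact p.Prime] [CharP A p]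

lemma exists_pow_eq_of (s : Finset (PerfectClosure A p)) :
    ∃ m, ∀ c ∈ s, ∃ a, c ^ p ^ m = PerfectClosure.of A p a := by
  have h1 : ∀ c : PerfectClosure A p, ∃ m a, c ^ p ^ m = PerfectClosure.of A p a := by
    intro c
    induction c using PerfectClosure.induction_on with
    | _ x =>
      refine ⟨x.1, x.2, ?_⟩
      rw [← PerfectClosure.iterate_frobenius_mk, ← coe_iterateFrobenius, iterateFrobenius_def]
  choose m a hm using h1
  refine ⟨s.sup m, fun c hc => ⟨a c ^ p ^ (s.sup m - m c), ?_⟩⟩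
  rw [map_pow, ← hm, ← pow_mul, ← pow_add, Nat.add_sub_cancel' (Finset.le_sup hc)]

lemma exists_pow_eq_of_of_eq {a b : A} (h : PerfectClosure.of A p a = PerfectClosure.of A p b) :
    ∃ k, a ^ p ^ k = b ^ p ^ k := by
  rw [PerfectClosure.of_apply, PerfectClosure.of_apply, PerfectClosure.mk_eq_iff] at h
  obtain ⟨k, hk⟩ := h
  refine ⟨k, ?_⟩
  simpa only [zero_add, ← coe_iterateFrobenius, iterateFrobenius_def] using hk

lemma exists_map_of_eq {F : MvPolynomial (Fin n) (PerfectClosure A p)} {ν m : ℕ}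
    (hF : F.IsHomogeneous ν)
    (h : ∀ d ∈ F.support, ∃ a, F.coeff d ^ p ^ m = PerfectClosure.of A p a) :
    ∃ F' : MvPolynomial (Fin n) A, F'.IsHomogeneous ν ∧
      MvPolynomial.map (PerfectClosure.of A p) F' =
        MvPolynomial.map (iterateFrobenius (PerfectClosure A p) p m) F := by
  classical
  choose! a ha using h
  refine ⟨∑ d ∈ F.support, monomial d (a d), IsHomogeneous.sum _ _ _ fun d hd =>
    isHomogeneous_monomial _ ?_, ?_⟩
  · by_contra hne
    exact mem_support_iff.1 hd (hF.coeff_eq_zero hne)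
  · conv_rhs => rw [F.as_sum, map_sum]
    rw [map_sum]
    refine Finset.sum_congr rfl fun d hd => ?_
    rw [map_monomial, map_monomial, ← ha d hd, iterateFrobenius_def]

lemma QuasiRegular.perfectClosure {Z : Fin n → A} (h : QuasiRegular Z ⊥) :
    QuasiRegular (PerfectClosure.of A p ∘ Z) ⊥ := by
  classical
  let _ : Algebra (ZMod p) A := ZMod.algebra A p
  intro ν F hF hm α
  rw [sup_bot_eq] at hm ⊢
  obtain ⟨G, hG, hFG⟩ := exists_homogeneous_of_mem_pow (ν + 1) hm
  obtain ⟨m, hms⟩ := exists_pow_eq_of p ((F.support.image F.coeff) ∪ (G.support.image G.coeff))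
  obtain ⟨F', hF', hFF'⟩ := exists_map_of_eq p (m := m) hF fun d hd => hms _
    (Finset.mem_union_left _ (Finset.mem_image_of_mem _ hd))
  obtain ⟨G', hG', hGG'⟩ := exists_map_of_eq p (m := m) hG fun d hd => hms _
    (Finset.mem_union_right _ (Finset.mem_image_of_mem _ hd))
  have key : ∀ (F : MvPolynomial (Fin n) (PerfectClosure A p)) (F' : MvPolynomial (Fin n) A),
      MvPolynomial.map (PerfectClosure.of A p) F' =
        MvPolynomial.map (iterateFrobenius (PerfectClosure A p) p m) F →
      PerfectClosure.of A p (eval (fun i => Z i ^ p ^ m) F') =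
        eval (PerfectClosure.of A p ∘ Z) F ^ p ^ m := by
    intro F F' hFF'
    rw [← eval_map_comp, hFF', ← iterateFrobenius_def, ← eval_map_comp]
    congr 2
    ext i
    simp [iterateFrobenius_def]
  obtain ⟨k, hk⟩ := exists_pow_eq_of_of_eq p
    (a := eval (fun i => Z i ^ p ^ m) F') (b := eval (fun i => Z i ^ p ^ m) G')
    (by rw [key F F' hFF', key G G' hGG', hFG])
  have hpow : ∀ H : MvPolynomial (Fin n) A, (eval (fun i => Z i ^ p ^ m) H) ^ p ^ k =
      eval (fun i => Z i ^ p ^ (m + k)) (MvPolynomial.map (iterateFrobenius A p k) H) := by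
    intro H
    rw [← iterateFrobenius_def, ← eval_map_comp]
    congr 2
    ext i
    simp [iterateFrobenius_def, pow_add, pow_mul]
  rw [hpow, hpow] at hk
  have h2 := h.pow_of_field (k := ZMod p) (q := p ^ (m + k)) ν
    (MvPolynomial.map (iterateFrobenius A p k) F')
    (hF'.map _) (by
      rw [sup_bot_eq, hk]
      exact eval_mem_pow (hG'.map _)) α
  rw [sup_bot_eq, coeff_map, iterateFrobenius_def] at h2
  have h3 := Ideal.mem_map_of_mem (PerfectClosure.of A p) h2
  rw [map_gen] at h3
  refine mem_gen_of_pow_mem p (m := m + k) ?_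
  convert h3 using 1
  · exact congrArg gen (funext fun i => by simp)
  · have := congrArg (coeff α) hFF'
    rw [coeff_map, coeff_map, iterateFrobenius_def] at this
    rw [map_pow, this, pow_add, pow_mul]

lemma gen_perfectClosure_ne_top {Z : Fin n → A} (h : gen Z ≠ ⊤) :
    gen (PerfectClosure.of A p ∘ Z) ≠ ⊤ := by
  classical
  intro h1
  rw [Ideal.eq_top_iff_one, ← pow_one (gen _)] at h1
  obtain ⟨G, hG, hFG⟩ := exists_homogeneous_of_mem_pow 1 h1
  obtain ⟨m, hms⟩ := exists_pow_eq_of p (G.support.image G.coeff)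
  obtain ⟨G', hG', hGG'⟩ := exists_map_of_eq p (m := m) hG fun d hd => hms _
    (Finset.mem_image_of_mem _ hd)
  have h2 : PerfectClosure.of A p (eval (fun i => Z i ^ p ^ m) G') = PerfectClosure.of A p 1 := by
    rw [← eval_map_comp, hGG', map_one, ← one_pow (p ^ m), ← hFG, ← iterateFrobenius_def,
      ← eval_map_comp]
    congr 2
    ext i
    simp [iterateFrobenius_def]
  obtain ⟨k, hk⟩ := exists_pow_eq_of_of_eq p h2
  rw [one_pow] at hk
  refine h ((Ideal.eq_top_iff_one _).2 ?_)
  rw [← hk]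
  have h3 : eval (fun i => Z i ^ p ^ m) G' ∈ gen Z := by
    have := eval_mem_pow (x := fun i => Z i ^ p ^ m) hG'
    rw [pow_one] at this
    refine (Ideal.span_le.2 ?_ : gen (fun i => Z i ^ p ^ m) ≤ gen Z) this
    rintro _ ⟨i, rfl⟩
    exact Ideal.pow_mem_of_mem _ (mem_gen Z i) _ (pow_pos (Fact.out : p.Prime).pos m)
  exact Ideal.pow_mem_of_mem _ h3 _ (pow_pos (Fact.out : p.Prime).pos k)

end

section

universe w

lemma charP_of_ringHom {A B : Type*} [CommRing A] [CommRing B] (p : ℕ) [Fact p.Prime] [CharP A p]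
    [Nontrivial B] (f : A →+* B) : CharP B p :=
  charP_of_injective_ringHom (f.comp (ZMod.castHom dvd_rfl A)).injective p

variable {n : ℕ}

lemma perfectRing_completion {A B : Type*} [CommRing A] [CommRing B] (p : ℕ) [Fact p.Prime]
    [CharP A p] [CharP B p] [PerfectRing A p] {Z : Fin n → A} {f : A →+* B}
    (hc : Complete ((gen Z).map f)) (hf : AdicDense f (gen Z)) : PerfectRing B p := by
  have hp : p ≠ 0 := (Fact.out : p.Prime).ne_zero
  choose M hM using fun N => exists_mem_of_pow_mem (B := A) p Z 1 N
  simp only [pow_one] at hM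
  set J := (gen Z).map f with hJ
  have hfr : ∀ x y : B, x ^ p - y ^ p = (x - y) ^ p := fun x y => (sub_pow_char x y).symm
  have hle : ∀ {a b : ℕ} {x : B}, a ≤ b → x ∈ J ^ b → x ∈ J ^ a :=
    fun h hx => Ideal.pow_le_pow_right h hx
  have hmem : ∀ {N : ℕ} {a : A}, a ∈ gen Z ^ N → f a ∈ J ^ N := fun ha => map_pow_le le_rfl ha
  refine ⟨⟨?_, ?_⟩⟩
  · change Function.Injective (frobenius B p)
    rw [injective_iff_map_eq_zero]
    intro b hb
    rw [frobenius_def] at hb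
    refine hc.1 b fun N => ?_
    obtain ⟨a, ha⟩ := hf.dense (max (M N) N) b
    have h1 : f (a ^ p) ∈ J ^ M N := by
      have := hfr b (f a)
      rw [hb, zero_sub, ← map_pow] at this
      rw [← neg_mem_iff, this]
      exact Ideal.pow_mem_of_mem _ (hle (le_max_left _ _) ha) _ hp.bot_lt
    have h2 := hmem (hM N a (hf.mem _ _ h1))
    rw [← sub_add_cancel b (f a)]
    exact add_mem (hle (le_max_right _ _) ha) h2
  · intro b
    let K : ℕ → ℕ := fun N => ∑ j ∈ Finset.range (N + 1), (M j + j)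
    have hK1 : ∀ N, M N + N ≤ K N := fun N => by
      simp only [K]
      rw [Finset.sum_range_succ]
      omega
    have hK2 : ∀ N, K N ≤ K (N + 1) := fun N => by
      simp only [K]
      rw [Finset.sum_range_succ _ (N + 1)]
      omega
    choose a ha using fun N => hf.dense (K N) b
    choose r hr using fun N => exists_root (B := A) p 1 (a N)
    simp only [pow_one] at hr
    obtain ⟨L, hL⟩ := hc.2 (fun N => f (r N)) fun N => by
      rw [← map_sub]
      refine hmem (hM N _ (hf.mem _ _ ?_))
      rw [sub_pow_char, hr, hr, map_sub]
      have := sub_mem (hle (hK2 N) (ha (N + 1))) (ha N)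
      rw [← neg_mem_iff]
      rw [sub_sub_sub_cancel_left, ← neg_sub] at this
      exact hle (by have := hK1 N; omega) this
    refine ⟨L, hc.eq_of_sub_mem fun N => ?_⟩
    change L ^ p - b ∈ _
    have h1 : L ^ p - f (a N) ∈ J ^ N := by
      rw [← hr, map_pow, hfr]
      exact Ideal.pow_mem_of_mem _ (hL N) _ hp.bot_lt
    have := sub_mem h1 (hle (by have := hK1 N; omega) (ha N) : b - f (a N) ∈ J ^ N)
    rwa [sub_sub_sub_cancel_right] at this

/-- A ring complete for the topology defined by a quasi-regular sequence. -/
structure GoodBase {B : Type*} [CommRing B] (Z : Fin n → B) : Prop where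
  complete : Complete (gen Z)
  qr : QuasiRegular Z ⊥
  ne_top : gen Z ≠ ⊤

/-- The completed perfection of a ring of characteristic `p`. -/
theorem exists_completed_perfection {A : Type w} [CommRing A] (p : ℕ) [Fact p.Prime] [CharP A p]
    {Z : Fin n → A} (h : QuasiRegular Z ⊥) (hZ : gen Z ≠ ⊤) :
    ∃ (B : Type w) (_ : CommRing B) (_ : CharP B p) (_ : PerfectRing B p) (f : A →+* B),
      GoodBase (f ∘ Z) ∧ ∀ (E : Type w) [CommRing E] [CharP E p] [PerfectRing E p] (g : A →+* E)
        (K : Ideal E), Complete K → gen (g ∘ Z) ≤ K → ∃ g' : B →+* E, g'.comp f = g := by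
  classical
  let P := PerfectClosure A p
  let o : A →+* P := PerfectClosure.of A p
  obtain ⟨B, _, f, hc, hf⟩ := exists_completion (gen (o ∘ Z)) ⟨Finset.univ.image (o ∘ Z), by
    rw [Finset.coe_image, Finset.coe_univ, Set.image_univ]⟩
  have htop := hf.ne_top (gen_perfectClosure_ne_top p hZ)
  have : Nontrivial B := by
    by_contra hn
    rw [not_nontrivial_iff_subsingleton] at hn
    exact htop (Subsingleton.elim _ _)
  have : CharP B p := charP_of_ringHom p f
  refine ⟨B, inferInstance, this, perfectRing_completion p hc hf, f.comp o, ⟨?_, ?_, ?_⟩, ?_⟩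
  · rw [map_gen] at hc; exact hc
  · exact (h.perfectClosure p).completion hf
  · rw [map_gen] at htop; exact htop
  · intro E _ _ _ g K hg hK
    let l : P →+* E := PerfectClosure.lift A p E g
    have hl : l.comp o = g := (PerfectClosure.lift A p E).symm_apply_apply g
    obtain ⟨g', hg', -⟩ := hf.exists_lift hg (g := l) (by
      rw [map_gen]; exact le_trans (by rw [← hl]; exact le_rfl) hK)
    exact ⟨g', by rw [← RingHom.comp_assoc, hg', hl]⟩

end

end

section

open MvPolynomial

variable {n : ℕ} {B : Type*} [CommRing B] (p : ℕ) [hp : Fact p.Prime]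

/-- Witt vectors whose first coefficients are in an ideal. -/
noncomputable def wittKer (I : Ideal B) (k : ℕ) : Ideal (WittVector p B) :=
  RingHom.ker ((WittVector.truncate k).comp (WittVector.map (Ideal.Quotient.mk I)))

variable {p}

lemma mem_wittKer {I : Ideal B} {k : ℕ} {u : WittVector p B} :
    u ∈ wittKer p I k ↔ ∀ i < k, u.coeff i ∈ I := by
  rw [wittKer, RingHom.mem_ker, RingHom.comp_apply, ← RingHom.mem_ker, WittVector.mem_ker_truncate]
  refine forall_congr' fun i => forall_congr' fun _ => ?_
  rw [WittVector.map_coeff, Ideal.Quotient.eq_zero_iff_mem]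

lemma sub_mem_wittKer {I : Ideal B} {k : ℕ} {u v : WittVector p B} :
    u - v ∈ wittKer p I k ↔ ∀ i < k, u.coeff i - v.coeff i ∈ I := by
  rw [wittKer, RingHom.mem_ker, map_sub, sub_eq_zero, RingHom.comp_apply, RingHom.comp_apply]
  constructor
  · intro h i hi
    have := congrArg (TruncatedWittVector.coeff ⟨i, hi⟩) h
    rw [WittVector.coeff_truncate, WittVector.coeff_truncate, WittVector.map_coeff,
      WittVector.map_coeff] at this
    exact Ideal.Quotient.eq.1 this
  · intro h
    ext i
    rw [WittVector.coeff_truncate, WittVector.coeff_truncate, WittVector.map_coeff,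
      WittVector.map_coeff]
    exact Ideal.Quotient.eq.2 (h i i.2)

variable (p)

/-- The Teichmüller lift of a sequence, preceded by `p`. -/
noncomputable abbrev wittSeq (Z : Fin n → B) : Fin (n + 1) → WittVector p B :=
  Fin.cons (p : WittVector p B) (WittVector.teichmuller p ∘ Z)

variable {p}

lemma exists_gen_teichmuller_pow_le (Z : Fin n → B) (N : ℕ) :
    ∃ M, ∀ k, gen (WittVector.teichmuller p ∘ Z) ^ M ≤ wittKer p (gen Z ^ N) k := by
  obtain ⟨M, hM⟩ := exists_gen_pow_le (WittVector.teichmuller p ∘ Z) N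
  refine ⟨M, fun k => hM.trans (Ideal.span_le.2 ?_)⟩
  rintro _ ⟨i, rfl⟩
  rw [SetLike.mem_coe, mem_wittKer]
  intro j _
  change ((WittVector.teichmuller p (Z i)) ^ N).coeff j ∈ _
  rw [← map_pow]
  rcases Nat.eq_zero_or_pos j with rfl | h
  · rw [WittVector.teichmuller_coeff_zero]
    exact Ideal.pow_mem_pow (mem_gen Z i) _
  · rw [WittVector.teichmuller_coeff_pos _ _ _ h]
    exact zero_mem _

variable [CharP B p]

lemma exists_pow_le_wittKer (Z : Fin n → B) (k N : ℕ) :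
    ∃ M, gen (wittSeq p Z) ^ M ≤ wittKer p (gen Z ^ N) k := by
  obtain ⟨M, hM⟩ := exists_gen_pow_le (wittSeq p Z) (max k N)
  refine ⟨M, hM.trans (Ideal.span_le.2 ?_)⟩
  rintro _ ⟨i, rfl⟩
  rw [SetLike.mem_coe, mem_wittKer]
  intro j hj
  refine Fin.cases ?_ (fun i => ?_) i
  · change ((p : WittVector p B) ^ max k N).coeff j ∈ _
    rw [WittVector.coeff_p_pow_eq_zero _ _ (by omega)]
    exact zero_mem _
  · change ((WittVector.teichmuller p (Z i)) ^ max k N).coeff j ∈ _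
    rw [← map_pow]
    rcases Nat.eq_zero_or_pos j with rfl | h
    · rw [WittVector.teichmuller_coeff_zero]
      exact Ideal.pow_le_pow_right (le_max_right _ _) (Ideal.pow_mem_pow (mem_gen Z i) _)
    · rw [WittVector.teichmuller_coeff_pos _ _ _ h]
      exact zero_mem _

variable [PerfectRing B p]

lemma gen_wittSeq (Z : Fin n → B) :
    gen (wittSeq p Z) = (gen Z).comap (WittVector.constantCoeff : WittVector p B →+* B) := by
  have h1 : WittVector.constantCoeff ∘ (WittVector.teichmuller p ∘ Z) = Z :=
    funext fun i => WittVector.teichmuller_coeff_zero p (Z i)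
  have h2 : (gen (WittVector.teichmuller p ∘ Z)).map
      (WittVector.constantCoeff : WittVector p B →+* B) = gen Z := by
    rw [map_gen, h1]
  rw [gen_cons, ← h2, Ideal.comap_map_of_surjective' _ (WittVector.constantCoeff_surjective p),
    WittVector.ker_constantCoeff, sup_comm]

lemma mem_gen_wittSeq {Z : Fin n → B} {u : WittVector p B} :
    u ∈ gen (wittSeq p Z) ↔ u.coeff 0 ∈ gen Z := by
  rw [gen_wittSeq]; exact Iff.rfl

lemma exists_teichmuller_mem_pow (Z : Fin n → B) (k : ℕ) :
    ∃ N, ∀ b ∈ gen Z ^ N, WittVector.teichmuller p b ∈ gen (wittSeq p Z) ^ k := by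
  obtain ⟨N, hN⟩ := exists_gen_pow_le Z (p ^ k)
  refine ⟨N, fun b hb => ?_⟩
  obtain ⟨w, rfl⟩ := exists_root p k b
  have hw : w ∈ gen Z := mem_gen_of_pow_mem p (hN hb)
  rw [map_pow]
  exact Ideal.pow_le_pow_right (Nat.lt_pow_self hp.out.one_lt).le
    (Ideal.pow_mem_pow (mem_gen_wittSeq.2 hw) _)

/-- The adic topology on Witt vectors is finer than the coefficientwise topology. -/
lemma exists_wittKer_le (Z : Fin n → B) (k : ℕ) :
    ∃ N, wittKer p (gen Z ^ N) k ≤ gen (wittSeq p Z) ^ k := by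
  obtain ⟨N₀, hN₀⟩ := exists_teichmuller_mem_pow (p := p) Z k
  choose N hN using fun i => exists_mem_of_pow_mem p Z i N₀
  refine ⟨∑ i ∈ Finset.range k, N i, fun u hu => ?_⟩
  rw [mem_wittKer] at hu
  have hpJ : (p : WittVector p B) ∈ gen (wittSeq p Z) := mem_gen (wittSeq p Z) 0
  rcases k with _ | k
  · simp
  obtain ⟨c, hc⟩ := WittVector.dvd_sub_sum_teichmuller_iterateFrobeniusEquiv_coeff u k
  rw [sub_eq_iff_eq_add] at hc
  rw [hc]
  refine add_mem (Ideal.mul_mem_right _ _ (Ideal.pow_mem_pow hpJ _))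
    (Ideal.sum_mem _ fun i hi => ?_)
  rw [Finset.mem_Iic] at hi
  refine Ideal.mul_mem_right _ _ (hN₀ _ (hN i _ ?_))
  have h1 : ∀ (i : ℕ) (b : B), (((frobeniusEquiv B p).symm ^ i) b) ^ p ^ i = b := by
    intro i
    induction i with
    | zero => intro b; simp
    | succ i ih =>
      intro b
      rw [pow_succ (frobeniusEquiv B p).symm, pow_succ, pow_mul]
      change ((((frobeniusEquiv B p).symm ^ i) _) ^ p ^ i) ^ p = b
      rw [ih]
      exact frobeniusEquiv_symm_pow_p B p b
  rw [h1]
  refine Ideal.pow_le_pow_right (Finset.single_le_sum (f := N) (fun _ _ => Nat.zero_le _)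
    (Finset.mem_range.2 (Nat.lt_succ_of_le hi))) (hu i (by omega))

variable {Z : Fin n → B}

lemma wittSeq_colon (Z : Fin n → B) (K : ℕ) :
    ∃ K', ∀ u : WittVector p B, p * u ∈ gen (WittVector.teichmuller p ∘ Z) ^ K' →
      u ∈ gen (wittSeq p Z) ^ K := by
  obtain ⟨N, hN⟩ := exists_wittKer_le (p := p) Z K
  obtain ⟨N', hN'⟩ := exists_mem_of_pow_mem p Z 1 N
  obtain ⟨K', hK'⟩ := exists_gen_teichmuller_pow_le (p := p) Z N'
  refine ⟨K', fun u hu => hN (mem_wittKer.2 fun i hi => hN' _ ?_)⟩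
  have := mem_wittKer.1 (hK' (i + 2) hu) (i + 1) (by omega)
  rw [mul_comm, WittVector.mul_charP_coeff_succ] at this
  rwa [pow_one]

lemma QuasiRegular.teichmuller (h : QuasiRegular Z ⊥) :
    QuasiRegular (WittVector.teichmuller p ∘ Z) (Ideal.span {(p : WittVector p B)}) := by
  have h1 : WittVector.constantCoeff ∘ (WittVector.teichmuller p ∘ Z) = Z :=
    funext fun i => WittVector.teichmuller_coeff_zero p (Z i)
  have := QuasiRegular.comap (WittVector.constantCoeff_surjective p)
    (x := WittVector.teichmuller p ∘ Z) (I := ⊥) (by rwa [h1])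
  rwa [← RingHom.ker_eq_comap_bot, WittVector.ker_constantCoeff] at this

lemma QuasiRegular.wittSeq (h : QuasiRegular Z ⊥) : QuasiRegular (wittSeq p Z) ⊥ :=
  h.teichmuller.cons_of_colon (wittSeq_colon Z)

lemma gen_wittSeq_ne_top (h : gen Z ≠ ⊤) : gen (wittSeq p Z) ≠ ⊤ := by
  intro ht
  have : (1 : WittVector p B) ∈ gen (wittSeq p Z) := by rw [ht]; trivial
  rw [mem_gen_wittSeq, WittVector.one_coeff_zero] at this
  exact h ((Ideal.eq_top_iff_one _).2 this)

lemma Complete.exists_limit {A : Type*} [CommRing A] {I : Ideal A} (h : Complete I) {u : ℕ → A}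
    (hu : ∀ N, ∃ M, ∀ k ≥ M, u k - u M ∈ I ^ N) :
    ∃ L, ∀ N, ∃ M, ∀ k ≥ M, L - u k ∈ I ^ N := by
  choose M hM using hu
  let M' : ℕ → ℕ := fun N => ∑ j ∈ Finset.range (N + 1), M j
  have hM1 : ∀ N, M N ≤ M' N := fun N => by
    simp only [M']; rw [Finset.sum_range_succ]; omega
  have hM2 : ∀ N, M' N ≤ M' (N + 1) := fun N => by
    simp only [M']; rw [Finset.sum_range_succ _ (N + 1)]; omega
  have hM3 : ∀ N k l, M' N ≤ k → M' N ≤ l → u k - u l ∈ I ^ N := fun N k l hk hl => by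
    have := sub_mem (hM N k ((hM1 N).trans hk)) (hM N l ((hM1 N).trans hl))
    rwa [sub_sub_sub_cancel_right] at this
  obtain ⟨L, hL⟩ := h.2 (fun N => u (M' N)) fun N => hM3 N _ _ (hM2 N) le_rfl
  refine ⟨L, fun N => ⟨M' N, fun k hk => ?_⟩⟩
  have := add_mem (hL N) (hM3 N _ k le_rfl hk)
  rwa [sub_add_sub_cancel] at this

lemma Complete.wittVector (h : Complete (gen Z)) : Complete (gen (PureRegular.wittSeq p Z)) := by
  constructor
  · intro u hu
    ext i
    rw [WittVector.zero_coeff]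
    refine h.1 _ fun N => ?_
    obtain ⟨M, hM⟩ := exists_pow_le_wittKer (p := p) Z (i + 1) N
    exact mem_wittKer.1 (hM (hu M)) i (by omega)
  · intro u hu
    have hmono : ∀ {k l : ℕ}, k ≤ l → u l - u k ∈ gen (PureRegular.wittSeq p Z) ^ k := by
      intro k l hkl
      induction l, hkl using Nat.le_induction with
      | base => simp
      | succ l hl ih =>
        have := add_mem (Ideal.pow_le_pow_right hl (hu l)) ih
        rwa [sub_add_sub_cancel] at this
    have h1 : ∀ i, ∃ L, ∀ N, ∃ M, ∀ k ≥ M, L - (u k).coeff i ∈ gen Z ^ N := fun i => by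
      refine h.exists_limit fun N => ?_
      obtain ⟨M, hM⟩ := exists_pow_le_wittKer (p := p) Z (i + 1) N
      exact ⟨M, fun k hk => sub_mem_wittKer.1 (hM (hmono hk)) i (by omega)⟩
    choose L hL using h1
    refine ⟨WittVector.mk p L, fun k => ?_⟩
    obtain ⟨N, hN⟩ := exists_wittKer_le (p := p) Z k
    choose M hM using fun i => hL i N
    have h2 : WittVector.mk p L - u (k + ∑ i ∈ Finset.range k, M i) ∈
        gen (PureRegular.wittSeq p Z) ^ k := by
      refine hN (sub_mem_wittKer.2 fun i hi => hM i _ ?_)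
      exact (Finset.single_le_sum (f := M) (fun _ _ => Nat.zero_le _)
        (Finset.mem_range.2 hi)).trans (Nat.le_add_left _ _)
    have := add_mem h2 (hmono (Nat.le_add_right k (∑ i ∈ Finset.range k, M i)))
    rwa [sub_add_sub_cancel] at this

end

section

open MvPolynomial

section

variable {n : ℕ} {A C : Type*} [CommRing A] [CommRing C]

lemma QuasiRegular.mem_pow_of_mul_mem {x : Fin n → A} (h : QuasiRegular x ⊥) (j : Fin n) {k : ℕ}
    {u : A} (hu : x j * u ∈ gen x ^ (k + 1)) : u ∈ gen x ^ k := by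
  classical
  induction k with
  | zero => simp
  | succ k ih =>
    obtain ⟨F, hF, hFu⟩ := exists_homogeneous_of_mem_pow k
      (ih (Ideal.pow_le_pow_right (Nat.le_succ _) hu))
    have h1 := h (k + 1) (X j * F) (by rw [add_comm]; exact (isHomogeneous_X A j).mul hF) (by
      rw [sup_bot_eq, map_mul, eval_X, hFu]
      exact hu)
    rw [← hFu, pow_succ']
    refine eval_mem_mul hF fun α => ?_
    have := h1 (Finsupp.single j 1 + α)
    rwa [coeff_X_mul, sup_bot_eq] at this

lemma Complete.of_surjective {I : Ideal A} (h : Complete I) {f : A →+* C}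
    (hf : Function.Surjective f) (hker : ∀ u, (∀ M, u ∈ I ^ M ⊔ RingHom.ker f) → f u = 0) :
    Complete (I.map f) := by
  have hmem : ∀ {k c}, c ∈ (I.map f) ^ k → ∃ a ∈ I ^ k, f a = c := fun {k c} hc => by
    rw [← Ideal.map_pow, Ideal.mem_map_iff_of_surjective f hf] at hc
    exact hc
  have hmem' : ∀ {k a}, a ∈ I ^ k → f a ∈ (I.map f) ^ k := fun ha => map_pow_le le_rfl ha
  constructor
  · intro c hc
    obtain ⟨u, rfl⟩ := hf c
    refine hker u fun M => ?_
    obtain ⟨a, ha, hau⟩ := hmem (hc M)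
    rw [← sub_add_cancel u a, add_comm]
    exact add_mem (Ideal.mem_sup_left ha) (Ideal.mem_sup_right (by
      rw [RingHom.mem_ker, map_sub, hau, sub_self]))
  · intro u hu
    choose d hd hdu using fun k => hmem (hu k)
    obtain ⟨a₀, ha₀⟩ := hf (u 0)
    obtain ⟨L, hL⟩ := h.2 (fun k => a₀ + ∑ i ∈ Finset.range k, d i) fun k => by
      rw [Finset.sum_range_succ, ← add_assoc, add_sub_cancel_left]
      exact hd k
    have h2 : ∀ k, f (a₀ + ∑ i ∈ Finset.range k, d i) = u k := fun k => by
      rw [map_add, map_sum, ha₀, Finset.sum_congr rfl fun i _ => hdu i, Finset.sum_range_sub]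
      ring
    refine ⟨f L, fun k => ?_⟩
    rw [← h2, ← map_sub]
    exact hmem' (hL k)

lemma Complete.closed_span_singleton {I : Ideal A} (h : Complete I) {t : A}
    (ht : ∀ k u, t * u ∈ I ^ (k + 1) → u ∈ I ^ k) {u : A}
    (hu : ∀ M, u ∈ I ^ M ⊔ Ideal.span {t}) : u ∈ Ideal.span {t} := by
  have h1 : ∀ M, ∃ a, u - t * a ∈ I ^ (M + 1) := fun M => by
    obtain ⟨y, hy, z, hz, hyz⟩ := Submodule.mem_sup.1 (hu (M + 1))
    obtain ⟨a, rfl⟩ := Ideal.mem_span_singleton'.1 hz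
    exact ⟨a, by rwa [← hyz, mul_comm, add_sub_cancel_right]⟩
  choose a ha using h1
  obtain ⟨L, hL⟩ := h.2 a fun k => by
    refine ht k _ ?_
    have := sub_mem (ha k) (Ideal.pow_le_pow_right (Nat.le_succ _) (ha (k + 1)))
    rw [sub_sub_sub_cancel_left] at this
    rwa [mul_sub]
  have h2 : u = t * L := h.eq_of_sub_mem fun M => by
    have := sub_mem (Ideal.pow_le_pow_right (Nat.le_succ _) (ha M))
      (Ideal.mul_mem_left _ t (hL M))
    convert this using 1
    ring
  exact Ideal.mem_span_singleton.2 ⟨L, h2⟩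

end

section

variable {n : ℕ} {B : Type*} [CommRing B] (p : ℕ) [hp : Fact p.Prime]

/-- The degree one element `p - ∑ sᵢ [Zᵢ]` of the ring of Witt vectors. -/
noncomputable def omega (s : Fin n → WittVector p B) (Z : Fin n → B) : WittVector p B :=
  p - ∑ i, s i * WittVector.teichmuller p (Z i)

/-- The quotient of the ring of Witt vectors by `p - ∑ sᵢ [Zᵢ]`. -/
abbrev Untilt (s : Fin n → WittVector p B) (Z : Fin n → B) : Type _ :=
  WittVector p B ⧸ Ideal.span {omega p s Z}

/-- The image of the Teichmüller lift. -/
noncomputable def sharp (s : Fin n → WittVector p B) (Z : Fin n → B) : B →* Untilt p s Z :=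
  ((Ideal.Quotient.mk (Ideal.span {omega p s Z}) : WittVector p B →+* Untilt p s Z) :
    WittVector p B →* Untilt p s Z).comp (WittVector.teichmuller p)

variable {p} {s : Fin n → WittVector p B} {Z : Fin n → B}

lemma gen_cons_omega : gen (Fin.cons (omega p s Z) (WittVector.teichmuller p ∘ Z)) =
    gen (wittSeq p Z) :=
  gen_cons_sub _ _ (Ideal.sum_mem _ fun i _ =>
    Ideal.mul_mem_left _ _ (mem_gen (WittVector.teichmuller p ∘ Z) i))

lemma map_gen_wittSeq : (gen (wittSeq p Z)).map (Ideal.Quotient.mk (Ideal.span {omega p s Z})) =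
    gen (sharp p s Z ∘ Z) := by
  rw [← gen_cons_omega (s := s), gen_cons, Ideal.map_sup, map_gen]
  have : (Ideal.span {omega p s Z}).map (Ideal.Quotient.mk (Ideal.span {omega p s Z})) = ⊥ :=
    Ideal.map_quotient_self _
  rw [this, bot_sup_eq]
  rfl

variable [CharP B p] [PerfectRing B p]

lemma QuasiRegular.cons_omega (h : QuasiRegular Z ⊥) :
    QuasiRegular (Fin.cons (omega p s Z) (WittVector.teichmuller p ∘ Z)) ⊥ :=
  h.wittSeq.cons_sub s

lemma QuasiRegular.omega_colon (h : QuasiRegular Z ⊥) (k : ℕ) (u : WittVector p B)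
    (hu : omega p s Z * u ∈ gen (PureRegular.wittSeq p Z) ^ (k + 1)) :
    u ∈ gen (PureRegular.wittSeq p Z) ^ k := by
  rw [← gen_cons_omega (s := s)] at hu ⊢
  exact h.cons_omega.mem_pow_of_mul_mem 0 hu

/-- The untilt of a good base is a good base. -/
lemma GoodBase.untilt (h : GoodBase Z) (s : Fin n → WittVector p B) :
    GoodBase (sharp p s Z ∘ Z) := by
  have hsurj : Function.Surjective (Ideal.Quotient.mk (Ideal.span {omega p s Z})) :=
    Ideal.Quotient.mk_surjective
  refine ⟨?_, ?_, ?_⟩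
  · rw [← map_gen_wittSeq]
    refine h.complete.wittVector.of_surjective hsurj fun u hu => ?_
    rw [Ideal.mk_ker] at hu
    exact Ideal.Quotient.eq_zero_iff_mem.2
      (h.complete.wittVector.closed_span_singleton h.qr.omega_colon hu)
  · have h1 := (h.qr.cons_omega (s := s)).tail
    simp only [Fin.cons_succ, Fin.cons_zero, bot_sup_eq] at h1
    have h2 := h1.of_surjective hsurj (by rw [Ideal.mk_ker])
    rwa [Ideal.map_quotient_self] at h2
  · rw [← map_gen_wittSeq]
    intro ht
    refine gen_wittSeq_ne_top (p := p) h.ne_top ?_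
    have h1 := congrArg (Ideal.comap (Ideal.Quotient.mk (Ideal.span {omega p s Z}))) ht
    rw [Ideal.comap_map_of_surjective' _ hsurj, Ideal.mk_ker, Ideal.comap_top] at h1
    rwa [sup_eq_left.2] at h1
    rw [Ideal.span_singleton_le_iff_mem, ← gen_cons_omega (s := s)]
    exact mem_gen (Fin.cons (omega p s Z) (WittVector.teichmuller p ∘ Z) : Fin (n + 1) → _) 0

end

lemma omega_single {n : ℕ} {B : Type*} [CommRing B] {p : ℕ} [Fact p.Prime]
    (Z : Fin n → B) (i : Fin n) :
    omega p (Pi.single i 1) Z = (p : WittVector p B) - .teichmuller p (Z i) := by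
  classical
  rw [omega, Finset.sum_eq_single i]
  · simp
  · intro j _ hj
    simp [hj]
  · simp

section

variable {B : Type*} [CommRing B] {p : ℕ} [hp : Fact p.Prime] [CharP B p] [PerfectRing B p]

lemma teichmuller_mul_mem_span {d : B} (hd : ∀ b, d * b = 0 → b = 0) {a : WittVector p B}
    (h : WittVector.teichmuller p d * a ∈ Ideal.span {(p : WittVector p B) - .teichmuller p d}) :
    a ∈ Ideal.span {(p : WittVector p B) - .teichmuller p d} := by
  obtain ⟨b, hb⟩ := Ideal.mem_span_singleton.1 h
  have h0 : (a + b).coeff 0 = 0 := by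
    refine hd _ ?_
    have h1 := congrArg WittVector.constantCoeff hb
    simp only [map_mul, map_sub, map_natCast, CharP.cast_eq_zero, zero_sub] at h1
    have h2 : WittVector.constantCoeff (WittVector.teichmuller p d) = d :=
      WittVector.teichmuller_coeff_zero p d
    rw [h2] at h1
    change d * WittVector.constantCoeff (a + b) = 0
    rw [map_add, mul_add, h1]
    ring
  rw [← WittVector.mem_span_p_iff_coeff_zero_eq_zero] at h0
  obtain ⟨e, he⟩ := Ideal.mem_span_singleton.1 h0
  refine Ideal.mem_span_singleton.2 ⟨e, ?_⟩
  rw [← sub_eq_zero]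
  refine WittVector.eq_zero_of_p_mul_eq_zero (p := p) _ ?_
  linear_combination ((p : WittVector p B) - WittVector.teichmuller p d) * he + hb

lemma exists_of_pow_mem_span {d : B} (hd : ∀ b, d * b = 0 → b = 0) {w : WittVector p B}
    (h : w ^ p ∈ Ideal.span {(p : WittVector p B) - .teichmuller p d}) :
    ∃ (e : B) (w₁ : WittVector p B), e ^ p = d ∧
      w - WittVector.teichmuller p e * w₁ ∈ Ideal.span {(p : WittVector p B) - .teichmuller p d} ∧
      w₁ ^ p ∈ Ideal.span {(p : WittVector p B) - .teichmuller p d} := by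
  obtain ⟨e, he⟩ := exists_root p 1 d
  rw [pow_one] at he
  obtain ⟨b, hb⟩ := Ideal.mem_span_singleton.1 h
  obtain ⟨c, hc⟩ := exists_root p 1 (-b.coeff 0)
  rw [pow_one] at hc
  have h0 : (w - WittVector.teichmuller p (e * c)).coeff 0 = 0 := by
    change WittVector.constantCoeff (w - WittVector.teichmuller p (e * c)) = 0
    have h2 : ∀ d : B, WittVector.constantCoeff (WittVector.teichmuller p d) = d :=
      WittVector.teichmuller_coeff_zero p
    rw [map_sub, h2, sub_eq_zero]
    refine pow_eq_pow p (m := 1) ?_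
    have h1 := congrArg WittVector.constantCoeff hb
    simp only [map_mul, map_sub, map_natCast, CharP.cast_eq_zero, zero_sub, map_pow, h2] at h1
    rw [pow_one, h1, mul_pow, he, hc]
    change -d * b.coeff 0 = _
    ring
  rw [← WittVector.mem_span_p_iff_coeff_zero_eq_zero] at h0
  obtain ⟨f, hf⟩ := Ideal.mem_span_singleton.1 h0
  have hed : WittVector.teichmuller p e ^ p = WittVector.teichmuller p d := by
    rw [← map_pow, he]
  have hpos : p = p - 1 + 1 := (Nat.succ_pred_eq_of_pos hp.out.pos).symm
  have h3 : w - WittVector.teichmuller p e *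
      (WittVector.teichmuller p c + WittVector.teichmuller p e ^ (p - 1) * f) ∈
      Ideal.span {(p : WittVector p B) - .teichmuller p d} := by
    refine Ideal.mem_span_singleton.2 ⟨f, ?_⟩
    have h4 : WittVector.teichmuller p e * WittVector.teichmuller p e ^ (p - 1) =
        WittVector.teichmuller p d := by
      rw [← pow_succ', ← hpos, hed]
    rw [map_mul] at hf
    linear_combination hf - f * h4
  refine ⟨e, _, he, h3, teichmuller_mul_mem_span hd ?_⟩
  have h5 := congrArg (· ^ p) (Ideal.Quotient.eq.2 h3)
  rw [← RingHom.map_pow, ← RingHom.map_pow, Ideal.Quotient.eq_zero_iff_mem.2 h] at h5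
  rw [← hed, ← mul_pow, hed]
  exact Ideal.Quotient.eq_zero_iff_mem.1 h5.symm

/-- Untilts with respect to `p - [d]` are reduced. -/
theorem isReduced_of_teichmuller {d : B} (hd : ∀ b, d * b = 0 → b = 0)
    (hsep : ∀ u : WittVector p B, (∀ M, u ∈ Ideal.span {WittVector.teichmuller p d} ^ M ⊔
      Ideal.span {(p : WittVector p B) - .teichmuller p d}) →
      u ∈ Ideal.span {(p : WittVector p B) - .teichmuller p d})
    {u : WittVector p B} {k : ℕ}
    (hu : u ^ k ∈ Ideal.span {(p : WittVector p B) - .teichmuller p d}) :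
    u ∈ Ideal.span {(p : WittVector p B) - .teichmuller p d} := by
  set O := Ideal.span {(p : WittVector p B) - .teichmuller p d} with hO
  have h1 : ∀ M : ℕ, ∀ w : WittVector p B, w ^ p ∈ O →
      ∃ w₁, w₁ ^ p ∈ O ∧ ∀ e : B, e ^ p = d →
        w - WittVector.teichmuller p e ^ M * w₁ ∈ O := by
    intro M
    induction M with
    | zero => exact fun w hw => ⟨w, hw, fun e _ => by simp⟩
    | succ M ih =>
      intro w hw
      obtain ⟨w₁, hw₁, hww₁⟩ := ih w hw
      obtain ⟨e, w₂, he, h2, hw₂⟩ := exists_of_pow_mem_span hd hw₁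
      refine ⟨w₂, hw₂, fun e' he' => ?_⟩
      have : e' = e := pow_eq_pow p (m := 1) (by rw [pow_one, he, he'])
      subst this
      have := add_mem (hww₁ e' he) (Ideal.mul_mem_left _ (WittVector.teichmuller p e' ^ M) h2)
      convert this using 1
      ring
  have h2 : ∀ w : WittVector p B, w ^ p ∈ O → w ∈ O := by
    intro w hw
    obtain ⟨e, he⟩ := exists_root p 1 d
    rw [pow_one] at he
    refine hsep w fun M => ?_
    obtain ⟨w₁, -, h3⟩ := h1 (p * M) w hw
    rw [← sub_add_cancel w (WittVector.teichmuller p e ^ (p * M) * w₁), add_comm]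
    refine add_mem (Ideal.mem_sup_left (Ideal.mul_mem_right _ _ ?_))
      (Ideal.mem_sup_right (h3 e he))
    rw [pow_mul, ← map_pow, he]
    exact Ideal.pow_mem_pow (Ideal.mem_span_singleton_self _) M
  have h3 : ∀ m : ℕ, u ^ p ^ m ∈ O → u ∈ O := by
    intro m
    induction m with
    | zero => simp
    | succ m ih => exact fun h => ih (h2 _ (by rwa [← pow_mul, ← pow_succ]))
  exact h3 k (Ideal.mem_of_dvd _ (pow_dvd_pow u (Nat.lt_pow_self hp.out.one_lt).le) hu)

/-- Untilts with respect to `p - [Zᵢ]` are reduced. -/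
theorem GoodBase.isReduced_untilt {n : ℕ} {Z : Fin n → B} (h : GoodBase Z) (i : Fin n) :
    IsReduced (Untilt p (Pi.single i 1) Z) := by
  refine ⟨fun c => ?_⟩
  rintro ⟨k, hk⟩
  obtain ⟨u, rfl⟩ := Ideal.Quotient.mk_surjective c
  rw [← RingHom.map_pow, Ideal.Quotient.eq_zero_iff_mem, omega_single] at hk
  rw [Ideal.Quotient.eq_zero_iff_mem, omega_single]
  refine isReduced_of_teichmuller (fun b hb => ?_) (fun u hu => ?_) hk
  · refine h.complete.1 b fun M => h.qr.mem_pow_of_mul_mem i ?_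
    rw [hb]
    exact zero_mem _
  · rw [← omega_single] at hu ⊢
    refine h.complete.wittVector.closed_span_singleton h.qr.omega_colon fun M => ?_
    refine (sup_le_sup_right (Ideal.pow_right_mono ?_ M) _ : _ ≤ gen (wittSeq p Z) ^ M ⊔ _) (hu M)
    rw [Ideal.span_singleton_le_iff_mem]
    exact mem_gen (wittSeq p Z) i.succ

end

end

section

open MvPolynomial

section

universe w

variable {p : ℕ} [Fact p.Prime] {n : ℕ}

lemma map_omega {B E : Type*} [CommRing B] [CommRing E] (g : B →+* E)
    (s : Fin n → WittVector p B) (Z : Fin n → B) :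
    WittVector.map g (omega p s Z) = omega p (WittVector.map g ∘ s) (g ∘ Z) := by
  simp [omega, map_sub, map_sum, WittVector.map_teichmuller]

variable {T : Type w}

section

variable {A : Type*} [CommRing A]

/-- The generic Witt vector with coordinates the variables `X (t, m + 1)`. -/
noncomputable def genericWitt (p : ℕ) [Fact p.Prime] (A : Type*) [CommRing A] (t : T) :
    WittVector p (MvPolynomial (T × ℕ) A) :=
  WittVector.mk p fun m => X (t, m + 1)

/-- The value of a polynomial over the Witt vectors at the Teichmüller lift of `X (t, 0)`. -/
noncomputable def genericValue (f : T → Polynomial (WittVector p A)) (t : T) :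
    WittVector p (MvPolynomial (T × ℕ) A) :=
  (f t).eval₂ (WittVector.map C) (WittVector.teichmuller p (X (t, 0)))

/-- The coordinates of the relation `f t ([X (t, 0)]) = (p - q) * genericWitt t`. -/
noncomputable def rootRelation (f : T → Polynomial (WittVector p A)) (q : WittVector p A) :
    T × ℕ → MvPolynomial (T × ℕ) A
  | (t, 0) => (genericValue f t + WittVector.map C q * genericWitt p A t).coeff 0
  | (t, m + 1) => X (t, m + 1) ^ p -
      (genericValue f t + WittVector.map C q * genericWitt p A t).coeff (m + 1)

lemma map_genericValue {E : Type*} [CommRing E] (φ : MvPolynomial (T × ℕ) A →+* E)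
    (f : T → Polynomial (WittVector p A)) (t : T) :
    WittVector.map φ (genericValue f t) = (f t).eval₂ (WittVector.map (φ.comp C))
      (WittVector.teichmuller p (φ (X (t, 0)))) := by
  rw [genericValue, Polynomial.hom_eval₂, WittVector.map_teichmuller]
  congr 1

lemma map_rootRelation_eq_zero_iff {E : Type*} [CommRing E] [CharP E p]
    (φ : MvPolynomial (T × ℕ) A →+* E) (f : T → Polynomial (WittVector p A))
    (q : WittVector p A) :
    (∀ j, φ (rootRelation f q j) = 0) ↔ ∀ t, (f t).eval₂ (WittVector.map (φ.comp C))
      (WittVector.teichmuller p (φ (X (t, 0)))) =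
        WittVector.map (φ.comp C) ((p : WittVector p A) - q) *
          WittVector.map φ (genericWitt p A t) := by
  have key : ∀ t, (f t).eval₂ (WittVector.map (φ.comp C))
      (WittVector.teichmuller p (φ (X (t, 0)))) =
        WittVector.map (φ.comp C) ((p : WittVector p A) - q) *
          WittVector.map φ (genericWitt p A t) ↔
      WittVector.map φ (genericValue f t + WittVector.map C q * genericWitt p A t) =
        WittVector.map φ (genericWitt p A t) * (p : WittVector p E) := fun t => by
    have : WittVector.map φ (WittVector.map C q) = WittVector.map (φ.comp C) q := by
      ext i
      simp [WittVector.map_coeff]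
    rw [map_add, map_mul, map_genericValue, this, map_sub, map_natCast, sub_mul,
      eq_sub_iff_add_eq, mul_comm (p : WittVector p E)]
  constructor
  · intro h t
    rw [key]
    ext m
    rw [WittVector.map_coeff]
    cases m with
    | zero => rw [WittVector.mul_charP_coeff_zero]; exact h (t, 0)
    | succ m =>
      rw [WittVector.mul_charP_coeff_succ, WittVector.map_coeff]
      have := h (t, m + 1)
      rw [rootRelation, map_sub, sub_eq_zero, map_pow] at this
      exact this.symm
  · rintro h ⟨t, m⟩
    have h1 := congrArg (fun u => WittVector.coeff u m) ((key t).1 (h t))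
    simp only [WittVector.map_coeff] at h1
    cases m with
    | zero => rw [WittVector.mul_charP_coeff_zero] at h1; exact h1
    | succ m =>
      rw [WittVector.mul_charP_coeff_succ, WittVector.map_coeff] at h1
      rw [rootRelation, map_sub, h1, map_pow, sub_eq_zero]
      rfl

lemma exists_hom_of_root {E : Type*} [CommRing E] [CharP E p]
    (f : T → Polynomial (WittVector p A)) (q : WittVector p A) (g : A →+* E) (y : T → E)
    (hy : ∀ t, (f t).eval₂ (WittVector.map g) (WittVector.teichmuller p (y t)) ∈
      Ideal.span {WittVector.map g ((p : WittVector p A) - q)}) :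
    ∃ φ : MvPolynomial (T × ℕ) A →+* E, φ.comp C = g ∧ (∀ t, φ (X (t, 0)) = y t) ∧
      ∀ j, φ (rootRelation f q j) = 0 := by
  choose e he using fun t => Ideal.mem_span_singleton'.1 (hy t)
  let v : T × ℕ → E := fun j => Nat.casesOn j.2 (y j.1) fun m => (e j.1).coeff m
  have hC : (eval₂Hom g v).comp C = g := by
    ext a
    simp
  refine ⟨eval₂Hom g v, hC, fun t => by simp [v], ?_⟩
  rw [map_rootRelation_eq_zero_iff]
  intro t
  rw [hC, eval₂Hom_X', show v (t, 0) = y t from rfl, ← he t, mul_comm]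
  congr 1
  ext m
  simp [WittVector.map_coeff, genericWitt, v, WittVector.coeff_mk]

lemma map_mk_rootRelation {n : ℕ} (Z : Fin n → A) (f : T → Polynomial (WittVector p A))
    (s : Fin n → WittVector p A) (t : T) (m : ℕ) :
    MvPolynomial.map (Ideal.Quotient.mk (gen Z)) ((genericValue f t + WittVector.map C
      (∑ i, s i * WittVector.teichmuller p (Z i)) * genericWitt p A t).coeff m) =
      (genericValue
        (fun t => (f t).map (WittVector.map (Ideal.Quotient.mk (gen Z)))) t).coeff m := by
  rw [← WittVector.map_coeff, map_add, map_mul, map_genericValue, genericValue,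
    Polynomial.eval₂_map]
  have h1 : (MvPolynomial.map (Ideal.Quotient.mk (gen Z))).comp (C : A →+* MvPolynomial (T × ℕ) A) =
      C.comp (Ideal.Quotient.mk (gen Z)) := by
    ext a
    simp
  have h2 : WittVector.map (MvPolynomial.map (Ideal.Quotient.mk (gen Z))) (WittVector.map
      (C : A →+* MvPolynomial (T × ℕ) A) (∑ i, s i * WittVector.teichmuller p (Z i))) = 0 := by
    simp only [map_sum, map_mul, WittVector.map_teichmuller, map_C]
    refine Finset.sum_eq_zero fun i _ => ?_
    rw [Ideal.Quotient.eq_zero_iff_mem.2 (mem_gen Z i), map_zero, WittVector.teichmuller_zero,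
      mul_zero]
  rw [h2, zero_mul, add_zero, h1, map_X]
  congr 2

lemma genericValue_coeff_eq_rename (f : T → Polynomial (WittVector p A)) (t : T) (m : ℕ)
    {j : T × ℕ} (hj : (t, 0) ≠ j) :
    (genericValue f t).coeff m = rename (Subtype.val : {y // y ≠ j} → T × ℕ)
      (((f t).eval₂ (WittVector.map C) (WittVector.teichmuller p
        (X ⟨(t, 0), hj⟩ : MvPolynomial {y // y ≠ j} A))).coeff m) := by
  have := WittVector.map_coeff (p := p)
    (rename (R := A) (Subtype.val : {y // y ≠ j} → T × ℕ)).toRingHom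
    ((f t).eval₂ (WittVector.map C) (WittVector.teichmuller p
        (X ⟨(t, 0), hj⟩ : MvPolynomial {y // y ≠ j} A))) m
  rw [Polynomial.hom_eval₂, WittVector.map_teichmuller] at this
  refine Eq.trans ?_ this
  rw [genericValue]
  congr 2
  · ext x i : 2
    simp [WittVector.map_coeff]
  · simp

lemma genericValue_coeff_zero (f : T → Polynomial (WittVector p A)) (t : T) :
    (genericValue f t).coeff 0 = ((f t).map WittVector.constantCoeff).eval₂ C (X (t, 0)) := by
  change WittVector.constantCoeff (genericValue f t) = _
  rw [genericValue, Polynomial.hom_eval₂, Polynomial.eval₂_map]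
  congr 1

end

theorem exists_root_extension {B : Type w} [CommRing B] [CharP B p] [PerfectRing B p]
    {Z : Fin n → B} (h : GoodBase Z) (s : Fin n → WittVector p B)
    (f : T → Polynomial (WittVector p B)) (hf : ∀ t, (f t).Monic)
    (hdeg : ∀ t, (f t).natDegree ≠ 0) :
    ∃ (B' : Type w) (_ : CommRing B') (_ : CharP B' p) (_ : PerfectRing B' p) (ι : B →+* B')
      (Y : T → B'), GoodBase (ι ∘ Z) ∧
      (∀ t, (f t).eval₂ (WittVector.map ι) (WittVector.teichmuller p (Y t)) ∈
        Ideal.span {WittVector.map ι (omega p s Z)}) ∧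
      ∀ (E : Type w) [CommRing E] [CharP E p] [PerfectRing E p] (g : B →+* E) (y : T → E)
        (K : Ideal E), Complete K → gen (g ∘ Z) ≤ K →
        (∀ t, (f t).eval₂ (WittVector.map g) (WittVector.teichmuller p (y t)) ∈
          Ideal.span {WittVector.map g (omega p s Z)}) →
        ∃ g' : B' →+* E, g'.comp ι = g ∧ ∀ t, g' (Y t) = y t := by
  classical
  let q := ∑ i, s i * WittVector.teichmuller p (Z i)
  have hω : omega p s Z = (p : WittVector p B) - q := rfl
  let ρ := rootRelation f q
  let K := Ideal.span (Set.range ρ)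
  let π := Ideal.Quotient.mk K
  have hπρ : ∀ j, π (ρ j) = 0 := fun j =>
    Ideal.Quotient.eq_zero_iff_mem.2 (Ideal.subset_span ⟨j, rfl⟩)
  let coefficient (t : T) (j : T × ℕ) (hj : ((t, 0) : T × ℕ) ≠ j) (m : ℕ) :
      MvPolynomial {y // y ≠ j} (B ⧸ gen Z) :=
    WittVector.coeff (((f t).map (WittVector.map (Ideal.Quotient.mk (gen Z)))).eval₂
      (WittVector.map C) (WittVector.teichmuller p (X ⟨(t, 0), hj⟩))) m
  have hqr : QuasiRegular ((C : B →+* MvPolynomial (T × ℕ) B) ∘ Z) K := by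
    refine QuasiRegular.of_monic_relations h.qr ρ (fun j => j) Prod.snd ?_ ?_
    · rintro ⟨t, m⟩
      cases m with
      | zero =>
        refine ⟨((f t).map ((Ideal.Quotient.mk (gen Z)).comp WittVector.constantCoeff)).map C,
          ((hf t).map _).map _, ?_⟩
        change MvPolynomial.map _
          ((genericValue f t + WittVector.map C q * genericWitt p B t).coeff 0) = _
        rw [map_mk_rootRelation, genericValue_coeff_zero, Polynomial.map_map, Polynomial.map_map,
          Polynomial.eval₂_map, Polynomial.eval₂_map]
        congr 1
        ext x
        simp [WittVector.map_coeff]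
      | succ m =>
        have hne : ((t, 0) : T × ℕ) ≠ (t, m + 1) := by simp
        refine ⟨Polynomial.X ^ p - Polynomial.C (coefficient t (t, m + 1) hne (m + 1)),
          Polynomial.monic_X_pow_sub_C _ (Nat.Prime.ne_zero Fact.out), ?_⟩
        · change MvPolynomial.map _ (X (t, m + 1) ^ p -
            (genericValue f t + WittVector.map C q * genericWitt p B t).coeff (m + 1)) = _
          rw [map_sub, map_mk_rootRelation, genericValue_coeff_eq_rename _ _ _ hne, map_pow, map_X,
            Polynomial.eval₂_sub, Polynomial.eval₂_pow, Polynomial.eval₂_X, Polynomial.eval₂_C]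
          rfl
    · rintro ⟨t, m⟩ j hij hr
      have hne : ((t, 0) : T × ℕ) ≠ j := by
        rintro rfl
        simp only [Nat.le_zero] at hr
        subst hr
        exact hij rfl
      cases m with
      | zero =>
        change MvPolynomial.map _
          ((genericValue f t + WittVector.map C q * genericWitt p B t).coeff 0) ∈ _
        rw [map_mk_rootRelation, genericValue_coeff_eq_rename _ _ _ hne]
        exact ⟨_, rfl⟩
      | succ m =>
        change MvPolynomial.map _ (X (t, m + 1) ^ p -
            (genericValue f t + WittVector.map C q * genericWitt p B t).coeff (m + 1)) ∈ _
        rw [map_sub, map_mk_rootRelation, genericValue_coeff_eq_rename _ _ _ hne, map_pow, map_X]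
        refine ⟨X ⟨(t, m + 1), hij⟩ ^ p - coefficient t j hne (m + 1), ?_⟩
        · rw [map_sub, map_pow, rename_X]
  have hqr' : QuasiRegular ((π.comp C) ∘ Z) ⊥ := by
    have := QuasiRegular.of_surjective (f := π) Ideal.Quotient.mk_surjective
      (by rw [Ideal.mk_ker]) hqr
    rwa [Ideal.map_quotient_self] at this
  obtain ⟨m, hm, hle⟩ := Ideal.exists_le_maximal _ h.ne_top
  let _ : Field (B ⧸ m) := Ideal.Quotient.field m
  let Ω := AlgebraicClosure (B ⧸ m)
  let g0 : B →+* Ω := (algebraMap (B ⧸ m) Ω).comp (Ideal.Quotient.mk m)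
  have hg0 : ∀ i, g0 (Z i) = 0 := fun i => by
    simp only [g0, RingHom.comp_apply]
    rw [Ideal.Quotient.eq_zero_iff_mem.2 (hle (mem_gen Z i)), map_zero]
  have : CharP Ω p := charP_of_ringHom p g0
  have hroot : ∀ t, ∃ y : Ω, Polynomial.eval y ((f t).map (g0.comp WittVector.constantCoeff)) = 0 :=
    fun t => by
    refine IsAlgClosed.exists_root _ fun hd => hdeg t ?_
    rw [← (hf t).natDegree_map (g0.comp WittVector.constantCoeff)]
    exact Polynomial.natDegree_eq_of_degree_eq_some hd
  choose y hy using hroot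
  have : PerfectRing Ω p := PerfectField.toPerfectRing p
  have hq0 : WittVector.map g0 ((p : WittVector p B) - q) = (p : WittVector p Ω) := by
    rw [← hω, map_omega]
    simp [omega, hg0]
  obtain ⟨φ0, hφC, -, hφ0⟩ := exists_hom_of_root f q g0 y fun t => by
    rw [hq0, WittVector.mem_span_p_iff_coeff_zero_eq_zero]
    change WittVector.constantCoeff _ = _
    rw [Polynomial.hom_eval₂, ← hy t, Polynomial.eval_map]
    congr 1
  let φ1 : MvPolynomial (T × ℕ) B ⧸ K →+* Ω := Ideal.Quotient.lift K φ0 fun a ha => by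
    have : K ≤ RingHom.ker φ0 := Ideal.span_le.2 (by rintro _ ⟨j, rfl⟩; exact hφ0 j)
    exact this ha
  have htop : gen ((π.comp C) ∘ Z) ≠ ⊤ := by
    intro htop
    have h1 : (gen ((π.comp C) ∘ Z)).map φ1 ≤ RingHom.ker (RingHom.id Ω) := by
      rw [map_gen]
      refine Ideal.span_le.2 ?_
      rintro _ ⟨i, rfl⟩
      have : φ0 (C (Z i)) = 0 := by
        rw [← hg0 i, ← hφC]; rfl
      exact this
    rw [htop, Ideal.map_top] at h1
    exact one_ne_zero (α := Ω) (h1 (Submodule.mem_top (x := (1 : Ω))))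
  have : Nontrivial (MvPolynomial (T × ℕ) B ⧸ K) := φ1.domain_nontrivial
  have : CharP (MvPolynomial (T × ℕ) B ⧸ K) p := charP_of_ringHom p (π.comp C)
  obtain ⟨B', i1, i2, i3, θ, hgood, huniv⟩ := exists_completed_perfection p hqr' htop
  refine ⟨B', i1, i2, i3, θ.comp (π.comp C), fun t => θ (π (X (t, 0))), hgood, ?_, ?_⟩
  · have := (map_rootRelation_eq_zero_iff (θ.comp π) f q).1 fun j => by
      change θ (π (ρ j)) = 0
      rw [hπρ, map_zero]
    intro t
    rw [Ideal.mem_span_singleton]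
    exact ⟨_, this t⟩
  · intro E _ _ _ g y' J hE hJ hy'
    obtain ⟨φ, hφC, hφX, hφ⟩ := exists_hom_of_root f q g y' hy'
    let φ' : MvPolynomial (T × ℕ) B ⧸ K →+* E := Ideal.Quotient.lift K φ fun a ha => by
      have : K ≤ RingHom.ker φ := Ideal.span_le.2 (by rintro _ ⟨j, rfl⟩; exact hφ j)
      exact this ha
    have hφ' : φ'.comp (π.comp C) = g := by
      rw [← hφC]
      rfl
    obtain ⟨g', hg'⟩ := huniv E φ' J hE (by
      have : φ' ∘ ((π.comp C) ∘ Z) = g ∘ Z := by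
        rw [← hφ']; rfl
      rwa [this])
    refine ⟨g', ?_, fun t => ?_⟩
    · rw [← hφ', ← hg']
      rfl
    · rw [← hφX t]
      exact RingHom.congr_fun hg' (π (X (t, 0)))

end

end

section

open MvPolynomial

lemma sub_mem_pow_of_pow_sub_mem {p : ℕ} {O : Type*} [CommRing O]
    {I : Ideal O} (hp : (p : O) ∈ I) {a b : O} (h : a - b ∈ I)
    (k : ℕ) : a ^ p ^ k - b ^ p ^ k ∈ I ^ (k + 1) := by
  induction k with
  | zero => simpa using h
  | succ k ih =>
    have hk : p ^ (k + 1) = p ^ k * p := pow_succ _ _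
    rw [hk, pow_mul, pow_mul, ← (Commute.all _ _).geom_sum₂_mul, pow_succ' I]
    refine Ideal.mul_mem_mul ?_ ih
    have hI : a ^ p ^ k - b ^ p ^ k ∈ I := Ideal.pow_le_self (Nat.succ_ne_zero _) ih
    rw [← Ideal.Quotient.eq_zero_iff_mem] at hI ⊢
    rw [map_sub, sub_eq_zero] at hI
    simp only [map_sum, map_mul, map_pow] at hI ⊢
    simp only [hI, ← pow_add]
    rw [Finset.sum_congr rfl fun i hi => by
      rw [show i + (p - 1 - i) = p - 1 by have := Finset.mem_range.1 hi; omega]]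
    rw [Finset.sum_const, Finset.card_range, nsmul_eq_mul]
    have : ((p : ℕ) : O ⧸ I) = 0 := by
      rw [← map_natCast (Ideal.Quotient.mk I)]
      exact Ideal.Quotient.eq_zero_iff_mem.2 hp
    rw [this, zero_mul]

section

variable {p : ℕ} [Fact p.Prime] {O κ : Type*} [CommRing O] [CommRing κ]

lemma wittVector_ghostComponent_eq_sum (u : WittVector p O) (k : ℕ) :
    WittVector.ghostComponent k u =
      ∑ i ∈ Finset.range (k + 1), (p : O) ^ i * u.coeff i ^ p ^ (k - i) := by
  rw [WittVector.ghostComponent_apply, aeval_wittPolynomial]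

lemma ghostComponent_mem_pow {I : Ideal O} (hp : (p : O) ∈ I) {u : WittVector p O}
    (hu : ∀ i, u.coeff i ∈ I) (k : ℕ) : WittVector.ghostComponent k u ∈ I ^ (k + 1) := by
  rw [wittVector_ghostComponent_eq_sum]
  refine Ideal.sum_mem _ fun i hi => ?_
  have h1 : k + 1 ≤ i + p ^ (k - i) := by
    have := Nat.lt_pow_self (n := k - i) (Nat.Prime.one_lt (Fact.out : p.Prime))
    have := Finset.mem_range.1 hi
    omega
  refine Ideal.pow_le_pow_right h1 ?_
  rw [pow_add]
  exact Ideal.mul_mem_mul (Ideal.pow_mem_pow hp _) (Ideal.pow_mem_pow (hu i) _)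

variable [CharP κ p] [PerfectRing κ p]

/-- A ring map from a perfect ring of characteristic `p` to `O ⧸ I` lifts to Witt vectors. -/
theorem exists_wittLift {I : Ideal O} (h : Complete I) (hp : (p : O) ∈ I) (f : κ →+* O ⧸ I) :
    ∃ F : WittVector p κ →+* O, ∀ u, Ideal.Quotient.mk I (F u) = f (u.coeff 0) := by
  let θ (k : ℕ) : WittVector p (O ⧸ I) →+* O ⧸ I ^ (k + 1) :=
    RingHom.liftOfSurjective (WittVector.map (Ideal.Quotient.mk I))
      (WittVector.map_surjective _ Ideal.Quotient.mk_surjective)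
      ⟨(Ideal.Quotient.mk (I ^ (k + 1))).comp (WittVector.ghostComponent k), fun u hu => by
        rw [RingHom.mem_ker, RingHom.comp_apply, Ideal.Quotient.eq_zero_iff_mem]
        refine ghostComponent_mem_pow hp (fun i => ?_) k
        rw [← Ideal.Quotient.eq_zero_iff_mem, ← WittVector.map_coeff, RingHom.mem_ker.1 hu,
          WittVector.zero_coeff]⟩
  have hθ : ∀ k u, θ k (WittVector.map (Ideal.Quotient.mk I) u) =
      Ideal.Quotient.mk _ (WittVector.ghostComponent k u) := fun k u =>
    RingHom.liftOfSurjective_comp_apply ..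
  let r (k : ℕ) : κ →+* κ := (iterateFrobeniusEquiv κ p k).symm.toRingHom
  have hr : ∀ k a, r (k + 1) a ^ p = r k a := fun k a => by
    apply (iterateFrobeniusEquiv κ p k).injective
    have h1 : iterateFrobeniusEquiv κ p k (r k a) = a := RingEquiv.apply_symm_apply _ _
    have h2 : iterateFrobeniusEquiv κ p (k + 1) (r (k + 1) a) = a := RingEquiv.apply_symm_apply _ _
    rw [h1]
    conv_rhs => rw [← h2]
    simp only [iterateFrobeniusEquiv_def, ← pow_mul, pow_succ']
  let F (k : ℕ) : WittVector p κ →+* O ⧸ I ^ (k + 1) :=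
    (θ k).comp ((WittVector.map f).comp (WittVector.map (r k)))
  have hF : ∀ k u, ∃ a, Ideal.Quotient.mk _ a = F k u ∧
      ∃ b, Ideal.Quotient.mk _ b = F (k + 1) u ∧ b - a ∈ I ^ (k + 1) := fun k u => by
    obtain ⟨v, hv⟩ := WittVector.map_surjective (Ideal.Quotient.mk I) Ideal.Quotient.mk_surjective
      (WittVector.map f (WittVector.map (r (k + 1)) u))
    refine ⟨WittVector.ghostComponent k (WittVector.mk p fun i => v.coeff i ^ p), ?_,
      WittVector.ghostComponent (k + 1) v, ?_, ?_⟩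
    · rw [← hθ]
      change _ = θ k (WittVector.map f (WittVector.map (r k) u))
      congr 1
      ext i
      have := congrArg (fun w => WittVector.coeff w i) hv
      simp only [WittVector.map_coeff] at this
      simp only [WittVector.map_coeff, WittVector.coeff_mk, map_pow, this]
      rw [← map_pow, hr]
    · rw [← hθ, hv]
      rfl
    · rw [wittVector_ghostComponent_eq_sum, wittVector_ghostComponent_eq_sum,
        Finset.sum_range_succ, add_sub_right_comm, ← Finset.sum_sub_distrib]
      refine Ideal.add_mem _ (Ideal.sum_mem _ fun i hi => ?_)
        (Ideal.mul_mem_right _ _ (Ideal.pow_mem_pow hp _))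
      have : k + 1 - i = k - i + 1 := by have := Finset.mem_range.1 hi; omega
      rw [WittVector.coeff_mk, ← pow_mul, this, pow_succ' p, sub_self]
      exact Ideal.zero_mem _
  have hstep : ∀ k u a b, Ideal.Quotient.mk _ a = F k u → Ideal.Quotient.mk _ b = F (k + 1) u →
      b - a ∈ I ^ (k + 1) := fun k u a b ha hb => by
    obtain ⟨a', ha', b', hb', hab⟩ := hF k u
    have h1 := Ideal.Quotient.eq.1 (ha'.trans ha.symm)
    have h2 := Ideal.pow_le_pow_right (Nat.le_succ _) (Ideal.Quotient.eq.1 (hb.trans hb'.symm))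
    have : b - a = (b - b') + (b' - a') + (a' - a) := by ring
    rw [this]
    exact Ideal.add_mem _ (Ideal.add_mem _ h2 hab) h1
  have hL : ∀ u, ∃ L, ∀ k, Ideal.Quotient.mk _ L = F k u := fun u => by
    choose a ha using fun k => Ideal.Quotient.mk_surjective (F k u)
    obtain ⟨L, hL⟩ := h.2 a fun k =>
      Ideal.pow_le_pow_right (Nat.le_succ _) (hstep k u _ _ (ha k) (ha (k + 1)))
    refine ⟨L, fun k => ?_⟩
    rw [← ha k, Ideal.Quotient.eq]
    have : L - a k = (L - a (k + 1)) + (a (k + 1) - a k) := by ring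
    rw [this]
    exact Ideal.add_mem _ (hL (k + 1)) (hstep k u _ _ (ha k) (ha (k + 1)))
  choose L hL using hL
  have huniq : ∀ x y, (∀ k, Ideal.Quotient.mk (I ^ (k + 1)) x = Ideal.Quotient.mk _ y) → x = y :=
    fun x y hxy => h.eq_of_sub_mem fun M =>
      Ideal.pow_le_pow_right (Nat.le_succ _) (Ideal.Quotient.eq.1 (hxy M))
  refine ⟨{ toFun := L, map_one' := ?_, map_mul' := ?_, map_zero' := ?_, map_add' := ?_ }, ?_⟩
  · exact huniq _ _ fun k => by rw [hL, map_one, map_one]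
  · exact fun u v => huniq _ _ fun k => by rw [hL, map_mul, map_mul, hL, hL]
  · exact huniq _ _ fun k => by rw [hL, map_zero, map_zero]
  · exact fun u v => huniq _ _ fun k => by rw [hL, map_add, map_add, hL, hL]
  · intro u
    change Ideal.Quotient.mk I (L u) = _
    obtain ⟨v, hv⟩ := WittVector.map_surjective (Ideal.Quotient.mk I) Ideal.Quotient.mk_surjective
      (WittVector.map f (WittVector.map (r 0) u))
    have h1 : Ideal.Quotient.mk (I ^ (0 + 1)) (L u) =
        Ideal.Quotient.mk _ (WittVector.ghostComponent 0 v) := by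
      rw [hL, ← hθ, hv]
      rfl
    rw [Ideal.Quotient.eq, zero_add, pow_one, ← Ideal.Quotient.eq] at h1
    rw [h1, wittVector_ghostComponent_eq_sum]
    have h2 := congrArg (fun w => WittVector.coeff w 0) hv
    simp only [WittVector.map_coeff] at h2
    simp [h2, r]

theorem wittLift_ext {I : Ideal O} (h : Complete I) (hp : (p : O) ∈ I)
    {F G : WittVector p κ →+* O} (hFG : ∀ u, F u - G u ∈ I) : F = G := by
  have hT : ∀ a, F (WittVector.teichmuller p a) = G (WittVector.teichmuller p a) := fun a => by
    refine h.eq_of_sub_mem fun M => Ideal.pow_le_pow_right (Nat.le_succ M) ?_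
    obtain ⟨b, rfl⟩ := exists_root p M a
    simp only [map_pow]
    exact sub_mem_pow_of_pow_sub_mem hp (hFG _) M
  ext u
  refine h.eq_of_sub_mem fun M => Ideal.pow_le_pow_right (Nat.le_succ M) ?_
  obtain ⟨v, hv⟩ := WittVector.dvd_sub_sum_teichmuller_iterateFrobeniusEquiv_coeff u M
  rw [sub_eq_iff_eq_add] at hv
  rw [hv, map_add, map_add, map_sum, map_sum]
  simp only [map_mul, map_pow, map_natCast, hT]
  rw [add_sub_add_right_eq_sub, ← mul_sub]
  exact Ideal.mul_mem_right _ _ (Ideal.pow_mem_pow hp _)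

end

end

section

variable {R C : Type*} [CommRing R] [CommRing C] [Algebra R C] {m : Ideal R}

/-- Every element is either in the extension of `m` or invertible modulo it. -/
def FieldLike (m : Ideal R) (M : Type*) [CommRing M] [Algebra R M] : Prop :=
  ∀ y : M, y ∈ m.map (algebraMap R M) ∨ ∃ z : M, y * z - 1 ∈ m.map (algebraMap R M)

lemma FieldLike.isMaximal {M : Type*} [CommRing M] [Algebra R M] (h : FieldLike m M)
    (htop : m.map (algebraMap R M) ≠ ⊤) : (m.map (algebraMap R M)).IsMaximal := by
  rw [Ideal.isMaximal_iff]
  refine ⟨fun h1 => htop ((Ideal.eq_top_iff_one _).2 h1), fun J y hJ hy hyJ => ?_⟩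
  obtain h1 | ⟨z, hz⟩ := h y
  · exact absurd h1 hy
  · have := J.sub_mem (J.mul_mem_right z hyJ) (hJ hz)
    rwa [sub_sub_cancel] at this

lemma map_algebraMap_ne_top (htop : m.map (algebraMap R C) ≠ ⊤) (M : Subalgebra R C) :
    m.map (algebraMap R M) ≠ ⊤ := by
  intro h
  have h1 := congrArg (Ideal.map M.val.toRingHom) h
  rw [Ideal.map_map, Ideal.map_top] at h1
  exact htop h1

lemma mem_map_algebraMap_of_alghom {M N : Type*} [CommRing M] [CommRing N] [Algebra R M]
    [Algebra R N] (f : M →ₐ[R] N) {y : M} (hy : y ∈ m.map (algebraMap R M)) :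
    f y ∈ m.map (algebraMap R N) := by
  have := Ideal.mem_map_of_mem f.toRingHom hy
  rw [Ideal.map_map] at this
  have hf : f.toRingHom.comp (algebraMap R M) = algebraMap R N := f.comp_algebraMap
  rwa [hf] at this

lemma FieldLike.bot (hm : m.IsMaximal) : FieldLike m (⊥ : Subalgebra R C) := by
  rintro ⟨y, hy⟩
  obtain ⟨r, rfl⟩ := Algebra.mem_bot.1 hy
  by_cases hr : r ∈ m
  · exact Or.inl (Ideal.mem_map_of_mem (algebraMap R (⊥ : Subalgebra R C)) hr)
  · obtain ⟨s, i, hi, hs⟩ := hm.exists_inv hr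
    refine Or.inr ⟨algebraMap R _ s, ?_⟩
    have : (⟨algebraMap R C r, hy⟩ : (⊥ : Subalgebra R C)) * algebraMap R _ s - 1 =
        algebraMap R _ (-i) := by
      have h1 : r * s - 1 = -i := by rw [← hs]; ring
      rw [← h1, map_sub, map_mul, map_one]
      rfl
    rw [this]
    exact Ideal.mem_map_of_mem _ (neg_mem hi)

lemma FieldLike.adjoin_root {p : ℕ} [Fact p.Prime] {T : Set C} {M : Subalgebra R C}
    (hMT : M = Algebra.adjoin R T) (h : FieldLike m M)
    (htop : m.map (algebraMap R C) ≠ ⊤) {τ : C} {b : M} (hb : τ ^ p = b)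
    (hne : ∀ c : M, c ^ p - b ∉ m.map (algebraMap R M)) :
    FieldLike m (Algebra.adjoin R (insert τ T)) := by
  let N := Algebra.adjoin R (insert τ T)
  let I := m.map (algebraMap R M)
  have hmax : I.IsMaximal := h.isMaximal (map_algebraMap_ne_top htop M)
  let _ : Field (M ⧸ I) := Ideal.Quotient.field I
  have hMN : M ≤ N := hMT ▸ Algebra.adjoin_mono (Set.subset_insert _ _)
  let τ' : N := ⟨τ, Algebra.subset_adjoin (Set.mem_insert _ _)⟩
  let ι : M →ₐ[R] N := Subalgebra.inclusion hMN
  let Φ : Polynomial M →+* N := Polynomial.eval₂RingHom ι.toRingHom τ'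
  have hbτ : τ' ^ p = ι b := Subtype.ext hb
  have hΦ : ∀ F, F ∈ RingHom.ker (Polynomial.mapRingHom (Ideal.Quotient.mk I)) →
      Φ F ∈ m.map (algebraMap R N) := by
    intro F hF
    rw [Polynomial.ker_mapRingHom, Ideal.mk_ker] at hF
    have h1 := Ideal.mem_map_of_mem Φ hF
    rw [Ideal.map_map, Ideal.map_map] at h1
    have : (Φ.comp Polynomial.C).comp (algebraMap R M) = algebraMap R N := by
      ext r
      simp [Φ]
    rwa [this] at h1
  have hsurj : Function.Surjective Φ := by
    rintro ⟨y, hy⟩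
    induction hy using Algebra.adjoin_induction with
    | mem x hx =>
      obtain rfl | hx := hx
      · exact ⟨Polynomial.X, by simp [Φ, τ']⟩
      · exact ⟨Polynomial.C ⟨x, hMT ▸ Algebra.subset_adjoin hx⟩, by simp [Φ, ι]⟩
    | algebraMap r =>
      exact ⟨Polynomial.C (algebraMap R M r), by simp [Φ]; rfl⟩
    | add x y hx hy h1 h2 =>
      obtain ⟨F, hF⟩ := h1
      obtain ⟨G, hG⟩ := h2
      exact ⟨F + G, by rw [map_add, hF, hG]; rfl⟩
    | mul x y hx hy h1 h2 =>
      obtain ⟨F, hF⟩ := h1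
      obtain ⟨G, hG⟩ := h2
      exact ⟨F * G, by rw [map_mul, hF, hG]; rfl⟩
  have hirr : Irreducible (Polynomial.X ^ p - Polynomial.C (Ideal.Quotient.mk I b)) := by
    refine X_pow_sub_C_irreducible_of_prime Fact.out fun c hc => ?_
    obtain ⟨c, rfl⟩ := Ideal.Quotient.mk_surjective c
    rw [← map_pow, Ideal.Quotient.eq] at hc
    exact hne c hc
  have hΦ0 : Φ (Polynomial.X ^ p - Polynomial.C b) = 0 := by
    have : Φ (Polynomial.X ^ p - Polynomial.C b) = τ' ^ p - ι b := by simp [Φ]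
    rw [this, hbτ, sub_self]
  have hlift := Polynomial.map_surjective (Ideal.Quotient.mk I) Ideal.Quotient.mk_surjective
  intro y
  obtain ⟨F, rfl⟩ := hsurj y
  by_cases hdvd : Polynomial.X ^ p - Polynomial.C (Ideal.Quotient.mk I b) ∣
      F.map (Ideal.Quotient.mk I)
  · left
    obtain ⟨H, hH⟩ := hdvd
    obtain ⟨H, rfl⟩ := hlift H
    have := hΦ (F - (Polynomial.X ^ p - Polynomial.C b) * H) (by
      rw [RingHom.mem_ker, Polynomial.coe_mapRingHom, Polynomial.map_sub, Polynomial.map_mul, hH]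
      simp)
    rwa [map_sub, map_mul, hΦ0, zero_mul, sub_zero] at this
  · right
    obtain ⟨H, G, hHG⟩ := (hirr.coprime_iff_not_dvd).2 hdvd
    obtain ⟨H, rfl⟩ := hlift H
    obtain ⟨G, rfl⟩ := hlift G
    refine ⟨Φ G, ?_⟩
    have := hΦ (F * G + H * (Polynomial.X ^ p - Polynomial.C b) - 1) (by
      rw [RingHom.mem_ker, Polynomial.coe_mapRingHom, Polynomial.map_sub, Polynomial.map_add,
        Polynomial.map_mul, mul_comm (F.map _), add_comm, Polynomial.map_one, sub_eq_zero, ← hHG]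
      simp)
    rwa [map_sub, map_add, map_mul, map_mul, hΦ0, mul_zero, add_zero, map_one] at this

lemma exists_mem_adjoin_of_mem_sUnion {c : Set (Set C)} (hc : IsChain (· ⊆ ·) c)
    (hne : c.Nonempty) {y : C} (hy : y ∈ Algebra.adjoin R (⋃₀ c)) :
    ∃ T ∈ c, y ∈ Algebra.adjoin R T := by
  have hdir : ∀ T ∈ c, ∀ T' ∈ c, ∃ T'' ∈ c, T ⊆ T'' ∧ T' ⊆ T'' := fun T hT T' hT' => by
    obtain h | h := hc.total hT hT'
    · exact ⟨T', hT', h, subset_rfl⟩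
    · exact ⟨T, hT, subset_rfl, h⟩
  induction hy using Algebra.adjoin_induction with
  | mem x hx =>
    obtain ⟨T, hT, hx⟩ := hx
    exact ⟨T, hT, Algebra.subset_adjoin hx⟩
  | algebraMap r =>
    obtain ⟨T, hT⟩ := hne
    exact ⟨T, hT, Subalgebra.algebraMap_mem _ r⟩
  | add x y _ _ h1 h2 =>
    obtain ⟨T, hT, hx⟩ := h1
    obtain ⟨T', hT', hy⟩ := h2
    obtain ⟨T'', hT'', h1, h2⟩ := hdir T hT T' hT'
    exact ⟨T'', hT'', add_mem (Algebra.adjoin_mono h1 hx) (Algebra.adjoin_mono h2 hy)⟩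
  | mul x y _ _ h1 h2 =>
    obtain ⟨T, hT, hx⟩ := h1
    obtain ⟨T', hT', hy⟩ := h2
    obtain ⟨T'', hT'', h1, h2⟩ := hdir T hT T' hT'
    exact ⟨T'', hT'', mul_mem (Algebra.adjoin_mono h1 hx) (Algebra.adjoin_mono h2 hy)⟩

/-- An algebra with enough `p`-th roots contains a subalgebra over which the maximal ideal stays
maximal and whose residue field is perfect. -/
theorem exists_perfect_residue (p : ℕ) [Fact p.Prime] (hm : m.IsMaximal) (hp : (p : R) ∈ m)
    (htop : m.map (algebraMap R C) ≠ ⊤) (Q : Set C) (hQ : ∀ a, algebraMap R C a ∈ Q)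
    (hroot : ∀ b ∈ Q, ∃ τ ∈ Q, τ ^ p = b) :
    ∃ M : Subalgebra R C, (m.map (algebraMap R M)).IsMaximal ∧
      ∀ y : M, ∃ z : M, z ^ p - y ∈ m.map (algebraMap R M) := by
  obtain ⟨T, hT⟩ := zorn_subset {T : Set C | T ⊆ Q ∧ FieldLike m (Algebra.adjoin R T)}
    (fun c hcS hc => by
      obtain rfl | hne := c.eq_empty_or_nonempty
      · refine ⟨∅, ⟨Set.empty_subset _, ?_⟩, by simp⟩
        rw [Algebra.adjoin_empty]
        exact FieldLike.bot hm
      · refine ⟨⋃₀ c, ⟨Set.sUnion_subset fun T hT => (hcS hT).1, ?_⟩,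
          fun T hT => Set.subset_sUnion_of_mem hT⟩
        rintro ⟨y, hy⟩
        obtain ⟨T, hT, hy'⟩ := exists_mem_adjoin_of_mem_sUnion hc hne hy
        let ι : Algebra.adjoin R T →ₐ[R] Algebra.adjoin R (⋃₀ c) :=
          Subalgebra.inclusion (Algebra.adjoin_mono (Set.subset_sUnion_of_mem hT))
        obtain h | ⟨z, hz⟩ := (hcS hT).2 ⟨y, hy'⟩
        · exact Or.inl (mem_map_algebraMap_of_alghom ι h)
        · have := mem_map_algebraMap_of_alghom ι hz
          rw [map_sub, map_mul, map_one] at this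
          exact Or.inr ⟨ι z, this⟩)
  obtain ⟨⟨hTQ, hTF⟩, hmaxl⟩ := hT
  let M := Algebra.adjoin R T
  let I := m.map (algebraMap R M)
  have hI : I.IsMaximal := hTF.isMaximal (map_algebraMap_ne_top htop _)
  refine ⟨M, hI, ?_⟩
  have hpI : (p : M) ∈ I := by
    have := Ideal.mem_map_of_mem (algebraMap R M) hp
    rwa [map_natCast] at this
  have hkey : ∀ b ∈ Q, ∀ hb : b ∈ M, ∃ z : M, z ^ p - ⟨b, hb⟩ ∈ I := by
    intro b hbQ hb
    by_contra! hne
    obtain ⟨τ, hτ, hτb⟩ := hroot b hbQ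
    have h1 : FieldLike m (Algebra.adjoin R (insert τ T)) :=
      FieldLike.adjoin_root (M := M) rfl hTF htop (b := ⟨b, hb⟩) hτb hne
    have h2 := hmaxl (y := insert τ T) ⟨Set.insert_subset hτ hTQ, h1⟩ (Set.subset_insert _ _)
      (Set.mem_insert _ _)
    refine hne ⟨τ, Algebra.subset_adjoin h2⟩ ?_
    convert I.zero_mem
    rw [sub_eq_zero]
    exact Subtype.ext hτb
  rintro ⟨y, hy⟩
  induction hy using Algebra.adjoin_induction with
  | mem x hx => exact hkey x (hTQ hx) _
  | algebraMap r => exact hkey _ (hQ r) _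
  | add x y hx hy h1 h2 =>
    obtain ⟨a, ha⟩ := h1
    obtain ⟨b, hb⟩ := h2
    refine ⟨a + b, ?_⟩
    obtain ⟨r, hr⟩ := exists_add_pow_prime_eq (Fact.out : p.Prime) a b
    have : (a + b) ^ p - ⟨x + y, add_mem hx hy⟩ =
        (a ^ p - ⟨x, hx⟩) + (b ^ p - ⟨y, hy⟩) + p * (a * b * r) := by
      rw [hr, show (⟨x + y, add_mem hx hy⟩ : M) = ⟨x, hx⟩ + ⟨y, hy⟩ from rfl]
      ring
    rw [this]
    exact I.add_mem (I.add_mem ha hb) (I.mul_mem_right _ hpI)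
  | mul x y hx hy h1 h2 =>
    obtain ⟨a, ha⟩ := h1
    obtain ⟨b, hb⟩ := h2
    refine ⟨a * b, ?_⟩
    have : (a * b) ^ p - ⟨x * y, mul_mem hx hy⟩ =
        (a ^ p - ⟨x, hx⟩) * b ^ p + ⟨x, hx⟩ * (b ^ p - ⟨y, hy⟩) := by
      rw [show (⟨x * y, mul_mem hx hy⟩ : M) = ⟨x, hx⟩ * ⟨y, hy⟩ from rfl]
      ring
    rw [this]
    exact I.add_mem (I.mul_mem_right _ ha) (I.mul_mem_left _ hb)

end

section

open MvPolynomial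

variable {A E : Type*} [CommRing A] [CommRing E]

/-- Nakayama's lemma over a complete ring. -/
theorem Complete.exists_sum_of_mod {I : Ideal A} (h : Complete I) (f : A →+* E)
    (hE : ∀ e, (∀ M, e ∈ I.map f ^ M) → e = 0) {ι : Type*} [Fintype ι] (g : ι → E)
    (hg : ∀ e, ∃ a : ι → A, e - ∑ i, f (a i) * g i ∈ I.map f) (e : E) :
    ∃ a : ι → A, e = ∑ i, f (a i) * g i := by
  have step : ∀ k e, e ∈ I.map f ^ k → ∃ a : ι → A, (∀ i, a i ∈ I ^ k) ∧
      e - ∑ i, f (a i) * g i ∈ I.map f ^ (k + 1) := by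
    intro k e he
    rw [← Ideal.map_pow] at he
    induction he using Submodule.span_induction with
    | mem x hx =>
      obtain ⟨b, hb, rfl⟩ := hx
      obtain ⟨a, ha⟩ := hg 1
      refine ⟨fun i => b * a i, fun i => Ideal.mul_mem_right _ _ hb, ?_⟩
      have : f b - ∑ i, f (b * a i) * g i = f b * (1 - ∑ i, f (a i) * g i) := by
        rw [mul_sub, mul_one, Finset.mul_sum]
        congr 1
        exact Finset.sum_congr rfl fun i _ => by rw [map_mul, mul_assoc]
      rw [this, pow_succ]
      refine Ideal.mul_mem_mul ?_ ha
      rw [← Ideal.map_pow]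
      exact Ideal.mem_map_of_mem f hb
    | zero => exact ⟨0, fun i => Ideal.zero_mem _, by simp⟩
    | add x y _ _ hx hy =>
      obtain ⟨a, ha, ha'⟩ := hx
      obtain ⟨b, hb, hb'⟩ := hy
      refine ⟨fun i => a i + b i, fun i => Ideal.add_mem _ (ha i) (hb i), ?_⟩
      convert Ideal.add_mem _ ha' hb' using 1
      simp only [map_add, add_mul, Finset.sum_add_distrib]
      ring
    | smul c x _ hx =>
      clear hx
      rename_i hx
      obtain ⟨t, ht⟩ : ∃ t : (I ^ k : Ideal A) →₀ E, c * x = t.sum fun b e => e * f b := by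
        have : (I ^ k).map f = Ideal.span (Set.range fun b : (I ^ k : Ideal A) => f b) := by
          rw [Ideal.map]
          congr 1
          ext y
          simp
        have hx2 := Ideal.mul_mem_left ((I ^ k).map f) c hx
        rw [this, Ideal.span, Finsupp.mem_span_range_iff_exists_finsupp] at hx2
        obtain ⟨t, ht⟩ := hx2
        exact ⟨t, ht.symm⟩
      choose a ha using fun b => hg (t b)
      refine ⟨fun i => ∑ b ∈ t.support, (b : A) * a b i, fun i =>
        Ideal.sum_mem _ fun b _ => Ideal.mul_mem_right _ _ b.2, ?_⟩
      have : c • x - ∑ i, f (∑ b ∈ t.support, (b : A) * a b i) * g i =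
          ∑ b ∈ t.support, f b * (t b - ∑ i, f (a b i) * g i) := by
        simp only [map_sum, map_mul, Finset.sum_mul, mul_sub, Finset.sum_sub_distrib,
          Finset.mul_sum, smul_eq_mul]
        rw [Finset.sum_comm, ht, Finsupp.sum]
        congr 1
        · exact Finset.sum_congr rfl fun _ _ => mul_comm _ _
        · exact Finset.sum_congr rfl fun _ _ => Finset.sum_congr rfl fun _ _ => mul_assoc _ _ _
      rw [this, pow_succ]
      refine Ideal.sum_mem _ fun b _ => Ideal.mul_mem_mul ?_ (ha b)
      rw [← Ideal.map_pow]
      exact Ideal.mem_map_of_mem f b.2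
  choose δ hδ hδ' using step
  let F : ∀ k, {a : ι → A // e - ∑ i, f (a i) * g i ∈ I.map f ^ k} := fun k =>
    Nat.rec ⟨0, by simp⟩ (fun k a => ⟨fun i => a.1 i + δ k _ a.2 i, by
      have := hδ' k _ a.2
      convert this using 1
      simp only [map_add, add_mul, Finset.sum_add_distrib]
      ring⟩) k
  have hF : ∀ k i, (F (k + 1)).1 i - (F k).1 i ∈ I ^ k := fun k i => by
    have : (F (k + 1)).1 i = (F k).1 i + δ k _ (F k).2 i := rfl
    rw [this, add_sub_cancel_left]
    exact hδ k _ (F k).2 i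
  choose L hL using fun i => h.2 (fun k => (F k).1 i) fun k => hF k i
  refine ⟨L, sub_eq_zero.1 (hE _ fun M => ?_)⟩
  have : e - ∑ i, f (L i) * g i =
      (e - ∑ i, f ((F M).1 i) * g i) - ∑ i, f (L i - (F M).1 i) * g i := by
    simp only [map_sub, sub_mul, Finset.sum_sub_distrib]
    ring
  rw [this]
  refine Ideal.sub_mem _ (F M).2 (Ideal.sum_mem _ fun i _ => Ideal.mul_mem_right _ _ ?_)
  exact map_pow_le le_rfl (hL i M)

theorem Complete.surjective_of_mod {I : Ideal A} (h : Complete I) (f : A →+* E)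
    (hE : ∀ e, (∀ M, e ∈ I.map f ^ M) → e = 0) (hf : ∀ e, ∃ a, e - f a ∈ I.map f) :
    Function.Surjective f := fun e => by
  obtain ⟨a, ha⟩ := h.exists_sum_of_mod f hE (fun _ : Fin 1 => 1) (fun e => by
    obtain ⟨a, ha⟩ := hf e
    exact ⟨fun _ => a, by simpa using ha⟩) e
  exact ⟨a 0, by simpa using ha.symm⟩

end

section

open MvPolynomial

universe w

variable {p : ℕ} [hp : Fact p.Prime] {n : ℕ}

/-- The sequence consisting of `p` and the variables in a polynomial ring over Witt vectors. -/
noncomputable abbrev wittVars (p : ℕ) [Fact p.Prime] (κ : Type*) [CommRing κ] (n : ℕ) :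
    Fin (n + 1) → MvPolynomial (Fin n) (WittVector p κ) :=
  Fin.cons (p : MvPolynomial (Fin n) (WittVector p κ)) X

lemma gen_comp_cons {A B : Type*} [CommRing A] [CommRing B] (f : A →+* B) (a : A)
    (x : Fin n → A) :
    gen (f ∘ (Fin.cons a x : Fin (n + 1) → A)) = Ideal.span {f a} ⊔ gen (f ∘ x) := by
  rw [gen_fin_succ]
  rfl

lemma exists_sub_teichmuller_mem {κ : Type*} [CommRing κ] [CharP κ p] [PerfectRing κ p]
    (a : MvPolynomial (Fin n) (WittVector p κ)) :
    ∃ b : κ, a - C (WittVector.teichmuller p b) ∈ gen (wittVars p κ n) := by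
  refine ⟨(constantCoeff a).coeff 0, ?_⟩
  have h1 : a - C (constantCoeff a) ∈ gen (X : Fin n → MvPolynomial (Fin n) (WittVector p κ)) := by
    rw [mem_gen_X_iff]
    simp [← constantCoeff_eq]
  have h2 : constantCoeff a - WittVector.teichmuller p ((constantCoeff a).coeff 0) ∈
      Ideal.span {(p : WittVector p κ)} := by
    rw [WittVector.mem_span_p_iff_coeff_zero_eq_zero]
    have := map_sub (WittVector.constantCoeff (p := p)) (constantCoeff a)
      (WittVector.teichmuller p ((constantCoeff a).coeff 0))
    simpa using this
  have h3 := Ideal.mem_map_of_mem (C (σ := Fin n)) h2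
  rw [Ideal.map_span, Set.image_singleton, map_sub, map_natCast] at h3
  have := Ideal.add_mem _ (Ideal.mem_sup_right h1 : _ ∈ Ideal.span {_} ⊔ _)
    (Ideal.mem_sup_left h3 : _ ∈ _ ⊔ gen (X : Fin n → MvPolynomial (Fin n) (WittVector p κ)))
  rw [sub_add_sub_cancel] at this
  rw [gen_fin_succ]
  exact this

variable {κ V : Type*} [CommRing κ] [CharP κ p] [PerfectRing κ p] [CommRing V]
  {f : MvPolynomial (Fin n) (WittVector p κ) →+* V}

lemma AdicDense.exists_sub_teichmuller_mem (h : AdicDense f (gen (wittVars p κ n))) (v : V) :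
    ∃ b : κ, v - f (C (WittVector.teichmuller p b)) ∈ gen (f ∘ wittVars p κ n) := by
  obtain ⟨a, ha⟩ := h.dense 1 v
  obtain ⟨b, hb⟩ := PureRegular.exists_sub_teichmuller_mem a
  refine ⟨b, ?_⟩
  rw [pow_one, map_gen] at ha
  have := Ideal.mem_map_of_mem f hb
  rw [map_gen, map_sub] at this
  have := Ideal.add_mem _ ha this
  rwa [sub_add_sub_cancel] at this

lemma AdicDense.mem_or_exists_mul_sub_one_mem {κ : Type*} [Field κ] [CharP κ p] [PerfectRing κ p]
    {f : MvPolynomial (Fin n) (WittVector p κ) →+* V}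
    (h : AdicDense f (gen (wittVars p κ n))) (v : V) :
    v ∈ gen (f ∘ wittVars p κ n) ∨ ∃ u, v * u - 1 ∈ gen (f ∘ wittVars p κ n) := by
  obtain ⟨b, hb⟩ := h.exists_sub_teichmuller_mem v
  by_cases h0 : b = 0
  · left
    simpa [h0] using hb
  · right
    refine ⟨f (C (WittVector.teichmuller p b⁻¹)), ?_⟩
    have := Ideal.mul_mem_right (f (C (WittVector.teichmuller p b⁻¹))) _ hb
    rw [sub_mul, ← map_mul, ← map_mul, ← map_mul, mul_inv_cancel₀ h0, map_one, map_one,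
      map_one] at this
    exact this

lemma AdicDense.exists_witt_lift {κ : Type*} [CommRing κ]
    {f : MvPolynomial (Fin n) (WittVector p κ) →+* V} (h : AdicDense f (gen (wittVars p κ n)))
    {O : Type*} [CommRing O]
    {K : Ideal O} (hK : Complete K) (F : WittVector p κ →+* O) (x : Fin n → O) (hp : (p : O) ∈ K)
    (hx : ∀ i, x i ∈ K) :
    ∃ θ : V →+* O, (∀ u, θ (f (C u)) = F u) ∧ (∀ i, θ (f (X i)) = x i) ∧
      (gen (f ∘ wittVars p κ n)).map θ ≤ K := by
  obtain ⟨θ, hθ, hθ'⟩ := h.exists_lift hK (g := eval₂Hom F x) (by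
    rw [map_gen, gen_comp_cons, sup_le_iff, map_natCast, Ideal.span_singleton_le_iff_mem]
    refine ⟨hp, Ideal.span_le.2 ?_⟩
    rintro _ ⟨i, rfl⟩
    simpa using hx i)
  rw [map_gen] at hθ'
  refine ⟨θ, fun u => ?_, fun i => ?_, hθ'⟩
  · rw [← RingHom.comp_apply, hθ, eval₂Hom_C]
  · rw [← RingHom.comp_apply, hθ, eval₂Hom_X']

end

section

open MvPolynomial

universe w

variable {p : ℕ} [hp : Fact p.Prime] {n : ℕ}

lemma gen_fg {A : Type*} [CommRing A] (x : Fin n → A) : (gen x).FG := by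
  classical
  exact ⟨Finset.univ.image x, by simp⟩

lemma gen_comp_wittVars_le {κ V : Type*} [CommRing κ] [CommRing V]
    (f : MvPolynomial (Fin n) (WittVector p κ) →+* V) (σ : Fin n → V) :
    gen (f ∘ wittVars p κ n) ≤
      Ideal.span {(p : V) - ∑ i, σ i * f (X i)} ⊔ gen (f ∘ X) := by
  rw [gen_comp_cons, sup_le_iff]
  refine ⟨?_, le_sup_right⟩
  rw [Ideal.span_singleton_le_iff_mem, map_natCast]
  have := Ideal.add_mem _ (Ideal.mem_sup_left (Ideal.mem_span_singleton_self
      ((p : V) - ∑ i, σ i * f (X i))) : _ ∈ _ ⊔ gen (f ∘ X))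
    (Ideal.mem_sup_right (Ideal.sum_mem _ fun i (_ : i ∈ Finset.univ) =>
      Ideal.mul_mem_left _ (σ i) (mem_gen (f ∘ X) i)))
  rwa [Function.comp_def, sub_add_cancel] at this

lemma AdicDense.mem_sup_pow_of_eq_zero {κ V E : Type*} [Field κ] [CharP κ p] [PerfectRing κ p]
    [CommRing V] [CommRing E] {f : MvPolynomial (Fin n) (WittVector p κ) →+* V}
    (h : AdicDense f (gen (wittVars p κ n))) {z : Fin n → E} (hqr : QuasiRegular z ⊥)
    (hz : gen z ≠ ⊤) {θ : V →+* E} (hθ : (gen (f ∘ wittVars p κ n)).map θ ≤ gen z)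
    (hX : ∀ i, θ (f (X i)) = z i) {σ : Fin n → V} (hσ : (p : E) = ∑ i, θ (σ i) * z i)
    {v : V} (hv : θ v = 0) (M : ℕ) :
    v ∈ Ideal.span {(p : V) - ∑ i, σ i * f (X i)} ⊔ gen (f ∘ X) ^ M := by
  have hθω : θ ((p : V) - ∑ i, σ i * f (X i)) = 0 := by
    simp only [map_sub, map_natCast, map_sum, map_mul, hX, ← hσ, sub_self]
  have hcomp : θ ∘ (f ∘ X) = z := funext hX
  induction M with
  | zero => simp
  | succ M ih =>
    obtain ⟨a, ha, b, hb, rfl⟩ := Submodule.mem_sup.1 ih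
    refine Ideal.add_mem _ (Ideal.mem_sup_left ha) ?_
    obtain ⟨G, hG, rfl⟩ := exists_homogeneous_of_mem_pow M hb
    obtain ⟨c, rfl⟩ := Ideal.mem_span_singleton'.1 ha
    rw [map_add, map_mul, hθω, mul_zero, zero_add, ← eval_map_comp, hcomp] at hv
    have hc : ∀ α, G.coeff α ∈ gen (f ∘ wittVars p κ n) := fun α => by
      have h1 := hqr M _ (hG.map θ) (by rw [hv]; exact Ideal.zero_mem _) α
      rw [sup_bot_eq, coeff_map] at h1
      rcases h.mem_or_exists_mul_sub_one_mem (G.coeff α) with h2 | ⟨u, hu⟩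
      · exact h2
      · refine absurd ((Ideal.eq_top_iff_one _).2 ?_) hz
        have h2 := hθ (Ideal.mem_map_of_mem θ hu)
        rw [map_sub, map_mul, map_one] at h2
        have := Ideal.sub_mem _ (Ideal.mul_mem_right (θ u) _ h1) h2
        rwa [sub_sub_cancel] at this
    have h3 := eval_mem_mul hG (x := f ∘ X) hc
    have h4 := Ideal.mul_mono_left (K := gen (f ∘ X) ^ M) (gen_comp_wittVars_le f σ) h3
    rw [Ideal.sup_mul, ← pow_succ'] at h4
    obtain ⟨a', ha', b', hb', hab⟩ := Submodule.mem_sup.1 h4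
    rw [← hab]
    exact Submodule.add_mem_sup (Ideal.mul_le_left ha') hb'

lemma charP_quotient {E : Type*} [CommRing E] {I : Ideal E} (hI : I ≠ ⊤) (hp : (p : E) ∈ I) :
    CharP (E ⧸ I) p := by
  have := Ideal.Quotient.nontrivial_iff.2 hI
  refine (CharP.charP_iff_prime_eq_zero Fact.out).2 ?_
  rw [← map_natCast (Ideal.Quotient.mk I)]
  exact Ideal.Quotient.eq_zero_iff_mem.2 hp

lemma perfectRing_quotient {E : Type*} [CommRing E] {I : Ideal E} [I.IsPrime] [CharP (E ⧸ I) p]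
    (hroot : ∀ y : E, ∃ x, x ^ p - y ∈ I) : PerfectRing (E ⧸ I) p :=
  have : ExpChar (E ⧸ I) p := ExpChar.prime Fact.out
  PerfectRing.ofSurjective _ _ fun y => by
    obtain ⟨y, rfl⟩ := Ideal.Quotient.mk_surjective y
    obtain ⟨x, hx⟩ := hroot y
    exact ⟨Ideal.Quotient.mk I x, by
      rw [frobenius_def, ← map_pow]; exact Ideal.Quotient.eq.2 hx⟩

theorem exists_untilt_of_complete {E : Type w} [CommRing E] {z : Fin n → E}
    (hc : Complete (gen z)) (hqr : QuasiRegular z ⊥) (hmax : (gen z).IsMaximal)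
    (hpz : (p : E) ∈ gen z) (hroot : ∀ y : E, ∃ x, x ^ p - y ∈ gen z) :
    ∃ (B : Type w) (_ : CommRing B) (_ : CharP B p) (_ : PerfectRing B p) (Z : Fin n → B)
      (s : Fin n → WittVector p B), GoodBase Z ∧ ∃ ψ : E →+* Untilt p s Z,
        ∀ i, ψ (z i) = sharp p s Z (Z i) := by
  let κ := E ⧸ gen z
  let _ : Field κ := Ideal.Quotient.field (gen z)
  have _ : CharP κ p := charP_quotient hmax.ne_top hpz
  have _ : PerfectRing κ p := perfectRing_quotient hroot
  obtain ⟨FE, hFE⟩ := exists_wittLift (κ := κ) hc hpz (RingHom.id _)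
  obtain ⟨V, _, f, hVc, hVd⟩ := exists_completion (gen (wittVars p κ n))
    (gen_fg _)
  rw [map_gen] at hVc
  obtain ⟨θ, hθC, hθX, hθ⟩ := hVd.exists_witt_lift hc FE z hpz (mem_gen z)
  have hsurj : Function.Surjective θ := by
    have hJ : (gen (f ∘ wittVars p κ n)).map θ = gen z := le_antisymm hθ <| by
      refine Ideal.span_le.2 ?_
      rintro _ ⟨i, rfl⟩
      rw [← hθX i]
      exact Ideal.mem_map_of_mem θ (mem_gen (f ∘ wittVars p κ n) i.succ)
    refine hVc.surjective_of_mod θ (by rw [hJ]; exact hc.1) fun e => ?_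
    refine ⟨f (C (WittVector.teichmuller p (Ideal.Quotient.mk _ e))), ?_⟩
    rw [hJ, hθC, ← Ideal.Quotient.eq, hFE, WittVector.teichmuller_coeff_zero, RingHom.id_apply]
  obtain ⟨σ', hσ'⟩ := Ideal.mem_span_range_iff_exists_fun.1 hpz
  choose σ hσ using fun i => hsurj (σ' i)
  have hX : gen (X : Fin n → MvPolynomial (Fin n) κ) ≠ ⊤ := gen_X_isMaximal.ne_top
  obtain ⟨B, _, _, _, f0, hB, -⟩ := exists_completed_perfection p (quasiRegular_X (k := κ)) hX
  let Z : Fin n → B := f0 ∘ X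
  have hW := hB.complete.wittVector (p := p)
  obtain ⟨θW, hWC, hWX, hθW⟩ := hVd.exists_witt_lift hW (WittVector.map (f0.comp C))
    (fun i => WittVector.teichmuller p (Z i)) (mem_gen (PureRegular.wittSeq p Z) 0)
    (fun i => mem_gen (PureRegular.wittSeq p Z) i.succ)
  let s : Fin n → WittVector p B := fun i => θW (σ i)
  have hU := GoodBase.untilt (p := p) hB s
  refine ⟨B, _, ‹_›, ‹_›, Z, s, hB, ?_⟩
  let q : V →+* Untilt p s Z := (Ideal.Quotient.mk _).comp θW
  have hqX : q ∘ (f ∘ X) = sharp p s Z ∘ Z := funext fun i => by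
    change Ideal.Quotient.mk _ (θW (f (X i))) = _
    rw [hWX]
    rfl
  have hqω : q ((p : V) - ∑ i, σ i * f (X i)) = 0 := by
    refine Ideal.Quotient.eq_zero_iff_mem.2 ?_
    have : θW ((p : V) - ∑ i, σ i * f (X i)) = omega p s Z := by
      simp only [map_sub, map_natCast, map_sum, map_mul, hWX]
      rfl
    rw [this]
    exact Ideal.mem_span_singleton_self _
  have hker : RingHom.ker θ ≤ RingHom.ker q := fun v hv => by
    rw [RingHom.mem_ker] at hv ⊢
    refine hU.complete.1 _ fun M => ?_
    have h1 := hVd.mem_sup_pow_of_eq_zero hqr hmax.ne_top hθ hθX (σ := σ)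
      (by simp only [hσ, hσ']) hv M
    have h2 := Ideal.mem_map_of_mem q h1
    rw [Ideal.map_sup, Ideal.map_span, Set.image_singleton, hqω, Ideal.span_singleton_zero,
      bot_sup_eq, map_gen_pow, hqX] at h2
    exact h2
  refine ⟨RingHom.liftOfSurjective θ hsurj ⟨q, hker⟩, fun i => ?_⟩
  rw [← hθX i, RingHom.liftOfSurjective_comp_apply]
  exact congrFun hqX i

end

section

open MvPolynomial

universe w

variable {p : ℕ} [hp : Fact p.Prime] {n : ℕ}

/-- The relations adjoining compatible `p`-power roots of all elements. -/
noncomputable def powerRootRelation (p : ℕ) (S : Type*) [CommRing S] :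
    S × ℕ → MvPolynomial (S × ℕ) S
  | (a, 0) => X (a, 0) - C a
  | (a, k + 1) => X (a, k + 1) ^ p - X (a, k)

theorem exists_power_roots (p : ℕ) [Fact p.Prime] {S : Type w} [CommRing S] {z : Fin n → S}
    (h : QuasiRegular z ⊥)
    (hz : gen z ≠ ⊤) :
    ∃ (C : Type w) (_ : CommRing C) (_ : Algebra S C) (Y : S → ℕ → C),
      QuasiRegular (algebraMap S C ∘ z) ⊥ ∧ gen (algebraMap S C ∘ z) ≠ ⊤ ∧
      (∀ a, Y a 0 = algebraMap S C a) ∧ ∀ a k, Y a (k + 1) ^ p = Y a k := by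
  classical
  let K : Ideal (MvPolynomial (S × ℕ) S) := Ideal.span (Set.range (powerRootRelation p S))
  let π : MvPolynomial (S × ℕ) S →+* MvPolynomial (S × ℕ) S ⧸ K := Ideal.Quotient.mk K
  have hqr : QuasiRegular ((C : S →+* MvPolynomial (S × ℕ) S) ∘ z) K := by
    refine QuasiRegular.of_monic_relations h (powerRootRelation p S) (fun j => j) Prod.snd ?_ ?_
    · rintro ⟨a, m⟩
      cases m with
      | zero =>
        refine ⟨Polynomial.X - Polynomial.C (C (Ideal.Quotient.mk _ a)),
          Polynomial.monic_X_sub_C _, ?_⟩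
        simp [powerRootRelation]
      | succ m =>
        refine ⟨Polynomial.X ^ p - Polynomial.C (X ⟨(a, m), by simp⟩),
          Polynomial.monic_X_pow_sub_C _ (Nat.Prime.ne_zero Fact.out), ?_⟩
        simp [powerRootRelation]
    · rintro ⟨a, m⟩ j hij hr
      cases m with
      | zero => exact ⟨X ⟨(a, 0), hij⟩ - C (Ideal.Quotient.mk _ a), by simp [powerRootRelation]⟩
      | succ m =>
        refine ⟨X ⟨(a, m + 1), hij⟩ ^ p - X ⟨(a, m), ?_⟩, by simp [powerRootRelation]⟩
        rintro rfl
        simp at hr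
  have hqr' : QuasiRegular ((π.comp C) ∘ z) ⊥ := by
    have := QuasiRegular.of_surjective (f := π) Ideal.Quotient.mk_surjective
      (by rw [Ideal.mk_ker]) hqr
    rwa [Ideal.map_quotient_self] at this
  refine ⟨MvPolynomial (S × ℕ) S ⧸ K, inferInstance, inferInstance, fun a k => π (X (a, k)),
    hqr', ?_, fun a => ?_, fun a k => ?_⟩
  · obtain ⟨m, hm, hle⟩ := Ideal.exists_le_maximal _ hz
    let _ : Field (S ⧸ m) := Ideal.Quotient.field m
    let Ω := AlgebraicClosure (S ⧸ m)
    let g0 : S →+* Ω := (algebraMap (S ⧸ m) Ω).comp (Ideal.Quotient.mk m)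
    have hroot : ∀ x : Ω, ∃ y, y ^ p = x := fun x =>
      IsAlgClosed.exists_pow_nat_eq x (Nat.Prime.pos Fact.out)
    choose r hr using hroot
    let y : S × ℕ → Ω := fun t => r^[t.2] (g0 t.1)
    have hKg : ∀ a ∈ K, eval₂Hom g0 y a = 0 := fun a ha => by
      have : K ≤ RingHom.ker (eval₂Hom g0 y) := Ideal.span_le.2 (Set.range_subset_iff.2 (by
        rintro ⟨a, m⟩
        cases m with
        | zero => simp [powerRootRelation, y]
        | succ m => simp [powerRootRelation, y, Function.iterate_succ_apply', hr]))
      exact this ha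
    let g : MvPolynomial (S × ℕ) S ⧸ K →+* Ω := Ideal.Quotient.lift K (eval₂Hom g0 y) hKg
    intro htop
    have h1 := congrArg (Ideal.map g) htop
    rw [map_gen, Ideal.map_top] at h1
    have h2 : g ∘ (algebraMap S (MvPolynomial (S × ℕ) S ⧸ K) ∘ z) = 0 := by
      funext i
      change Ideal.Quotient.lift K (eval₂Hom g0 y) _ (Ideal.Quotient.mk K (C (z i))) = 0
      refine (Ideal.Quotient.lift_mk _ _ hKg).trans ?_
      rw [eval₂Hom_C]
      simp only [g0, RingHom.comp_apply]
      rw [Ideal.Quotient.eq_zero_iff_mem.2 (hle (mem_gen z i)), map_zero]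
    rw [h2] at h1
    refine one_ne_zero (α := Ω) ?_
    have : (1 : Ω) ∈ gen (0 : Fin n → Ω) := h1 ▸ Submodule.mem_top
    have h3 : gen (0 : Fin n → Ω) ≤ ⊥ := Ideal.span_le.2 (by rintro _ ⟨i, rfl⟩; simp)
    exact (Ideal.mem_bot.1 (h3 this))
  · rw [← sub_eq_zero, show algebraMap S (MvPolynomial (S × ℕ) S ⧸ K) a = π (C a) from rfl,
      ← map_sub]
    exact Ideal.Quotient.eq_zero_iff_mem.2 (Ideal.subset_span ⟨(a, 0), rfl⟩)
  · rw [← sub_eq_zero, ← map_pow, ← map_sub]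
    exact Ideal.Quotient.eq_zero_iff_mem.2 (Ideal.subset_span ⟨(a, k + 1), rfl⟩)

lemma AdicDense.isMaximal {A B : Type*} [CommRing A] [CommRing B] {f : A →+* B} {I : Ideal A}
    (h : AdicDense f I) (hI : I.IsMaximal) : (I.map f).IsMaximal := by
  rw [Ideal.isMaximal_iff]
  refine ⟨fun h1 => hI.ne_top ((Ideal.eq_top_iff_one _).2 ?_), fun J y hJ hy hyJ => ?_⟩
  · simpa using h.mem 1 1 (by simpa using h1)
  · obtain ⟨a, ha⟩ := h.dense 1 y
    rw [pow_one] at ha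
    have haI : a ∉ I := fun haI => hy (by
      have := Ideal.add_mem _ ha (Ideal.mem_map_of_mem f haI)
      rwa [sub_add_cancel] at this)
    obtain ⟨b, i, hi, hb⟩ := hI.exists_inv haI
    have h1 : f a ∈ J := by
      have := J.sub_mem hyJ (hJ ha)
      rwa [sub_sub_cancel] at this
    rw [← map_one f, ← hb, map_add, map_mul]
    exact J.add_mem (J.mul_mem_left _ h1) (hJ (Ideal.mem_map_of_mem f hi))

lemma AdicDense.exists_pow_sub_mem {p : ℕ} {A B : Type*} [CommRing A] [CommRing B] {f : A →+* B}
    {I : Ideal A} (h : AdicDense f I) (hI : ∀ y : A, ∃ x, x ^ p - y ∈ I) (y : B) :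
    ∃ x, x ^ p - y ∈ I.map f := by
  obtain ⟨a, ha⟩ := h.dense 1 y
  obtain ⟨x, hx⟩ := hI a
  refine ⟨f x, ?_⟩
  rw [pow_one] at ha
  have := Ideal.sub_mem _ (Ideal.mem_map_of_mem f hx) ha
  rw [map_sub, map_pow] at this
  convert this using 1
  ring

theorem exists_untilt {S : Type w} [CommRing S] {z : Fin n → S}
    (hqr : QuasiRegular z ⊥) (hmax : (gen z).IsMaximal) (hpz : (p : S) ∈ gen z) :
    ∃ (B : Type w) (_ : CommRing B) (_ : CharP B p) (_ : PerfectRing B p) (Z : Fin n → B)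
      (s : Fin n → WittVector p B), GoodBase Z ∧ ∃ ψ : S →+* Untilt p s Z,
        ∀ i, ψ (z i) = sharp p s Z (Z i) := by
  obtain ⟨C, _, _, Y, hC, hCtop, hY0, hYs⟩ := exists_power_roots p hqr hmax.ne_top
  rw [← map_gen] at hCtop
  obtain ⟨M, hM, hMroot⟩ := exists_perfect_residue p hmax hpz hCtop
    (Set.range fun t : S × ℕ => Y t.1 t.2) (fun a => ⟨(a, 0), hY0 a⟩) (by
      rintro _ ⟨⟨a, k⟩, rfl⟩
      exact ⟨_, ⟨(a, k + 1), rfl⟩, hYs a k⟩)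
  rw [map_gen] at hM hMroot hCtop
  have hMqr : QuasiRegular (algebraMap S M ∘ z) ⊥ := by
    refine QuasiRegular.of_map (f := M.val.toRingHom) hC fun a ha => ?_
    have h1 : gen (algebraMap S M ∘ z) ≤
        (gen (M.val.toRingHom ∘ (algebraMap S M ∘ z))).comap M.val.toRingHom := by
      rw [← Ideal.map_le_iff_le_comap, map_gen]
    have h2 := hM.eq_of_le (fun h => hCtop ?_) h1
    · rw [h2]; exact ha
    · have h3 := (Ideal.eq_top_iff_one _).1 h
      rw [Ideal.mem_comap, map_one] at h3
      exact (Ideal.eq_top_iff_one _).2 h3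
  obtain ⟨E, _, f, hfc, hfd⟩ := exists_completion _ (gen_fg (algebraMap S M ∘ z))
  have hEmax := hfd.isMaximal hM
  have hEroot := hfd.exists_pow_sub_mem hMroot
  have hEqr := hMqr.completion hfd
  rw [map_gen] at hfc hEmax hEroot
  have hpE : (p : E) ∈ gen (f ∘ (algebraMap S M ∘ z)) := by
    rw [← map_gen, ← map_gen]
    have := Ideal.mem_map_of_mem f (Ideal.mem_map_of_mem (algebraMap S M) hpz)
    rwa [map_natCast, map_natCast] at this
  obtain ⟨B, i1, i2, i3, Z, s, hZ, ψ, hψ⟩ :=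
    exists_untilt_of_complete hfc hEqr hEmax hpE hEroot
  exact ⟨B, i1, i2, i3, Z, s, hZ, ψ.comp (f.comp (algebraMap S M)), hψ⟩

/-- Functoriality of the untilt. -/
noncomputable def untiltMap {B B' : Type*} [CommRing B] [CommRing B']
    (s : Fin n → WittVector p B) (Z : Fin n → B)
    (ι : B →+* B') : Untilt p s Z →+* Untilt p (WittVector.map ι ∘ s) (ι ∘ Z) :=
  Ideal.quotientMap _ (WittVector.map ι) (by
    rw [Ideal.span_singleton_le_iff_mem, Ideal.mem_comap, map_omega]
    exact Ideal.mem_span_singleton_self _)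

lemma untiltMap_mk {B B' : Type*} [CommRing B] [CommRing B']
    (s : Fin n → WittVector p B) (Z : Fin n → B) (ι : B →+* B') (u : WittVector p B) :
    untiltMap s Z ι (Ideal.Quotient.mk _ u) = Ideal.Quotient.mk _ (WittVector.map ι u) := rfl

lemma untiltMap_sharp {B B' : Type*} [CommRing B] [CommRing B']
    (s : Fin n → WittVector p B) (Z : Fin n → B) (ι : B →+* B') (b : B) :
    untiltMap s Z ι (sharp p s Z b) = sharp p _ _ (ι b) := by
  change Ideal.Quotient.mk _ (WittVector.map ι _) = _
  rw [WittVector.map_teichmuller]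
  rfl

theorem exists_sharp_extension {B : Type w} [CommRing B] [CharP B p] [PerfectRing B p]
    {Z : Fin n → B} (h : GoodBase Z) (s : Fin n → WittVector p B) {T : Type w}
    (a : T → Untilt p s Z) :
    ∃ (B' : Type w) (_ : CommRing B') (_ : CharP B' p) (_ : PerfectRing B' p) (ι : B →+* B')
      (Y : T → B'), GoodBase (ι ∘ Z) ∧ ∀ t, sharp p _ _ (Y t) = untiltMap s Z ι (a t) := by
  choose γ hγ using fun t => Ideal.Quotient.mk_surjective (a t)
  obtain ⟨B', i1, i2, i3, ι, Y, hB, hY, -⟩ := exists_root_extension h s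
    (fun t => Polynomial.X - Polynomial.C (γ t)) (fun t => Polynomial.monic_X_sub_C _)
    (fun t => by
      have : Nontrivial B := CharP.nontrivial_of_char_ne_one (hp.out.ne_one)
      have : Nontrivial (WittVector p B) :=
        (WittVector.constantCoeff (p := p) (R := B)).domain_nontrivial
      rw [Polynomial.natDegree_X_sub_C]
      exact one_ne_zero)
  refine ⟨B', i1, i2, i3, ι, Y, hB, fun t => ?_⟩
  rw [← hγ, untiltMap_mk]
  have := hY t
  rw [Polynomial.eval₂_sub, Polynomial.eval₂_X, Polynomial.eval₂_C, map_omega] at this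
  exact Ideal.Quotient.eq.2 this

theorem exists_perfectoid {S : Type w} [CommRing S] {z : Fin n → S}
    (hqr : QuasiRegular z ⊥) (hmax : (gen z).IsMaximal) (hpz : (p : S) ∈ gen z) :
    ∃ (B : Type w) (_ : CommRing B) (_ : CharP B p) (_ : PerfectRing B p) (Z : Fin n → B)
      (s : Fin n → WittVector p B), GoodBase Z ∧ ∃ ψ : S →+* Untilt p s Z,
        (∀ i, ψ (z i) = sharp p s Z (Z i)) ∧ ∀ a, ∃ b, sharp p s Z b = ψ a := by
  obtain ⟨B, i1, i2, i3, Z, s, hZ, ψ, hψ⟩ := exists_untilt hqr hmax hpz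
  obtain ⟨B', j1, j2, j3, ι, Y, hB, hY⟩ := exists_sharp_extension hZ s ψ
  refine ⟨B', j1, j2, j3, ι ∘ Z, WittVector.map ι ∘ s, hB, (untiltMap s Z ι).comp ψ, fun i => ?_,
    fun a => ⟨Y a, hY a⟩⟩
  rw [RingHom.comp_apply, hψ, untiltMap_sharp]
  rfl

end

section

open MvPolynomial

/-- A nonempty set of exponents has a unique element of least weight, for suitable weights. -/
theorem exists_weight (d : ℕ) : ∀ A : Set (Fin (d + 1) → ℕ), A.Nonempty →
    ∃ e : Fin (d + 1) → ℕ, (∀ i, 0 < e i) ∧ e (Fin.last d) = 1 ∧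
      ∃ a ∈ A, ∀ b ∈ A, b ≠ a → ∑ i, e i * a i < ∑ i, e i * b i := by
  induction d with
  | zero =>
    intro A hA
    obtain ⟨a, ha, hmin⟩ := WellFounded.has_min (measure fun a : Fin 1 → ℕ => a 0).wf A hA
    refine ⟨fun _ => 1, by simp, rfl, a, ha, fun b hb hba => ?_⟩
    have h1 : ¬ b 0 < a 0 := hmin b hb
    have h2 : b 0 ≠ a 0 := fun h => hba (funext fun i => by rw [Fin.fin_one_eq_zero i, h])
    simp only [Fin.sum_univ_succ, Finset.univ_eq_empty, Finset.sum_empty]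
    omega
  | succ d ih =>
    intro A hA
    obtain ⟨a, ha, hmin⟩ := WellFounded.has_min (measure fun a : Fin (d + 2) → ℕ => a 0).wf A hA
    obtain ⟨e, he, hlast, t, ht, htmin⟩ := ih {t | Fin.cons (a 0) t ∈ A}
      ⟨Fin.tail a, by simpa [Fin.cons_self_tail] using ha⟩
    refine ⟨Fin.cons (1 + ∑ i, e i * t i) e, ?_, ?_, Fin.cons (a 0) t, ht, fun b hb hne => ?_⟩
    · intro i
      refine Fin.cases ?_ (fun i => ?_) i
      · simp
      · simpa using he i
    · rw [← Fin.succ_last, Fin.cons_succ, hlast]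
    · have h1 : ¬ b 0 < a 0 := hmin b hb
      simp only [Fin.sum_univ_succ (n := d + 1), Fin.cons_zero, Fin.cons_succ]
      rcases (not_lt.1 h1).eq_or_lt with h2 | h2
      · rw [← h2]
        have h3 := htmin (Fin.tail b) (by
          change Fin.cons (a 0) (Fin.tail b) ∈ A
          rw [h2, Fin.cons_self_tail]
          exact hb) (by
          rintro rfl
          exact hne (by rw [h2, Fin.cons_self_tail]))
        exact Nat.add_lt_add_left h3 _
      · have := Nat.mul_le_mul_left (1 + ∑ i, e i * t i) h2
        rw [Nat.succ_eq_add_one, mul_add] at this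
        omega

variable {A : Type*} [CommRing A] {n : ℕ}

/-- An expansion of `c` along `x`, modulo `𝔬`, whose nonzero coefficients avoid `𝔬 ⊔ gen x`. -/
structure Expansion (x : Fin n → A) (𝔬 : Ideal A) (c : A) where
  form : ℕ → MvPolynomial (Fin n) A
  homogeneous : ∀ L, (form L).IsHomogeneous L
  coeff : ∀ L α, (form L).coeff α ∈ 𝔬 ⊔ gen x → (form L).coeff α = 0
  sub_mem : ∀ L, c - ∑ l ∈ Finset.range L, eval x (form l) ∈ 𝔬 ⊔ gen x ^ L

lemma exists_filtered_form {x : Fin n → A} {𝔬 : Ideal A} {L : ℕ} {F : MvPolynomial (Fin n) A}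
    (hF : F.IsHomogeneous L) :
    ∃ G : MvPolynomial (Fin n) A, G.IsHomogeneous L ∧
      (∀ α, G.coeff α ∈ 𝔬 ⊔ gen x → G.coeff α = 0) ∧
      (∀ α, F.coeff α ∉ 𝔬 ⊔ gen x → G.coeff α = F.coeff α) ∧
      eval x F - eval x G ∈ 𝔬 ⊔ gen x ^ (L + 1) := by
  classical
  let G : MvPolynomial (Fin n) A :=
    ∑ α ∈ F.support with F.coeff α ∉ 𝔬 ⊔ gen x, monomial α (F.coeff α)
  have hG : ∀ α, G.coeff α = if F.coeff α ∉ 𝔬 ⊔ gen x then F.coeff α else 0 := fun α => by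
    simp only [G, coeff_sum, coeff_monomial, Finset.sum_ite_eq', Finset.mem_filter, mem_support_iff]
    by_cases h0 : F.coeff α = 0
    · simp [h0]
    · simp [h0]
  have hGh : G.IsHomogeneous L := by
    intro α hα
    refine hF (d := α) fun h0 => hα ?_
    rw [hG, h0, ite_self]
  refine ⟨G, hGh, fun α hα => ?_, fun α hα => by rw [hG, if_pos hα], ?_⟩
  · rw [hG] at hα ⊢
    split_ifs at hα ⊢ with h
    · rfl
    · exact absurd hα h
  · rw [← map_sub]
    have h1 : ∀ α, (F - G).coeff α ∈ 𝔬 ⊔ gen x := fun α => by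
      rw [coeff_sub, hG]
      split_ifs with h
      · simpa using h
      · simp
    have h2 := eval_mem_mul (hF.sub hGh) (x := x) h1
    rw [Ideal.sup_mul, ← pow_succ'] at h2
    obtain ⟨a', ha', b', hb', hab⟩ := Submodule.mem_sup.1 h2
    rw [← hab]
    exact Submodule.add_mem_sup (Ideal.mul_le_left ha') hb'

lemma exists_form_step {x : Fin n → A} {𝔬 : Ideal A} {L : ℕ} {c : A} (hc : c ∈ 𝔬 ⊔ gen x ^ L) :
    ∃ G : MvPolynomial (Fin n) A, G.IsHomogeneous L ∧
      (∀ α, G.coeff α ∈ 𝔬 ⊔ gen x → G.coeff α = 0) ∧ c - eval x G ∈ 𝔬 ⊔ gen x ^ (L + 1) := by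
  obtain ⟨a, ha, b, hb, rfl⟩ := Submodule.mem_sup.1 hc
  obtain ⟨F, hF, rfl⟩ := exists_homogeneous_of_mem_pow L hb
  obtain ⟨G, hG, hG0, -, hFG⟩ := exists_filtered_form (x := x) (𝔬 := 𝔬) hF
  refine ⟨G, hG, hG0, ?_⟩
  rw [add_sub_assoc]
  exact Ideal.add_mem _ (Ideal.mem_sup_left ha) hFG

/-- Every partial expansion extends. -/
lemma exists_expansion {x : Fin n → A} {𝔬 : Ideal A} {c : A} (k : ℕ)
    (F : MvPolynomial (Fin n) A) (hF : F.IsHomogeneous k)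
    (hF0 : ∀ α, F.coeff α ∈ 𝔬 ⊔ gen x → F.coeff α = 0) (hck : c ∈ 𝔬 ⊔ gen x ^ k)
    (hc : c - eval x F ∈ 𝔬 ⊔ gen x ^ (k + 1)) :
    ∃ E : Expansion x 𝔬 c, E.form k = F := by
  choose! G hG hG0 hGc using fun (L : ℕ) (c : A) (hc : c ∈ 𝔬 ⊔ gen x ^ L) => exists_form_step hc
  let r : ℕ → A := fun m => Nat.rec (c - eval x F) (fun m a => a - eval x (G (k + 1 + m) a)) m
  have hr : ∀ m, r m ∈ 𝔬 ⊔ gen x ^ (k + 1 + m) := by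
    intro m
    induction m with
    | zero => exact hc
    | succ m ih => exact hGc _ _ ih
  let form : ℕ → MvPolynomial (Fin n) A := fun L =>
    if L < k then 0 else if L = k then F else G L (r (L - (k + 1)))
  have hlt : ∀ L, L < k → form L = 0 := fun L h => if_pos h
  have hk : form k = F := by simp [form]
  have hgt : ∀ m, form (k + 1 + m) = G (k + 1 + m) (r m) := fun m => by
    have h1 : ¬ k + 1 + m < k := by omega
    have h2 : ¬ k + 1 + m = k := by omega
    simp only [form, if_neg h1, if_neg h2, Nat.add_sub_cancel_left]
  have hcases : ∀ L, L < k ∨ L = k ∨ ∃ m, L = k + 1 + m := fun L => by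
    rcases lt_trichotomy L k with h | h | h
    · exact Or.inl h
    · exact Or.inr (Or.inl h)
    · exact Or.inr (Or.inr ⟨L - (k + 1), by omega⟩)
  have hsum0 : ∀ L, L ≤ k → ∑ l ∈ Finset.range L, eval x (form l) = 0 := fun L hL =>
    Finset.sum_eq_zero fun l hl => by
      rw [hlt l ((Finset.mem_range.1 hl).trans_le hL), map_zero]
  have hsum : ∀ m, c - ∑ l ∈ Finset.range (k + 1 + m), eval x (form l) = r m := by
    intro m
    induction m with
    | zero =>
      rw [add_zero, Finset.sum_range_succ, hsum0 k le_rfl, hk, zero_add]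
      rfl
    | succ m ih =>
      rw [← add_assoc, Finset.sum_range_succ, ← sub_sub, ih, hgt]
  refine ⟨⟨form, fun L => ?_, fun L => ?_, fun L => ?_⟩, hk⟩
  · rcases hcases L with h | rfl | ⟨m, rfl⟩
    · rw [hlt L h]; exact isHomogeneous_zero _ _ _
    · rwa [hk]
    · rw [hgt]; exact hG _ _ (hr m)
  · rcases hcases L with h | rfl | ⟨m, rfl⟩
    · simp [hlt L h]
    · rwa [hk]
    · rw [hgt]; exact hG0 _ _ (hr m)
  · rcases hcases L with h | rfl | ⟨m, rfl⟩
    · rw [hsum0 L h.le, sub_zero]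
      exact sup_le_sup_left (gen_pow_mono x h.le) _ hck
    · rwa [hsum0 L le_rfl, sub_zero]
    · rw [hsum]; exact hr m

theorem Expansion.exists_pow_mem {d : ℕ} {x : Fin (d + 1) → A} {𝔬 : Ideal A} {c : A}
    (E : Expansion x 𝔬 c) (hE : ∃ L, E.form L ≠ 0)
    (hu : ∀ a, a ∈ 𝔬 ⊔ gen x ∨ ∃ u, a * u - 1 ∈ 𝔬 ⊔ gen x) :
    ∃ e : Fin (d + 1) → ℕ, (∀ i, 0 < e i) ∧ e (Fin.last d) = 1 ∧ ∃ w,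
      ∀ 𝔟 : Ideal A, 𝔬 ≤ 𝔟 → c ∈ 𝔟 → (∀ i, x i - x (Fin.last d) ^ e i ∈ 𝔟) →
        x (Fin.last d) ^ w ∈ 𝔟 ⊔ Ideal.span {x (Fin.last d) ^ (w + 1)} := by
  obtain ⟨L₀, hL₀⟩ := hE
  obtain ⟨β, hβ⟩ := exists_coeff_ne_zero hL₀
  obtain ⟨e, he, hlast, a, ⟨α₀, ⟨L₁, hα₀⟩, rfl⟩, hmin⟩ := exists_weight d
    ((fun α : Fin (d + 1) →₀ ℕ => ⇑α) '' {α | ∃ L, (E.form L).coeff α ≠ 0})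
    ⟨β, ⟨β, ⟨L₀, hβ⟩, rfl⟩⟩
  let wt : (Fin (d + 1) →₀ ℕ) → ℕ := fun α => ∑ i, e i * α i
  have hdeg : ∀ {L α}, (E.form L).coeff α ≠ 0 → L = α.degree := fun {L α} h => by
    by_contra hd
    exact h ((E.homogeneous L).coeff_eq_zero (Ne.symm hd))
  have hdw : ∀ α, α.degree ≤ wt α := fun α => by
    rw [Finsupp.degree_eq_sum]
    exact Finset.sum_le_sum fun i _ => Nat.le_mul_of_pos_left _ (he i)
  refine ⟨e, he, hlast, wt α₀, fun 𝔟 h𝔬 hc hy => ?_⟩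
  set t := x (Fin.last d) with ht
  set w := wt α₀ with hw
  set 𝔠 := 𝔟 ⊔ Ideal.span {t ^ (w + 1)} with h𝔠
  have h𝔟 : 𝔟 ≤ 𝔠 := le_sup_left
  have ht𝔠 : t ^ (w + 1) ∈ 𝔠 := Ideal.mem_sup_right (Ideal.mem_span_singleton_self _)
  let π := Ideal.Quotient.mk 𝔠
  have hπx : ∀ i, π (x i) = π t ^ e i := fun i => by
    rw [← map_pow]
    exact Ideal.Quotient.eq.2 (h𝔟 (hy i))
  have hπt : π t ^ (w + 1) = 0 := by
    rw [← map_pow]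
    exact Ideal.Quotient.eq_zero_iff_mem.2 ht𝔠
  have hxt : (gen x).map π ≤ Ideal.span {π t} := by
    rw [map_gen]
    refine Ideal.span_le.2 (Set.range_subset_iff.2 fun i => ?_)
    change π (x i) ∈ _
    rw [hπx i]
    exact Ideal.pow_mem_of_mem _ (Ideal.mem_span_singleton_self _) _ (he i)
  have hmon : ∀ α : Fin (d + 1) →₀ ℕ, π (∏ i, x i ^ α i) = π t ^ wt α := fun α => by
    rw [map_prod, ← Finset.prod_pow_eq_pow_sum]
    exact Finset.prod_congr rfl fun i _ => by rw [map_pow, hπx i, pow_mul]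
  have heval : ∀ L, π (eval x (E.form L)) =
      ∑ α ∈ (E.form L).support, π ((E.form L).coeff α) * π t ^ wt α := fun L => by
    rw [eval_eq', map_sum]
    exact Finset.sum_congr rfl fun α _ => by rw [map_mul, hmon]
  have hterm : ∀ L α, α ∈ (E.form L).support → α ≠ α₀ →
      π ((E.form L).coeff α) * π t ^ wt α = 0 := fun L α hα hne => by
    have h1 : w + 1 ≤ wt α := hmin α ⟨α, ⟨L, mem_support_iff.1 hα⟩, rfl⟩ fun h =>
      hne (DFunLike.coe_injective h)
    obtain ⟨m, hm⟩ := Nat.exists_eq_add_of_le h1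
    rw [hm, pow_add, hπt, zero_mul, mul_zero]
  have hsum : π (∑ l ∈ Finset.range (w + 1), eval x (E.form l)) =
      π ((E.form L₁).coeff α₀) * π t ^ w := by
    rw [map_sum, Finset.sum_eq_single L₁]
    · rw [heval, Finset.sum_eq_single α₀ (fun α hα hne => hterm _ α hα hne)]
      intro h
      exact absurd (mem_support_iff.2 hα₀) h
    · intro L _ hL
      rw [heval]
      refine Finset.sum_eq_zero fun α hα => hterm _ α hα ?_
      rintro rfl
      exact hL ((hdeg (mem_support_iff.1 hα)).trans (hdeg hα₀).symm)
    · intro h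
      refine absurd ?_ h
      rw [Finset.mem_range, hdeg hα₀]
      exact Nat.lt_succ_of_le (hdw α₀)
  have h1 : π (c - ∑ l ∈ Finset.range (w + 1), eval x (E.form l)) = 0 := by
    obtain ⟨a, ha, b, hb, hab⟩ := Submodule.mem_sup.1 (E.sub_mem (w + 1))
    rw [← hab, map_add, Ideal.Quotient.eq_zero_iff_mem.2 (h𝔟 (h𝔬 ha)), zero_add]
    have h2 := Ideal.mem_map_of_mem π hb
    rw [Ideal.map_pow] at h2
    have h3 := Ideal.pow_right_mono hxt _ h2
    rw [Ideal.span_singleton_pow, hπt] at h3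
    simpa using h3
  rw [map_sub, Ideal.Quotient.eq_zero_iff_mem.2 (h𝔟 hc), zero_sub, neg_eq_zero, hsum] at h1
  rcases hu ((E.form L₁).coeff α₀) with h2 | ⟨u, hu⟩
  · exact absurd (E.coeff _ _ h2) hα₀
  · have h3 : π ((E.form L₁).coeff α₀ * u - 1) ∈ Ideal.span {π t} := by
      obtain ⟨a, ha, b, hb, hab⟩ := Submodule.mem_sup.1 hu
      rw [← hab, map_add, Ideal.Quotient.eq_zero_iff_mem.2 (h𝔟 (h𝔬 ha)), zero_add]
      exact hxt (Ideal.mem_map_of_mem π hb)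
    obtain ⟨v, hv⟩ := Ideal.mem_span_singleton'.1 h3
    rw [← Ideal.Quotient.eq_zero_iff_mem]
    change π (t ^ w) = 0
    rw [map_sub, map_mul, map_one] at hv
    rw [map_pow]
    have h4 : π t ^ w = π ((E.form L₁).coeff α₀) * π t ^ w * π u - v * π t ^ (w + 1) := by
      rw [pow_succ, show v * (π t ^ w * π t) = v * π t * π t ^ w by ring, hv]
      ring
    rw [h4, h1, hπt, zero_mul, mul_zero, sub_zero]

end

section

open MvPolynomial

universe w

variable {p : ℕ} [hp : Fact p.Prime] {d : ℕ}

/-- A ring with a set of representatives modulo a finitely generated ideal `J` is finitely generated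
modulo every power of `J`. -/
lemma exists_generators_mod_pow {A E : Type*} [CommRing A] [CommRing E] (θ : A →+* E) {J : Ideal E}
    (hJ : J.FG) (hθ : ∀ e, ∃ a, e - θ a ∈ J) (k : ℕ) :
    ∃ (ι : Type) (_ : Fintype ι) (g : ι → E), ∀ e, ∃ a : ι → A, e - ∑ i, θ (a i) * g i ∈ J ^ k := by
  obtain ⟨N, m, rfl⟩ := Submodule.fg_iff_exists_fin_generating_family.1 hJ
  induction k with
  | zero => exact ⟨Empty, inferInstance, Empty.elim, fun e => ⟨Empty.elim, by simp⟩⟩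
  | succ k ih =>
    obtain ⟨ι, _, g, hg⟩ := ih
    refine ⟨Option (Fin N × ι), inferInstance, fun o => o.elim 1 fun t => m t.1 * g t.2,
      fun e => ?_⟩
    obtain ⟨a, ha⟩ := hθ e
    obtain ⟨c, hc⟩ := Ideal.mem_span_range_iff_exists_fun.1 ha
    choose b hb using hg
    refine ⟨fun o => o.elim a fun t => b (c t.1) t.2, ?_⟩
    have : e - ∑ o : Option (Fin N × ι), θ (o.elim a fun t => b (c t.1) t.2) *
        (o.elim 1 fun t => m t.1 * g t.2) =
        ∑ l, (c l - ∑ i, θ (b (c l) i) * g i) * m l := by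
      rw [Fintype.sum_option, Fintype.sum_prod_type]
      simp only [Option.elim, mul_one, sub_mul, Finset.sum_sub_distrib, hc, Finset.sum_mul]
      rw [← sub_sub]
      congr 1
      exact Finset.sum_congr rfl fun l _ => Finset.sum_congr rfl fun i _ => by ring
    rw [this, pow_succ]
    exact Ideal.sum_mem _ fun l _ => Ideal.mul_mem_mul (hb _)
      (Submodule.subset_span ⟨l, rfl⟩)

lemma exists_monic_of_generators {A E : Type*} [CommRing A] [CommRing E] [Nontrivial E]
    (θ : A →+* E) {ι : Type*} [Fintype ι] {g : ι → E}
    (hg : ∀ e, ∃ a : ι → A, e = ∑ i, θ (a i) * g i) (e : E) :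
    ∃ G : Polynomial A, G.Monic ∧ G.natDegree ≠ 0 ∧ G.eval₂ θ e = 0 := by
  let _ := θ.toAlgebra
  have : Module.Finite A E := by
    refine Module.Finite.of_surjective (Fintype.linearCombination A g) fun e => ?_
    obtain ⟨a, rfl⟩ := hg e
    exact ⟨a, rfl⟩
  obtain ⟨G, hG, hG0⟩ := Algebra.IsIntegral.isIntegral (R := A) e
  refine ⟨G, hG, fun h => ?_, hG0⟩
  rw [hG.natDegree_eq_zero.1 h] at hG0
  simp at hG0

theorem exists_witt_cover {R : Type u} {D : Type w} [CommRing R] [CommRing D] [Algebra R D]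
    {m : Ideal R} (hm : m.IsMaximal) (hmfg : m.FG) {x : Fin d → R} (hx : ∀ i, x i ∈ m)
    {k : ℕ} (hk : m ^ k ≤ gen x) (hpx : (p : R) ∈ gen x)
    {K : Ideal D} (hK : Complete K) (hKtop : K ≠ ⊤) (hmK : m.map (algebraMap R D) ≤ K)
    (Q : Set D) (hQ : ∀ a, algebraMap R D a ∈ Q) (hroot : ∀ b ∈ Q, ∃ τ ∈ Q, τ ^ p = b) :
    ∃ (κ : Type w) (_ : Field κ) (_ : CharP κ p) (_ : PerfectRing κ p) (V : Type w)
      (_ : CommRing V) (f : MvPolynomial (Fin d) (WittVector p κ) →+* V) (Ψ : V →+* D)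
      (ρ : κ →+* D ⧸ K),
      AdicDense f (gen (wittVars p κ d)) ∧ (∀ i, Ψ (f (X i)) = algebraMap R D (x i)) ∧
      (∀ u, Ideal.Quotient.mk K (Ψ (f (C u))) = ρ (u.coeff 0)) ∧
      ∀ r : R, ∃ G : Polynomial V, G.Monic ∧ G.natDegree ≠ 0 ∧
        G.eval₂ Ψ (algebraMap R D r) = 0 := by
  have htop : m.map (algebraMap R D) ≠ ⊤ := fun h => hKtop (top_le_iff.1 (h ▸ hmK))
  have hpm : (p : R) ∈ m := (Ideal.span_le.2 (Set.range_subset_iff.2 hx) : gen x ≤ m) hpx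
  obtain ⟨M, hM, hMroot⟩ := exists_perfect_residue p hm hpm htop Q hQ hroot
  obtain ⟨E, _, g, hgc, hgd⟩ := exists_completion _ (hmfg.map (algebraMap R M))
  let J := (m.map (algebraMap R M)).map g
  have hJmax : J.IsMaximal := hgd.isMaximal hM
  have hJroot := hgd.exists_pow_sub_mem hMroot
  obtain ⟨Φ, hΦ, hΦK⟩ := hgd.exists_lift hK (g := M.val.toRingHom) (by
    rw [Ideal.map_map]
    exact hmK)
  let ε : R →+* E := g.comp (algebraMap R M)
  have hΦε : ∀ r, Φ (ε r) = algebraMap R D r := fun r => by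
    change (Φ.comp g) (algebraMap R M r) = _
    rw [hΦ]
    rfl
  have hJε : J = m.map ε := Ideal.map_map _ _
  have hpJ : (p : E) ∈ J := by
    rw [hJε, ← map_natCast ε]
    exact Ideal.mem_map_of_mem ε hpm
  let κ := E ⧸ J
  let _ : Field κ := Ideal.Quotient.field J
  have _ : CharP κ p := charP_quotient hJmax.ne_top hpJ
  have _ : PerfectRing κ p := perfectRing_quotient hJroot
  obtain ⟨F, hF⟩ := exists_wittLift (κ := κ) hgc hpJ (RingHom.id _)
  obtain ⟨V, _, f, hVc, hVd⟩ := exists_completion _ (gen_fg (wittVars p κ d))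
  rw [map_gen] at hVc
  have hxJ : ∀ i, ε (x i) ∈ J := fun i => by
    rw [hJε]
    exact Ideal.mem_map_of_mem ε (hx i)
  obtain ⟨θ, hθC, hθX, hθ⟩ := hVd.exists_witt_lift hgc F (fun i => ε (x i)) hpJ hxJ
  have hres : ∀ e, e - F (WittVector.teichmuller p (Ideal.Quotient.mk J e)) ∈ J := fun e => by
    rw [← Ideal.Quotient.eq, hF, WittVector.teichmuller_coeff_zero, RingHom.id_apply]
  have hpε : (p : E) ∈ gen (ε ∘ x) := by
    rw [← map_gen, ← map_natCast ε]
    exact Ideal.mem_map_of_mem ε hpx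
  have hmap : (gen (f ∘ wittVars p κ d)).map θ = gen (ε ∘ x) := by
    have h1 : θ ∘ f ∘ X = ε ∘ x := funext hθX
    rw [gen_comp_cons, Ideal.map_sup, Ideal.map_span, Set.image_singleton, map_gen, h1,
      map_natCast, map_natCast, sup_eq_right, Ideal.span_le, Set.singleton_subset_iff]
    exact hpε
  have hpow : J ^ k ≤ gen (ε ∘ x) := by
    rw [hJε, ← Ideal.map_pow, ← map_gen]
    exact Ideal.map_mono hk
  have hle : gen (ε ∘ x) ≤ J := Ideal.span_le.2 (Set.range_subset_iff.2 hxJ)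
  have hJK : J ≤ Ideal.comap Φ K := by
    rw [← Ideal.map_le_iff_le_comap]
    exact hΦK
  let ρ : κ →+* D ⧸ K := Ideal.Quotient.lift J ((Ideal.Quotient.mk K).comp Φ) fun a ha =>
    Ideal.Quotient.eq_zero_iff_mem.2 (hJK ha)
  have hfg : J.FG := by
    rw [hJε]
    exact hmfg.map ε
  have : Nontrivial E := by
    by_contra h
    rw [not_nontrivial_iff_subsingleton] at h
    exact hJmax.ne_top (Subsingleton.elim _ _)
  obtain ⟨ι, _, gg, hgg⟩ := exists_generators_mod_pow θ hfg (fun e =>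
    ⟨f (MvPolynomial.C (WittVector.teichmuller p (Ideal.Quotient.mk J e))), by
      rw [hθC]
      exact hres e⟩) k
  have hgen := hVc.exists_sum_of_mod θ (fun e he => hgc.1 _ fun M =>
      Ideal.pow_right_mono (hmap.le.trans hle) M (he M)) gg
    (fun e => (hgg e).imp fun a ha => hmap.ge (hpow ha))
  refine ⟨κ, inferInstance, inferInstance, inferInstance, V, inferInstance, f, Φ.comp θ, ρ, hVd,
    fun i => ?_, fun u => ?_, fun r => ?_⟩
  · rw [RingHom.comp_apply, hθX, hΦε]
  · rw [RingHom.comp_apply, hθC]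
    change ρ (Ideal.Quotient.mk J (F u)) = _
    rw [hF, RingHom.id_apply]
  · obtain ⟨G, hG, hG1, hG0⟩ := exists_monic_of_generators θ hgen (ε r)
    refine ⟨G, hG, hG1, ?_⟩
    rw [← hΦε, ← Polynomial.hom_eval₂, hG0, map_zero]

end

section

open MvPolynomial

universe w

variable {p : ℕ} [hp : Fact p.Prime] {n d : ℕ}

lemma Complete.isUnit_one_sub {A : Type*} [CommRing A] {I : Ideal A} (h : Complete I) {a : A}
    (ha : a ∈ I) : IsUnit (1 - a) := by
  obtain ⟨L, hL⟩ := h.2 (fun k => ∑ i ∈ Finset.range k, a ^ i) fun k => by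
    simp only [Finset.sum_range_succ, add_sub_cancel_left]
    exact Ideal.pow_mem_pow ha k
  refine IsUnit.of_mul_eq_one L (sub_eq_zero.1 (h.1 _ fun k => ?_))
  have h1 := mul_neg_geom_sum a k
  have h2 : (1 - a) * L - 1 = (1 - a) * (L - ∑ i ∈ Finset.range k, a ^ i) - a ^ k := by
    linear_combination h1
  rw [h2]
  exact Ideal.sub_mem _ (Ideal.mul_mem_left _ _ (hL k)) (Ideal.pow_mem_pow ha k)

variable {B : Type w} [CommRing B] [CharP B p] [PerfectRing B p] {Z : Fin n → B}

lemma GoodBase.span_omega_eq (h : GoodBase Z) {s : Fin n → WittVector p B} {b : B}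
    (hb : b ∈ gen Z)
    (hω : (p : WittVector p B) - WittVector.teichmuller p b ∈ Ideal.span {omega p s Z}) :
    Ideal.span {(p : WittVector p B) - WittVector.teichmuller p b} =
      Ideal.span {omega p s Z} := by
  obtain ⟨u, hu⟩ := Ideal.mem_span_singleton'.1 hω
  have : CharP (B ⧸ gen Z) p := by
    have : Nontrivial (B ⧸ gen Z) := Ideal.Quotient.nontrivial_iff.2 h.ne_top
    exact charP_of_ringHom p (Ideal.Quotient.mk (gen Z))
  have hmk : ∀ {c : B}, c ∈ gen Z → WittVector.map (Ideal.Quotient.mk (gen Z))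
      (WittVector.teichmuller p c) = 0 := fun {c} hc => by
    rw [WittVector.map_teichmuller, Ideal.Quotient.eq_zero_iff_mem.2 hc,
      WittVector.teichmuller_zero]
  have h1 := congrArg (WittVector.map (Ideal.Quotient.mk (gen Z))) hu
  rw [map_mul, omega, map_sub, map_sub, hmk hb, map_sum, map_natCast, sub_zero,
    Finset.sum_eq_zero (fun i _ => by rw [map_mul, hmk (mem_gen Z i), mul_zero]), sub_zero] at h1
  have h2 : (WittVector.map (Ideal.Quotient.mk (gen Z)) (u - 1)) * (p : WittVector p (B ⧸ gen Z)) =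
      0 := by
    rw [map_sub, sub_mul, h1, map_one, one_mul, sub_self]
  have h3 := congrArg (fun v => WittVector.coeff v 1) h2
  simp only [WittVector.mul_charP_coeff_succ, WittVector.zero_coeff, WittVector.map_coeff] at h3
  rw [← map_pow, Ideal.Quotient.eq_zero_iff_mem] at h3
  have h4 : (u - 1) ^ p ∈ gen (wittSeq p Z) := by
    rw [mem_gen_wittSeq]
    have := map_pow (WittVector.constantCoeff (p := p) (R := B)) (u - 1) p
    simp only [WittVector.constantCoeff_apply] at this
    rwa [this]
  have h5 : (1 - u) ^ p ∈ gen (wittSeq p Z) := by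
    rw [← neg_sub, neg_pow]
    exact Ideal.mul_mem_left _ _ h4
  have h6 := h.complete.wittVector (p := p) |>.isUnit_one_sub h5
  have h7 : IsUnit u := by
    refine isUnit_of_dvd_unit ?_ h6
    have := sub_dvd_pow_sub_pow 1 (1 - u) p
    rwa [one_pow, sub_sub_cancel] at this
  rw [← hu, Ideal.span_singleton_mul_left_unit h7]

/-- A homomorphism from a perfect ring to the residue ring of an untilt lifts along `sharp`. -/
lemma GoodBase.exists_residue_lift (h : GoodBase Z) (s : Fin n → WittVector p B) {κ : Type*}
    [CommRing κ] [CharP κ p] [PerfectRing κ p]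
    (ρ : κ →+* Untilt p s Z ⧸ gen (sharp p s Z ∘ Z)) :
    ∃ g : κ →+* B, ∀ a, Ideal.Quotient.mk (gen (sharp p s Z ∘ Z)) (sharp p s Z (g a)) = ρ a := by
  let c : WittVector p B →+* B ⧸ gen Z := (Ideal.Quotient.mk (gen Z)).comp WittVector.constantCoeff
  have hc : ∀ u, c u = 0 ↔ u ∈ gen (wittSeq p Z) := fun u => by
    rw [mem_gen_wittSeq]
    exact Ideal.Quotient.eq_zero_iff_mem
  have hω : omega p s Z ∈ gen (wittSeq p Z) := by
    rw [← gen_cons_omega (s := s)]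
    exact mem_gen (Fin.cons (omega p s Z) (WittVector.teichmuller p ∘ Z)) 0
  let ε : Untilt p s Z →+* B ⧸ gen Z := Ideal.Quotient.lift _ c fun u hu =>
    (hc u).2 (Ideal.span_le.2 (Set.singleton_subset_iff.2 hω) hu)
  have hε : ∀ v, ε v = 0 ↔ v ∈ gen (sharp p s Z ∘ Z) := fun v => by
    obtain ⟨u, rfl⟩ := Ideal.Quotient.mk_surjective v
    rw [← map_gen_wittSeq]
    refine ⟨fun hu => Ideal.mem_map_of_mem _ ((hc u).1 hu), fun hu => ?_⟩
    obtain ⟨u', hu', he⟩ := (Ideal.mem_map_iff_of_surjective _ Ideal.Quotient.mk_surjective).1 hu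
    rw [← he]
    exact (hc u').2 hu'
  let ε' : Untilt p s Z ⧸ gen (sharp p s Z ∘ Z) →+* B ⧸ gen Z :=
    Ideal.Quotient.lift _ ε fun v hv => (hε v).2 hv
  have hinj : Function.Injective ε' := (injective_iff_map_eq_zero _).2 fun v hv => by
    obtain ⟨u, rfl⟩ := Ideal.Quotient.mk_surjective v
    exact Ideal.Quotient.eq_zero_iff_mem.2 ((hε u).1 hv)
  obtain ⟨F, hF⟩ := exists_wittLift h.complete (p := p) (by simp) (ε'.comp ρ)
  refine ⟨RingHom.liftOfSurjective WittVector.constantCoeff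
    (WittVector.constantCoeff_surjective p) ⟨F, ?_⟩, fun a => hinj ?_⟩
  · rw [WittVector.ker_constantCoeff, Ideal.span_singleton_le_iff_mem, RingHom.mem_ker]
    simp
  · obtain ⟨u, rfl⟩ := WittVector.constantCoeff_surjective p a
    rw [RingHom.liftOfSurjective_comp_apply]
    have h1 : ε' (Ideal.Quotient.mk _ (sharp p s Z (F u))) = Ideal.Quotient.mk (gen Z) (F u) := by
      change Ideal.Quotient.mk (gen Z) ((WittVector.teichmuller p (F u)).coeff 0) = _
      rw [WittVector.teichmuller_coeff_zero]
    exact h1.trans (hF u)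

end

section

open MvPolynomial

universe w

variable {p : ℕ} [hp : Fact p.Prime] {n d : ℕ}

variable {B : Type w} [CommRing B] [CharP B p] [PerfectRing B p] {Z : Fin n → B}

lemma sharp_mem_gen {s : Fin n → WittVector p B} {b : B} :
    sharp p s Z b ∈ gen (sharp p s Z ∘ Z) ↔ b ∈ gen Z := by
  rw [← map_gen_wittSeq]
  refine ⟨fun hu => ?_, fun hb => Ideal.mem_map_of_mem _ (by
    rwa [mem_gen_wittSeq, WittVector.teichmuller_coeff_zero])⟩
  obtain ⟨u, hu, he⟩ := (Ideal.mem_map_iff_of_surjective _ Ideal.Quotient.mk_surjective).1 hu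
  have hω : omega p s Z ∈ gen (wittSeq p Z) := by
    rw [← gen_cons_omega (s := s)]
    exact mem_gen (Fin.cons (omega p s Z) (WittVector.teichmuller p ∘ Z)) 0
  have h1 : u - WittVector.teichmuller p b ∈ gen (wittSeq p Z) :=
    Ideal.span_le.2 (Set.singleton_subset_iff.2 hω) (Ideal.Quotient.eq.1 he)
  have h2 := Ideal.sub_mem _ hu h1
  rwa [sub_sub_cancel, mem_gen_wittSeq, WittVector.teichmuller_coeff_zero] at h2

lemma mk_sub_sharp_mem (s : Fin n → WittVector p B) (u : WittVector p B) :
    Ideal.Quotient.mk (Ideal.span {omega p s Z}) u - sharp p s Z (u.coeff 0) ∈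
      gen (sharp p s Z ∘ Z) := by
  rw [← map_gen_wittSeq]
  have h1 : u - WittVector.teichmuller p (u.coeff 0) ∈ gen (wittSeq p Z) := by
    rw [mem_gen_wittSeq]
    have := map_sub (WittVector.constantCoeff (p := p) (R := B)) u
      (WittVector.teichmuller p (u.coeff 0))
    simp only [WittVector.constantCoeff_apply, WittVector.teichmuller_coeff_zero, sub_self] at this
    rw [this]
    exact Ideal.zero_mem _
  exact Ideal.mem_map_of_mem (Ideal.Quotient.mk (Ideal.span {omega p s Z})) h1

theorem GoodBase.exists_coordinate_base (h : GoodBase Z) {s : Fin n → WittVector p B}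
    {κ V : Type w} [Field κ] [CharP κ p] [PerfectRing κ p] [CommRing V]
    {f : MvPolynomial (Fin d) (WittVector p κ) →+* V} (hf : AdicDense f (gen (wittVars p κ d)))
    (Ψ : V →+* Untilt p s Z) (ρ : κ →+* Untilt p s Z ⧸ gen (sharp p s Z ∘ Z))
    (hρ : ∀ u, Ideal.Quotient.mk (gen (sharp p s Z ∘ Z)) (Ψ (f (C u))) = ρ (u.coeff 0))
    {y : Fin d → B} (hy : ∀ i, sharp p s Z (y i) = Ψ (f (X i)))
    (hK : ∀ i, Ψ (f (X i)) ∈ gen (sharp p s Z ∘ Z)) {i₀ : Fin d} (hi₀ : Ψ (f (X i₀)) = p) :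
    ∃ (A : Type w) (_ : CommRing A) (_ : CharP A p) (_ : PerfectRing A p) (Y : Fin d → A)
      (q : V →+* WittVector p A) (g : A →+* B), GoodBase Y ∧
      (∀ i, q (f (X i)) = WittVector.teichmuller p (Y i)) ∧ (∀ i, g (Y i) = y i) ∧
      (∀ v, Ideal.Quotient.mk (Ideal.span {omega p s Z}) (WittVector.map g (q v)) = Ψ v) ∧
      Ideal.span {WittVector.map g (omega p (Pi.single i₀ 1) Y)} = Ideal.span {omega p s Z} := by
  obtain ⟨e, he⟩ := h.exists_residue_lift s ρ
  have hyZ : ∀ i, y i ∈ gen Z := fun i => by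
    rw [← sharp_mem_gen (s := s), hy]
    exact hK i
  obtain ⟨A, _, _, _, fA, hA, hlift⟩ := exists_completed_perfection p
    (quasiRegular_X (k := κ) (n := d)) gen_X_isMaximal.ne_top
  obtain ⟨g, hg⟩ := hlift B (eval₂Hom e y) (gen Z) h.complete
    (Ideal.span_le.2 (Set.range_subset_iff.2 fun i => by simpa using hyZ i))
  have hgY : ∀ i, g (fA (X i)) = y i := fun i => by
    rw [← RingHom.comp_apply, hg, eval₂Hom_X']
  have hgC : ∀ a, g (fA (C a)) = e a := fun a => by
    rw [← RingHom.comp_apply, hg, eval₂Hom_C]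
  obtain ⟨q, hqC, hqX, -⟩ := hf.exists_witt_lift (hA.complete.wittVector (p := p))
    (WittVector.map (fA.comp C)) (fun i => WittVector.teichmuller p (fA (X i)))
    (mem_gen (wittSeq p (fA ∘ X)) 0)
    (fun i => by
      rw [mem_gen_wittSeq, WittVector.teichmuller_coeff_zero]
      exact mem_gen (fA ∘ X) i)
  have hpK : (p : Untilt p s Z) ∈ gen (sharp p s Z ∘ Z) := hi₀ ▸ hK i₀
  let G : V →+* Untilt p s Z :=
    ((Ideal.Quotient.mk (Ideal.span {omega p s Z})).comp (WittVector.map g)).comp q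
  have hGX : ∀ i, G (f (X i)) = Ψ (f (X i)) := fun i => by
    change Ideal.Quotient.mk _ (WittVector.map g (q (f (X i)))) = _
    rw [hqX, WittVector.map_teichmuller, hgY, ← hy]
    rfl
  have hGC : (G.comp f).comp C = (Ψ.comp f).comp C := by
    refine wittLift_ext (h.untilt (p := p) s).complete hpK fun u => ?_
    rw [← Ideal.Quotient.eq]
    refine Eq.trans ?_ (hρ u).symm
    rw [← he, Ideal.Quotient.eq]
    have h1 := mk_sub_sharp_mem (Z := Z) s (WittVector.map g (q (f (C u))))
    rw [WittVector.map_coeff, hqC, WittVector.map_coeff, RingHom.comp_apply, hgC] at h1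
    rw [← hqC] at h1
    exact h1
  have hG : G = Ψ := by
    refine hf.hom_ext (h.untilt (p := p) s).complete.1 ?_
      (MvPolynomial.ringHom_ext' hGC hGX)
    rw [map_gen, map_gen, gen, Ideal.span_le, Set.range_subset_iff]
    refine Fin.cases ?_ fun i => ?_
    · simpa using hpK
    · have := hK i
      rw [← hGX] at this
      simpa using this
  refine ⟨A, inferInstance, inferInstance, inferInstance, fA ∘ X, q, g, hA, hqX, hgY,
    fun v => congrArg (fun θ => θ v) hG, ?_⟩
  rw [omega_single, map_sub, map_natCast, WittVector.map_teichmuller]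
  refine h.span_omega_eq ?_ ?_
  · exact (hgY i₀).symm ▸ hyZ i₀
  · rw [← Ideal.Quotient.eq_zero_iff_mem, map_sub, map_natCast]
    change _ - sharp p s Z (g (fA (X i₀))) = 0
    rw [hgY, hy, hi₀, sub_self]

end

section

open MvPolynomial

universe w

lemma exists_pow_mul_eq_zero {V Ω : Type*} [CommRing V] [CommRing Ω] (θ : V →+* Ω) {𝔮 : Ideal V}
    (h𝔮 : ∀ v ∈ 𝔮, θ v = 0) (h1 : (1 : V) ∉ 𝔮) {ξ : Ω} {G : Polynomial V} (hG : G.Monic)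
    (hξ : G.eval₂ θ ξ = 0) : ∃ c ∉ 𝔮, ∃ N t, ξ ^ N * (θ c + ξ * t) = 0 := by
  classical
  have key : ∀ N (G : Polynomial V), (∀ k < N, G.coeff k ∈ 𝔮) →
      ∃ t, G.eval₂ θ ξ = ξ ^ N * (θ (G.coeff N) + ξ * t) := by
    intro N
    induction N with
    | zero =>
      intro G _
      refine ⟨G.divX.eval₂ θ ξ, ?_⟩
      conv_lhs => rw [← G.divX_mul_X_add]
      rw [Polynomial.eval₂_add, Polynomial.eval₂_mul_X, Polynomial.eval₂_C]
      ring
    | succ N ih =>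
      intro G hG
      obtain ⟨t, ht⟩ := ih G.divX fun k hk => by
        rw [Polynomial.coeff_divX]
        exact hG _ (by omega)
      refine ⟨t, ?_⟩
      conv_lhs => rw [← G.divX_mul_X_add]
      rw [Polynomial.eval₂_add, Polynomial.eval₂_mul_X, Polynomial.eval₂_C,
        h𝔮 _ (hG 0 N.succ_pos), ht, Polynomial.coeff_divX]
      ring
  have hex : ∃ k, G.coeff k ∉ 𝔮 := ⟨G.natDegree, by rwa [hG.coeff_natDegree]⟩
  obtain ⟨t, ht⟩ := key (Nat.find hex) G fun k hk => not_not.1 (Nat.find_min hex hk)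
  exact ⟨_, Nat.find_spec hex, _, t, ht.symm.trans hξ⟩

lemma mul_eq_zero_of_pow_mul_eq_zero {Ω : Type*} [CommRing Ω] [IsReduced Ω] {r ξ : Ω} {k N : ℕ}
    (h : ξ ^ N * r ^ k = 0) : r * ξ = 0 := by
  refine IsReduced.eq_zero _ ⟨k + N, ?_⟩
  rw [mul_pow, pow_add, pow_add]
  linear_combination (r ^ N * ξ ^ k) * h

lemma QuasiRegular.colon_of_mul_sub_eq_zero {d : ℕ} {Ω : Type*} [CommRing Ω] {x : Fin d → Ω}
    (h : QuasiRegular x ⊥) (j : Fin d) {r : Ω} {y : Fin d → Ω}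
    (hr : r * (y j * x j - ∑ i ∈ Finset.univ.filter (· < j), y i * x i) = 0) (M : ℕ) :
    r * y j ∈ gen x ^ M ⊔ Ideal.span (x '' {i | i < j}) := by
  have h1 := h.colon j (u := r * y j) (by
    have h1 : x j * (r * y j) = ∑ i ∈ Finset.univ.filter (· < j), r * y i * x i := by
      simp only [mul_sub, Finset.mul_sum, ← mul_assoc] at hr
      rw [← sub_eq_zero, ← hr]
      ring
    rw [bot_sup_eq, h1]
    exact Ideal.sum_mem _ fun i hi => Ideal.mul_mem_left _ _
      (Ideal.subset_span ⟨i, (Finset.mem_filter.1 hi).2, rfl⟩)) M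
  rwa [bot_sup_eq] at h1

variable {p : ℕ} [hp : Fact p.Prime] {n d : ℕ}

/-- Functoriality of untilts along a homomorphism respecting the distinguished elements. -/
noncomputable def untiltLift {A B : Type*} [CommRing A] [CommRing B] {t : Fin d → WittVector p A}
    {Y : Fin d → A} {s : Fin n → WittVector p B} {Z : Fin n → B} (g : A →+* B)
    (hω : WittVector.map g (omega p t Y) ∈ Ideal.span {omega p s Z}) :
    Untilt p t Y →+* Untilt p s Z :=
  Ideal.quotientMap _ (WittVector.map g) (by
    rw [Ideal.span_singleton_le_iff_mem, Ideal.mem_comap]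
    exact hω)

lemma untiltLift_sharp {A B : Type*} [CommRing A] [CommRing B] {t : Fin d → WittVector p A}
    {Y : Fin d → A} {s : Fin n → WittVector p B} {Z : Fin n → B} (g : A →+* B)
    (hω : WittVector.map g (omega p t Y) ∈ Ideal.span {omega p s Z}) (a : A) :
    untiltLift g hω (sharp p t Y a) = sharp p s Z (g a) := by
  change Ideal.Quotient.mk _ (WittVector.map g _) = _
  rw [WittVector.map_teichmuller]
  rfl

lemma map_omega_single {A B : Type*} [CommRing A] [CommRing B] [CharP A p] [PerfectRing A p]
    [CharP B p] [PerfectRing B p] (g : A →+* B) (Y : Fin d → A)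
    (i : Fin d) :
    WittVector.map g (omega p (Pi.single i 1) Y) = omega p (Pi.single i 1) (g ∘ Y) := by
  rw [omega_single, omega_single, map_sub, map_natCast, WittVector.map_teichmuller]
  rfl

variable {B : Type w} [CommRing B] [CharP B p] [PerfectRing B p] {Z : Fin n → B}

set_option maxHeartbeats 1000000 in
theorem GoodBase.exists_almost_colon (h : GoodBase Z) {s : Fin n → WittVector p B} {V : Type w}
    [CommRing V] (Ψ : V →+* Untilt p s Z) {x : Fin d → V} {A : Type w} [CommRing A] [CharP A p]
    [PerfectRing A p] {Y : Fin d → A} (hY : GoodBase Y) (q : V →+* WittVector p A) (g : A →+* B)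
    (hqx : ∀ i, q (x i) = WittVector.teichmuller p (Y i))
    (hqΨ : ∀ v, Ideal.Quotient.mk (Ideal.span {omega p s Z}) (WittVector.map g (q v)) = Ψ v)
    {i₀ : Fin d} (hgZ : gen (g ∘ Y) ≤ gen Z)
    (hω : Ideal.span {WittVector.map g (omega p (Pi.single i₀ 1) Y)} = Ideal.span {omega p s Z})
    {b : Fin d → B}
    (hb : ∀ i, ∃ G : Polynomial V, G.Monic ∧ G.natDegree ≠ 0 ∧ G.eval₂ Ψ (sharp p s Z (b i)) = 0)
    (j : Fin d) (hrel : sharp p s Z (b j) * Ψ (x j) =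
      ∑ i ∈ Finset.univ.filter (· < j), sharp p s Z (b i) * Ψ (x i)) :
    ∃ c : V, (∃ M, c ∉ Ideal.span {(p : V) - x i₀} ⊔ gen x ^ M) ∧
      ∃ (B' : Type w) (_ : CommRing B') (_ : CharP B' p) (_ : PerfectRing B' p) (ι : B →+* B'),
        GoodBase (ι ∘ Z) ∧ ∀ m, ∃ e, e ^ p ^ m = untiltMap s Z ι (Ψ c) ∧
          ∀ M, e * untiltMap s Z ι (sharp p s Z (b j)) ∈
            gen (untiltMap s Z ι ∘ Ψ ∘ x) ^ M ⊔
              Ideal.span ((untiltMap s Z ι ∘ Ψ ∘ x) '' {i | i < j}) := by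
  choose G hG hG1 hG0 using hb
  obtain ⟨A₁, _, _, _, ι₁, y, hA₁, hy, hlift₁⟩ := exists_root_extension hY (Pi.single i₀ 1)
    (T := ULift.{w} (Fin d)) (fun t => (G t.down).map q) (fun t => (hG t.down).map q)
    (fun t => by
      have : Nontrivial A := CharP.nontrivial_of_char_ne_one (hp.out.ne_one)
      have : Nontrivial (WittVector p A) :=
        (WittVector.constantCoeff (p := p) (R := A)).domain_nontrivial
      rw [(hG t.down).natDegree_map]
      exact hG1 t.down)
  rw [map_omega_single] at hy
  simp only [Polynomial.eval₂_map] at hy hlift₁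
  have hΨeq : (Ideal.Quotient.mk (Ideal.span {omega p s Z})).comp ((WittVector.map g).comp q) = Ψ :=
    RingHom.ext hqΨ
  obtain ⟨g₁, hg₁, hg₁y⟩ := hlift₁ B g (fun t => b t.down) (gen Z) h.complete hgZ fun t => by
    rw [hω, ← Ideal.Quotient.eq_zero_iff_mem, Polynomial.hom_eval₂, hΨeq]
    exact hG0 t.down
  have hω₁ : WittVector.map g₁ (omega p (Pi.single i₀ 1) (ι₁ ∘ Y)) ∈ Ideal.span {omega p s Z} := by
    rw [← hω, map_omega_single, map_omega_single, ← hg₁]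
    exact Ideal.mem_span_singleton_self _
  let Ψ₁ := untiltLift g₁ hω₁
  let q₁ : V →+* Untilt p (Pi.single i₀ 1) (ι₁ ∘ Y) :=
    (Ideal.Quotient.mk _).comp ((WittVector.map ι₁).comp q)
  have hq₁x : ∀ i, q₁ (x i) = sharp p _ _ (ι₁ (Y i)) := fun i => by
    change Ideal.Quotient.mk _ (WittVector.map ι₁ (q (x i))) = _
    rw [hqx, WittVector.map_teichmuller]
    rfl
  have hΨ₁ : ∀ v, Ψ₁ (q₁ v) = Ψ v := fun v => by
    rw [← hqΨ, ← hg₁]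
    rfl
  let ξ := sharp p _ (ι₁ ∘ Y) (y ⟨j⟩) * q₁ (x j) -
    ∑ i ∈ Finset.univ.filter (· < j), sharp p _ (ι₁ ∘ Y) (y ⟨i⟩) * q₁ (x i)
  have hξ : Ψ₁ ξ = 0 := by
    have hi : ∀ i, Ψ₁ (sharp p _ (ι₁ ∘ Y) (y ⟨i⟩) * q₁ (x i)) = sharp p s Z (b i) * Ψ (x i) :=
      fun i => by rw [map_mul, hΨ₁, untiltLift_sharp, hg₁y]
    simp only [ξ, map_sub, map_sum, hi]
    rw [hrel, sub_self]
  obtain ⟨H, hH, hH0⟩ : ∃ H : Polynomial V, H.Monic ∧ H.eval₂ q₁ ξ = 0 := by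
    let _ := q₁.toAlgebra
    have hi : ∀ i, IsIntegral V (sharp p _ (ι₁ ∘ Y) (y ⟨i⟩) * q₁ (x i)) := fun i => by
      refine IsIntegral.mul ⟨G i, hG i, ?_⟩ (isIntegral_algebraMap (R := V) (x := x i))
      have := Ideal.Quotient.eq_zero_iff_mem.2 (hy ⟨i⟩)
      rwa [Polynomial.hom_eval₂] at this
    exact (hi j).sub (IsIntegral.sum _ fun i _ => hi i)
  have hΩ₁ := hA₁.untilt (p := p) (Pi.single i₀ 1)
  let 𝔮 : Ideal V := ⨅ M, Ideal.span {(p : V) - x i₀} ⊔ gen x ^ M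
  have h𝔮 : ∀ v ∈ 𝔮, q₁ v = 0 := fun v hv => hΩ₁.complete.1 _ fun M => by
    have h1 := (Ideal.mem_iInf.1 hv) M
    have h2 := Ideal.mem_map_of_mem q₁ h1
    have h3 : q₁ ((p : V) - x i₀) = 0 := by
      rw [map_sub, map_natCast, hq₁x, sub_eq_zero, ← map_natCast (Ideal.Quotient.mk _)]
      refine Ideal.Quotient.eq.2 ?_
      rw [omega_single]
      exact Ideal.mem_span_singleton_self _
    rw [Ideal.map_sup, Ideal.map_span, Set.image_singleton, h3, Ideal.span_singleton_eq_bot.2 rfl,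
      bot_sup_eq, Ideal.map_pow, map_gen] at h2
    rwa [show q₁ ∘ x = sharp p _ (ι₁ ∘ Y) ∘ (ι₁ ∘ Y) from funext hq₁x] at h2
  have h1𝔮 : (1 : V) ∉ 𝔮 := fun h1 => hΩ₁.ne_top <| by
    rw [Ideal.eq_top_iff_one, ← map_one q₁, h𝔮 1 h1]
    exact Ideal.zero_mem _
  obtain ⟨c, hc, N, t, hNt⟩ := exists_pow_mul_eq_zero q₁ h𝔮 h1𝔮 hH hH0
  refine ⟨c, ?_, ?_⟩
  · by_contra! hcM
    exact hc (Ideal.mem_iInf.2 hcM)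
  obtain ⟨B', _, _, _, ι, η, hB', hη⟩ := exists_sharp_extension h s (T := PUnit) (fun _ => Ψ c)
  refine ⟨B', inferInstance, inferInstance, inferInstance, ι, hB', fun m => ?_⟩
  obtain ⟨w, hw⟩ := Ideal.Quotient.mk_surjective (q₁ c + ξ * t)
  obtain ⟨A₂, _, _, _, ι₂, y₂, hA₂, hy₂, hlift₂⟩ := exists_root_extension hA₁ (Pi.single i₀ 1)
    (T := PUnit) (fun _ => Polynomial.X - Polynomial.C w) (fun _ => Polynomial.monic_X_sub_C _)
    (fun _ => by
      have : Nontrivial A₁ := CharP.nontrivial_of_char_ne_one (hp.out.ne_one)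
      have : Nontrivial (WittVector p A₁) :=
        (WittVector.constantCoeff (p := p) (R := A₁)).domain_nontrivial
      rw [Polynomial.natDegree_X_sub_C]
      exact one_ne_zero)
  simp only [Polynomial.eval₂_sub, Polynomial.eval₂_X, Polynomial.eval₂_C] at hy₂ hlift₂
  have hωι : Ideal.span {WittVector.map (ι.comp g₁) (omega p (Pi.single i₀ 1) (ι₁ ∘ Y))} =
      Ideal.span {omega p (WittVector.map ι ∘ s) (ι ∘ Z)} := by
    have h1 := congrArg (Ideal.map (WittVector.map ι)) hω
    rw [Ideal.map_span, Ideal.map_span, Set.image_singleton, Set.image_singleton,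
      map_omega_single, map_omega_single, map_omega] at h1
    rw [map_omega_single, ← h1, ← hg₁]
    rfl
  have hwc : Ideal.Quotient.mk (Ideal.span {omega p (WittVector.map ι ∘ s) (ι ∘ Z)})
      (WittVector.map (ι.comp g₁) w) = untiltMap s Z ι (Ψ c) := by
    have h1 := congrArg Ψ₁ hw
    rw [map_add, map_mul, hξ, zero_mul, add_zero, hΨ₁] at h1
    rw [← h1]
    rfl
  obtain ⟨g₂, hg₂, hg₂y⟩ := hlift₂ B' (ι.comp g₁) η (gen (ι ∘ Z)) hB'.complete (by
    have h1 := Ideal.map_mono (f := ι) hgZ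
    rw [map_gen, map_gen, ← hg₁] at h1
    exact h1) fun u => by
      rw [hωι]
      refine Ideal.Quotient.eq.1 ?_
      rw [hwc]
      exact hη u
  have hg₂' : ∀ a, g₂ (ι₂ a) = ι (g₁ a) := fun a => congrArg (fun θ => θ a) hg₂
  have hg₁' : ∀ a, g₁ (ι₁ a) = g a := fun a => congrArg (fun θ => θ a) hg₁
  rw [map_omega_single] at hy₂
  have hω₂ : WittVector.map ι₂ (omega p (Pi.single i₀ 1) (ι₁ ∘ Y)) ∈
      Ideal.span {omega p (Pi.single i₀ 1) (ι₂ ∘ ι₁ ∘ Y)} := by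
    rw [map_omega_single]
    exact Ideal.mem_span_singleton_self _
  have hω₃ : WittVector.map g₂ (omega p (Pi.single i₀ 1) (ι₂ ∘ ι₁ ∘ Y)) ∈
      Ideal.span {omega p (WittVector.map ι ∘ s) (ι ∘ Z)} := by
    rw [← hωι, map_omega_single, map_omega_single, ← hg₂]
    exact Ideal.mem_span_singleton_self _
  let θ := untiltLift ι₂ hω₂
  let Ψ₂ := untiltLift g₂ hω₃
  have hred := hA₂.isReduced_untilt (p := p) i₀
  obtain ⟨r, hr⟩ := exists_root p m (y₂ ⟨⟩)
  have hrN : sharp p (Pi.single i₀ 1) (ι₂ ∘ ι₁ ∘ Y) r ^ p ^ m = θ (q₁ c + ξ * t) := by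
    rw [← map_pow, hr, ← hw]
    exact Ideal.Quotient.eq.2 (hy₂ ⟨⟩)
  have hθx : ∀ i, θ (q₁ (x i)) = sharp p (Pi.single i₀ 1) (ι₂ ∘ ι₁ ∘ Y) ((ι₂ ∘ ι₁ ∘ Y) i) :=
    fun i => by
      rw [hq₁x, untiltLift_sharp]
      rfl
  have hr0 : sharp p (Pi.single i₀ 1) (ι₂ ∘ ι₁ ∘ Y) r * θ ξ = 0 :=
    mul_eq_zero_of_pow_mul_eq_zero (k := p ^ m) (N := N) (by
      rw [hrN, ← map_pow, ← map_mul, hNt, map_zero])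
  simp only [ξ, map_sub, map_mul, map_sum, hθx] at hr0
  have hcol := (hA₂.untilt (p := p) (Pi.single i₀ 1)).qr.colon_of_mul_sub_eq_zero j
    (y := fun i => θ (sharp p _ (ι₁ ∘ Y) (y ⟨i⟩))) hr0
  have hΨx : Ψ₂ ∘ sharp p (Pi.single i₀ 1) (ι₂ ∘ ι₁ ∘ Y) ∘ ι₂ ∘ ι₁ ∘ Y =
      untiltMap s Z ι ∘ Ψ ∘ x := funext fun i => by
    simp only [Function.comp_apply, Ψ₂]
    rw [untiltLift_sharp, hg₂', hg₁', ← untiltMap_sharp, ← hqΨ, hqx, WittVector.map_teichmuller]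
    rfl
  refine ⟨sharp p _ _ (g₂ r), ?_, fun M => ?_⟩
  · rw [← map_pow, ← map_pow, hr, hg₂y]
    exact hη _
  · have h1 := Ideal.mem_map_of_mem Ψ₂ (hcol M)
    rw [Ideal.map_sup, Ideal.map_pow, map_gen, hΨx, Ideal.map_span, ← Set.image_comp,
      hΨx, map_mul, untiltLift_sharp, untiltLift_sharp, untiltLift_sharp, hg₂', hg₁y,
    ← untiltMap_sharp] at h1
    exact h1

end

section

open MvPolynomial

universe w

lemma mem_of_forall_mem_sup_pow {S : Type*} [CommRing S] [IsNoetherianRing S] [IsLocalRing S]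
    {I J : Ideal S} (hI : I ≠ ⊤) {a : S} (h : ∀ L, a ∈ J ⊔ I ^ L) : a ∈ J := by
  rw [← Ideal.Quotient.eq_zero_iff_mem, ← Submodule.mem_bot S (M := S ⧸ J),
    ← Ideal.iInf_pow_smul_eq_bot_of_isLocalRing (M := S ⧸ J) I hI, Submodule.mem_iInf]
  intro L
  obtain ⟨b, hb, c, hc, rfl⟩ := Submodule.mem_sup.1 (h L)
  rw [map_add, Ideal.Quotient.eq_zero_iff_mem.2 hb, zero_add]
  have := Submodule.smul_mem_smul hc (Submodule.mem_top (x := (1 : S ⧸ J)))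
  rwa [Algebra.smul_def, mul_one] at this

variable {p : ℕ} [hp : Fact p.Prime] {n d : ℕ}

theorem image_ne_zero {κ V E S : Type*} [Field κ] [CharP κ p] [PerfectRing κ p] [CommRing V]
    [CommRing E] [CommRing S] [Algebra S E] [IsNoetherianRing S] [IsLocalRing S]
    {f : MvPolynomial (Fin (d + 1)) (WittVector p κ) →+* V}
    (hf : AdicDense f (gen (wittVars p κ (d + 1)))) {z : Fin n → S} (hmax : (gen z).IsMaximal)
    (hE : GoodBase (algebraMap S E ∘ z)) (Θ : V →+* E) {y : Fin (d + 1) → S}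
    (hy : ∀ i, Θ (f (X i)) = algebraMap S E (y i)) (hyz : y (Fin.last d) ∈ gen z)
    {i₀ : Fin (d + 1)} (hi₀ : y i₀ = p)
    (hind : ∀ e : Fin (d + 1) → ℕ, (∀ i, 0 < e i) → e (Fin.last d) = 1 → ∀ w,
      y (Fin.last d) ^ w ∉ Ideal.span (Set.range fun i => y i - y (Fin.last d) ^ e i))
    {c : V} {M : ℕ} (hc : c ∉ Ideal.span {(p : V) - f (X i₀)} ⊔ gen (f ∘ X) ^ M) : Θ c ≠ 0 := by
  classical
  intro h0
  let 𝔬 := Ideal.span {(p : V) - f (X i₀)}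
  have hex : ∃ M, c ∉ 𝔬 ⊔ gen (f ∘ X) ^ M := ⟨M, hc⟩
  obtain ⟨L, hL⟩ : ∃ L, Nat.find hex = L + 1 := Nat.exists_eq_succ_of_ne_zero fun h => by
    have := Nat.find_spec hex
    rw [h, pow_zero, Ideal.one_eq_top, sup_top_eq] at this
    exact this trivial
  have hcL : c ∈ 𝔬 ⊔ gen (f ∘ X) ^ L := not_not.1 (Nat.find_min hex (by omega))
  have hcL1 := Nat.find_spec hex
  rw [hL] at hcL1
  obtain ⟨F, hF, hF0, hFc⟩ := exists_form_step hcL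
  obtain ⟨E', hE'⟩ := exists_expansion L F hF hF0 hcL hFc
  have hle : gen (f ∘ wittVars p κ (d + 1)) ≤ 𝔬 ⊔ gen (f ∘ X) := by
    have := gen_comp_wittVars_le (p := p) f (Pi.single i₀ 1)
    simpa [Pi.single_apply] using this
  obtain ⟨e, he, helast, w, hew⟩ := E'.exists_pow_mem ⟨L, fun h => by
    rw [hE'] at h
    rw [h, map_zero, sub_zero] at hFc
    exact hcL1 hFc⟩ fun a => (hf.mem_or_exists_mul_sub_one_mem a).imp (fun h => hle h)
      fun ⟨u, hu⟩ => ⟨u, hle hu⟩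
  let I := Ideal.span (Set.range fun i => y i - y (Fin.last d) ^ e i)
  have h1 := hew ((I.map (algebraMap S E)).comap Θ) ?_ ?_ ?_
  · refine hind e he helast w (mem_of_forall_mem_sup_pow hmax.ne_top fun N => ?_)
    refine mem_of_algebraMap_mem_map hmax hE.qr hE.ne_top (M := N) le_sup_right ?_
    refine Ideal.map_mono le_sup_left ?_
    have h2 := Ideal.mem_map_of_mem Θ h1
    rw [Ideal.map_sup, Ideal.map_span Θ {_}, Set.image_singleton] at h2
    obtain ⟨a, ha, b, hb, hab⟩ := Submodule.mem_sup.1 h2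
    obtain ⟨t, rfl⟩ := Ideal.mem_span_singleton'.1 hb
    have ha' := Ideal.map_comap_le ha
    rw [Function.comp_apply, map_pow, map_pow, hy] at hab
    have hmem : t * algebraMap S E (y (Fin.last d)) ∈ gen (algebraMap S E ∘ z) :=
      Ideal.mul_mem_left _ _ (by
        rw [← map_gen]
        exact Ideal.mem_map_of_mem _ hyz)
    refine (Ideal.mul_unit_mem_iff_mem _ (hE.complete.isUnit_one_sub hmem)).1 ?_
    convert ha' using 1
    rw [map_pow]
    linear_combination -hab
  · rw [Ideal.span_singleton_le_iff_mem, Ideal.mem_comap, map_sub, hy, hi₀, map_natCast,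
      map_natCast, sub_self]
    exact Ideal.zero_mem _
  · rw [Ideal.mem_comap, h0]
    exact Ideal.zero_mem _
  · intro i
    rw [Ideal.mem_comap, map_sub, map_pow, Function.comp_apply, Function.comp_apply, hy, hy,
      ← map_pow, ← map_sub]
    exact Ideal.mem_map_of_mem _ (Ideal.subset_span ⟨i, rfl⟩)

end

section

open MvPolynomial

universe w

variable {p : ℕ} [hp : Fact p.Prime] {n d : ℕ}

lemma mem_of_almost_mem {S E : Type*} [CommRing S] [IsNoetherianRing S] [IsLocalRing S]
    [CommRing E] [Algebra S E] {z : Fin n → S} (hmax : (gen z).IsMaximal)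
    (hE : GoodBase (algebraMap S E ∘ z)) {y : Fin d → S} (hyz : ∀ i, y i ∈ gen z)
    {s : Set (Fin d)} {a : S} {t : E} (ht : t ≠ 0)
    (h : ∀ m, ∃ e, e ^ p ^ m = t ∧ ∀ M, e * algebraMap S E a ∈
      gen (algebraMap S E ∘ y) ^ M ⊔ Ideal.span ((algebraMap S E ∘ y) '' s)) :
    a ∈ Ideal.span (y '' s) := by
  by_contra ha
  obtain ⟨L, hL⟩ : ∃ L, a ∉ Ideal.span (y '' s) ⊔ gen z ^ L := by
    by_contra! hc
    exact ha (mem_of_forall_mem_sup_pow hmax.ne_top hc)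
  have hyz' : gen y ≤ gen z := Ideal.span_le.2 (Set.range_subset_iff.2 hyz)
  refine ht (hE.complete.1 t fun M => ?_)
  obtain ⟨e, he, hea⟩ := h M
  have hmem : e ∈ gen (algebraMap S E ∘ z) := by
    refine mem_gen_of_mul_mem_map hmax hE.qr (J := Ideal.span (y '' s) ⊔ gen z ^ L) (M := L)
      le_sup_right hL ?_
    rw [mul_comm]
    obtain ⟨b, hb, c, hc, hbc⟩ := Submodule.mem_sup.1 (hea L)
    rw [← hbc, Ideal.map_sup]
    refine Ideal.add_mem _ (Submodule.mem_sup_right ?_) (Submodule.mem_sup_left ?_)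
    · rw [← map_gen_pow] at hb
      exact Ideal.map_mono (Ideal.pow_right_mono hyz' L) hb
    · rwa [Ideal.map_span, ← Set.image_comp]
  rw [← he]
  exact Ideal.pow_le_pow_right (Nat.lt_pow_self hp.out.one_lt).le (Ideal.pow_mem_pow hmem _)

theorem colon_of_pure {R : Type u} {S : Type w} [CommRing R] [CommRing S] [Algebra R S]
    [IsNoetherianRing S] [IsLocalRing S] {z : Fin n → S} (hqr : QuasiRegular z ⊥)
    (hmax : (gen z).IsMaximal) (hpz : (p : S) ∈ gen z) {m : Ideal R} (hm : m.IsMaximal)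
    (hmfg : m.FG) (hmz : m.map (algebraMap R S) ≤ gen z) {x : Fin (d + 1) → R}
    (hx : ∀ i, x i ∈ m) {k : ℕ} (hk : m ^ k ≤ gen x) {i₀ : Fin (d + 1)} (hi₀ : x i₀ = p)
    (hdesc : ∀ (I : Ideal R) (a : R), algebraMap R S a ∈ I.map (algebraMap R S) → a ∈ I)
    (hind : ∀ e : Fin (d + 1) → ℕ, (∀ i, 0 < e i) → e (Fin.last d) = 1 → ∀ w,
      x (Fin.last d) ^ w ∉ Ideal.span (Set.range fun i => x i - x (Fin.last d) ^ e i))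
    (j : Fin (d + 1)) (r : Fin (d + 1) → R)
    (hrel : r j * x j = ∑ i ∈ Finset.univ.filter (· < j), r i * x i) :
    r j ∈ Ideal.span (x '' {i | i < j}) := by
  obtain ⟨B, _, _, _, Z, s, hZ, ψ, hψz, hψ⟩ := exists_perfectoid hqr hmax hpz
  let φ : R →+* Untilt p s Z := ψ.comp (algebraMap R S)
  let _ : Algebra R (Untilt p s Z) := φ.toAlgebra
  have hφ : ∀ a, algebraMap R (Untilt p s Z) a = ψ (algebraMap R S a) := fun a => rfl
  have hψgen : (gen z).map ψ = gen (sharp p s Z ∘ Z) := by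
    rw [map_gen]
    exact congrArg gen (funext hψz)
  have hmK : m.map (algebraMap R (Untilt p s Z)) ≤ gen (sharp p s Z ∘ Z) := by
    rw [← hψgen]
    exact (Ideal.map_map (algebraMap R S) ψ).ge.trans (Ideal.map_mono hmz)
  have hpx : (p : R) ∈ gen x := hi₀ ▸ mem_gen x i₀
  obtain ⟨κ, _, _, _, V, _, f, Ψ, ρ, hf, hΨX, hΨC, hint_mem⟩ := exists_witt_cover (p := p) hm hmfg hx hk
    hpx (hZ.untilt (p := p) s).complete (hZ.untilt (p := p) s).ne_top hmK
    (Set.range (sharp p s Z)) (fun a => hψ _) (by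
      rintro _ ⟨b, rfl⟩
      obtain ⟨t, ht⟩ := exists_root (p := p) 1 b
      exact ⟨_, ⟨t, rfl⟩, by rw [← map_pow, ← ht, pow_one]⟩)
  choose b hb using fun i => hψ (algebraMap R S (r i))
  choose y hy using fun i => hψ (algebraMap R S (x i))
  have hxK : ∀ i, Ψ (f (X i)) ∈ gen (sharp p s Z ∘ Z) := fun i => by
    rw [hΨX]
    exact hmK (Ideal.mem_map_of_mem _ (hx i))
  obtain ⟨A, _, _, _, Y, q, g, hY, hqX, hgY, hqΨ, hω⟩ := hZ.exists_coordinate_base hf Ψ ρ hΨC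
    (y := y) (fun i => by rw [hΨX, hφ, hy]) hxK (i₀ := i₀) (by
      rw [hΨX, hφ, hi₀, map_natCast, map_natCast])
  obtain ⟨c, ⟨M, hc⟩, B', _, _, _, ι, hB', hroots⟩ := hZ.exists_almost_colon Ψ (x := f ∘ X) hY q g
    hqX hqΨ (i₀ := i₀) (Ideal.span_le.2 (Set.range_subset_iff.2 fun i => by
      rw [SetLike.mem_coe, Function.comp_apply, hgY, ← sharp_mem_gen (s := s), hy, ← hφ, ← hΨX]
      exact hxK i)) hω (b := b) (fun i => by
      rw [hb]
      exact hint_mem (r i)) j (by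
      simp only [Function.comp_apply, hb, hΨX, hφ, ← map_mul, ← map_sum, hrel])
  let θ := untiltMap s Z ι
  let _ : Algebra S (Untilt p (WittVector.map ι ∘ s) (ι ∘ Z)) := (θ.comp ψ).toAlgebra
  have hθ : ∀ a, algebraMap S (Untilt p (WittVector.map ι ∘ s) (ι ∘ Z)) a = θ (ψ a) :=
    fun a => rfl
  have hE : GoodBase (algebraMap S (Untilt p (WittVector.map ι ∘ s) (ι ∘ Z)) ∘ z) := by
    have : algebraMap S (Untilt p (WittVector.map ι ∘ s) (ι ∘ Z)) ∘ z =
        sharp p (WittVector.map ι ∘ s) (ι ∘ Z) ∘ (ι ∘ Z) := funext fun i => by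
      rw [Function.comp_apply, hθ, hψz]
      exact untiltMap_sharp s Z ι (Z i)
    rw [this]
    exact hB'.untilt _
  have hxz : ∀ i, algebraMap R S (x i) ∈ gen z := fun i => hmz (Ideal.mem_map_of_mem _ (hx i))
  have hΘ : ∀ i, θ (Ψ (f (X i))) =
      algebraMap S (Untilt p (WittVector.map ι ∘ s) (ι ∘ Z)) (algebraMap R S (x i)) := fun i => by
    rw [hΨX, hφ, hθ]
  have hne : θ (Ψ c) ≠ 0 := by
    refine image_ne_zero hf hmax hE (θ.comp Ψ) (y := fun i => algebraMap R S (x i)) hΘ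
      (hxz _) (i₀ := i₀) (by rw [hi₀, map_natCast]) (fun e he hl w hmem => ?_) hc
    refine hind e he hl w (hdesc _ _ ?_)
    rw [Ideal.map_span, ← Set.range_comp]
    rw [map_pow]
    convert hmem using 4
    simp
  have hcomp : θ ∘ Ψ ∘ f ∘ X = algebraMap S (Untilt p (WittVector.map ι ∘ s) (ι ∘ Z)) ∘
      fun i => algebraMap R S (x i) := funext hΘ
  have hmem : algebraMap R S (r j) ∈
      Ideal.span ((fun i => algebraMap R S (x i)) '' {i | i < j}) := by
    refine mem_of_almost_mem (p := p) hmax hE hxz hne fun m => ?_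
    obtain ⟨e, he, hea⟩ := hroots m
    refine ⟨e, he, fun M => ?_⟩
    rw [hθ, ← hb, ← hcomp]
    exact hea M
  refine hdesc _ _ ?_
  rw [Ideal.map_span, ← Set.image_comp]
  exact hmem

end

section

open MvPolynomial

variable {R : Type*} [CommRing R] [IsNoetherianRing R] [IsLocalRing R]

lemma not_maximalIdeal_le_radical_of_last_eq_zero {d : ℕ}
    (hd : ((d + 1 : ℕ) : WithBot ℕ∞) ≤ ringKrullDim R)
    {y : Fin (d + 1) → R} (hy : ∀ i, y i ∈ IsLocalRing.maximalIdeal R) (hy0 : y (Fin.last d) = 0) :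
    ¬ IsLocalRing.maximalIdeal R ≤ (gen y).radical := by
  classical
  intro h
  let s : Finset R := Finset.univ.image fun i : Fin d => y i.castSucc
  have hs : gen y ≤ Ideal.span s := Ideal.span_le.2 (Set.range_subset_iff.2 fun i => by
    induction i using Fin.lastCases with
    | last => simp [hy0]
    | cast i => exact Ideal.subset_span (by simp [s]))
  have hmin : IsLocalRing.maximalIdeal R ∈ (Ideal.span (s : Set R)).minimalPrimes := by
    refine ⟨⟨inferInstance, Ideal.span_le.2 fun a ha => ?_⟩, fun q hq _ => ?_⟩
    · obtain ⟨i, -, rfl⟩ := Finset.mem_image.1 ha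
      exact hy _
    · exact h.trans ((Ideal.radical_mono (hs.trans hq.2)).trans hq.1.isRadical)
  have h1 := Ideal.height_le_card_of_mem_minimalPrimes_span_finset hmin
  have h2 : s.card ≤ d := Finset.card_image_le.trans (by simp)
  rw [← IsLocalRing.maximalIdeal_height_eq_ringKrullDim] at hd
  have h3 : ((d + 1 : ℕ) : ℕ∞) ≤ (IsLocalRing.maximalIdeal R).height := by exact_mod_cast hd
  have h4 : ((d + 1 : ℕ) : ℕ∞) ≤ d := h3.trans (h1.trans (by exact_mod_cast h2))
  have h5 : d + 1 ≤ d := by exact_mod_cast h4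
  omega

lemma pow_notMem_span_sub_pow {d : ℕ} (hd : ((d + 1 : ℕ) : WithBot ℕ∞) ≤ ringKrullDim R)
    {x : Fin (d + 1) → R} (hx : ∀ i, x i ∈ IsLocalRing.maximalIdeal R)
    (hrad : IsLocalRing.maximalIdeal R ≤ (gen x).radical) {e : Fin (d + 1) → ℕ}
    (he : ∀ i, 0 < e i) (hl : e (Fin.last d) = 1) (w : ℕ) :
    x (Fin.last d) ^ w ∉ Ideal.span (Set.range fun i => x i - x (Fin.last d) ^ e i) := by
  intro h
  have hlast : x (Fin.last d) ∈ (gen fun i => x i - x (Fin.last d) ^ e i).radical := ⟨w, h⟩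
  refine not_maximalIdeal_le_radical_of_last_eq_zero hd
    (y := fun i => x i - x (Fin.last d) ^ e i)
    (fun i => Ideal.sub_mem _ (hx i) (Ideal.pow_mem_of_mem _ (hx _) _ (he i)))
    (by simp [hl]) (hrad.trans (Ideal.radical_le_radical_iff.2
      (Ideal.span_le.2 (Set.range_subset_iff.2 fun i => ?_))))
  have := Ideal.add_mem _ (Ideal.le_radical (mem_gen (fun i => x i - x (Fin.last d) ^ e i) i))
    (Ideal.pow_mem_of_mem _ hlast _ (he i))
  rwa [sub_add_cancel] at this

end

section

open MvPolynomial

variable {S : Type*} [CommRing S] [IsNoetherianRing S] [IsLocalRing S]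

theorem quasiRegular_of_gen_eq_maximalIdeal {d : ℕ}
    (hd : ((d + 1 : ℕ) : WithBot ℕ∞) ≤ ringKrullDim S) {z : Fin (d + 1) → S}
    (hz : gen z = IsLocalRing.maximalIdeal S) : QuasiRegular z ⊥ := by
  have hzm : ∀ i, z i ∈ IsLocalRing.maximalIdeal S := fun i => hz ▸ mem_gen z i
  intro ν F hF hFe
  by_contra! hα
  obtain ⟨α, hα⟩ := hα
  obtain ⟨G, hG, hG0, hGF, hFG⟩ := exists_filtered_form (x := z) (𝔬 := ⊥) hF
  have hGα : G.coeff α ≠ 0 := by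
    rw [sup_comm] at hα
    rw [hGF α hα]
    intro h
    exact hα (h ▸ Ideal.zero_mem _)
  obtain ⟨E, hE⟩ := exists_expansion (c := 0) ν G hG hG0 (Ideal.zero_mem _) (by
    rw [sup_comm] at hFe
    have := Ideal.sub_mem _ hFG hFe
    rwa [sub_sub_cancel_left, ← zero_sub] at this)
  obtain ⟨e, he, hl, w, hw⟩ := E.exists_pow_mem ⟨ν, fun h => hGα (by rw [← hE, h, coeff_zero])⟩
    fun a => by
      rw [bot_sup_eq, hz]
      by_cases ha : IsUnit a
      · obtain ⟨u, hu⟩ := ha.exists_right_inv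
        exact Or.inr ⟨u, by simp [hu]⟩
      · exact Or.inl ha
  refine pow_notMem_span_sub_pow hd hzm (hz ▸ Ideal.le_radical) he hl w ?_
  have h1 := hw (Ideal.span (Set.range fun i => z i - z (Fin.last d) ^ e i)) bot_le
    (Ideal.zero_mem _) fun i => Ideal.subset_span ⟨i, rfl⟩
  obtain ⟨a, ha, b, hb, hab⟩ := Submodule.mem_sup.1 h1
  obtain ⟨t, rfl⟩ := Ideal.mem_span_singleton'.1 hb
  have hunit : IsUnit (1 - t * z (Fin.last d)) :=
    IsLocalRing.isUnit_one_sub_self_of_mem_nonunits _ (Ideal.mul_mem_left _ t (hzm _))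
  refine (Ideal.mul_unit_mem_iff_mem _ hunit).1 ?_
  convert ha using 1
  linear_combination -hab

end

section

open MvPolynomial

variable {A : Type*} [CommRing A] {n : ℕ}

lemma exists_form_map_ne_zero {z : Fin n → A} (hsep : ∀ a, (∀ M, a ∈ gen z ^ M) → a = 0) {a : A}
    (ha : a ≠ 0) : ∃ k, ∃ F : MvPolynomial (Fin n) A, F.IsHomogeneous k ∧ eval z F = a ∧
      F.map (Ideal.Quotient.mk (gen z)) ≠ 0 := by
  classical
  have hex : ∃ M, a ∉ gen z ^ M := by
    by_contra! h
    exact ha (hsep a h)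
  obtain ⟨k, hk⟩ : ∃ k, Nat.find hex = k + 1 := Nat.exists_eq_succ_of_ne_zero fun h => by
    have := Nat.find_spec hex
    rw [h, pow_zero, Ideal.one_eq_top] at this
    exact this trivial
  have hak : a ∈ gen z ^ k := not_not.1 (Nat.find_min hex (by omega))
  obtain ⟨F, hF, hFa⟩ := exists_homogeneous_of_mem_pow k hak
  refine ⟨k, F, hF, hFa, fun h => ?_⟩
  have h1 := Nat.find_spec hex
  rw [hk] at h1
  refine h1 ?_
  rw [← hFa, pow_succ']
  refine eval_mem_mul hF fun α => ?_
  rw [← Ideal.Quotient.eq_zero_iff_mem, ← coeff_map, h, coeff_zero]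

lemma QuasiRegular.isDomain {z : Fin n → A} (h : QuasiRegular z ⊥) (hz : (gen z).IsPrime)
    (hsep : ∀ a, (∀ M, a ∈ gen z ^ M) → a = 0) : IsDomain A := by
  have : Nontrivial A := ⟨0, 1, fun h01 => hz.ne_top ((Ideal.eq_top_iff_one _).2 (by
    rw [← h01]
    exact Ideal.zero_mem _))⟩
  have : NoZeroDivisors A := ⟨fun {a b} hab => by
    by_contra! hne
    obtain ⟨k, F, hF, hFa, hF0⟩ := exists_form_map_ne_zero hsep hne.1
    obtain ⟨l, G, hG, hGb, hG0⟩ := exists_form_map_ne_zero hsep hne.2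
    refine mul_ne_zero hF0 hG0 ?_
    rw [← map_mul]
    ext α
    rw [coeff_map, coeff_zero, Ideal.Quotient.eq_zero_iff_mem, ← sup_bot_eq (gen z)]
    refine h _ (F * G) (hF.mul hG) ?_ α
    rw [map_mul, hFa, hGb, hab]
    exact Ideal.zero_mem _⟩
  exact NoZeroDivisors.to_isDomain A

end

section

open TensorProduct

lemma mem_of_algebraMap_mem_map_of_pure {R : Type u} {S : Type v} [CommRing R] [CommRing S]
    [Algebra R S]
    (h : ∀ (M : Type u) [AddCommGroup M] [Module R M],
      Function.Injective fun m : M => m ⊗ₜ[R] (1 : S)) (I : Ideal R) (a : R)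
    (ha : algebraMap R S a ∈ I.map (algebraMap R S)) : a ∈ I := by
  rw [← Ideal.Quotient.eq_zero_iff_mem]
  apply h (R ⧸ I)
  change Ideal.Quotient.mk I a ⊗ₜ[R] (1 : S) = (0 : R ⧸ I) ⊗ₜ[R] (1 : S)
  have key : ∀ s ∈ I.map (algebraMap R S), (1 : R ⧸ I) ⊗ₜ[R] s = 0 := by
    intro s hs
    refine Submodule.span_induction ?_ ?_ ?_ ?_ hs
    · rintro _ ⟨b, hb, rfl⟩
      rw [Algebra.algebraMap_eq_smul_one, TensorProduct.tmul_smul, TensorProduct.smul_tmul',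
        Algebra.smul_def, mul_one]
      change Ideal.Quotient.mk I b ⊗ₜ[R] (1 : S) = 0
      rw [Ideal.Quotient.eq_zero_iff_mem.2 hb, TensorProduct.zero_tmul]
    · exact TensorProduct.tmul_zero _ _
    · intro x y _ _ hx hy
      rw [TensorProduct.tmul_add, hx, hy, add_zero]
    · intro t x _ hx
      have := congrArg (LinearMap.lTensor (R ⧸ I) (LinearMap.mulLeft R t)) hx
      simpa using this
  rw [TensorProduct.zero_tmul, ← key _ ha, Algebra.algebraMap_eq_smul_one, TensorProduct.tmul_smul,
    TensorProduct.smul_tmul', Algebra.smul_def, mul_one]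
  rfl

end

section

open IsLocalRing RingTheory.Sequence

variable {R : Type*} [CommRing R]

lemma not_lt_lt_of_mem_minimalPrimes [IsNoetherianRing R] {P Q m : Ideal R} [P.IsPrime] [Q.IsPrime]
    {a : R} (hm : m ∈ (P ⊔ Ideal.span {a}).minimalPrimes) (hPQ : P < Q) : ¬ Q < m := by
  intro hQm
  have : m.IsPrime := hm.isPrime
  have hsurj : Function.Surjective (Ideal.Quotient.mk P) := Ideal.Quotient.mk_surjective
  have hprime : ∀ {J : Ideal R} [J.IsPrime], P ≤ J → (J.map (Ideal.Quotient.mk P)).IsPrime :=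
    fun h => Ideal.map_isPrime_of_surjective hsurj (Ideal.mk_ker.trans_le h)
  have hlt : ∀ {J K : Ideal R}, P ≤ J → J < K →
      J.map (Ideal.Quotient.mk P) < K.map (Ideal.Quotient.mk P) := fun {J K} hJ h => by
    refine lt_of_le_not_ge (Ideal.map_mono h.le) fun hK => h.not_ge ?_
    have := Ideal.map_le_iff_le_comap.1 hK
    rwa [Ideal.comap_map_of_surjective _ hsurj, ← RingHom.ker_eq_comap_bot, Ideal.mk_ker,
      sup_eq_left.2 hJ] at this
  have i1 := hprime (J := P) le_rfl
  have i2 := hprime (J := Q) hPQ.le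
  have i3 := hprime (J := m) (hPQ.le.trans hQm.le)
  have h1 := Ideal.height_add_one_le_of_lt_of_isPrime (hlt le_rfl hPQ)
  have h2 := Ideal.height_add_one_le_of_lt_of_isPrime (hlt hPQ.le hQm)
  have h3 := Ideal.map_height_le_one_of_mem_minimalPrimes hm
  have h4 : (1 : ℕ∞) + 1 ≤ 1 :=
    (add_le_add_left (le_add_self.trans h1) 1).trans (h2.trans h3)
  exact absurd h4 (by decide)

/-- If `a` is regular modulo `I` and lies in the radical of `I + (y)`, then `y` is regular
modulo `I`. -/
lemma isSMulRegular_of_mem_radical {I : Ideal R} {a y : R} (hay : a ∈ (I ⊔ Ideal.span {y}).radical)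
    (ha : ∀ t, a * t ∈ I → t ∈ I) (t : R) (ht : y * t ∈ I) : t ∈ I := by
  obtain ⟨k, hk⟩ := hay
  have hkt : a ^ k * t ∈ I := by
    obtain ⟨b, hb, c, hc, hbc⟩ := Submodule.mem_sup.1 hk
    obtain ⟨r, rfl⟩ := Ideal.mem_span_singleton'.1 hc
    rw [← hbc, add_mul, mul_assoc]
    exact Ideal.add_mem _ (Ideal.mul_mem_right _ _ hb) (Ideal.mul_mem_left _ _ ht)
  clear hk
  induction k with
  | zero => simpa using hkt
  | succ k ih =>
    rw [pow_succ', mul_assoc] at hkt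
    exact ih (ha _ hkt)

lemma isWeaklyRegular_concat_iff {l : List R} {a : R} :
    IsWeaklyRegular R (l ++ [a]) ↔ IsWeaklyRegular R l ∧
      ∀ t, a * t ∈ Ideal.ofList l → t ∈ Ideal.ofList l := by
  rw [isWeaklyRegular_append_iff, isWeaklyRegular_singleton_iff,
    isSMulRegular_quotient_iff_mem_of_smul_mem]
  simp only [smul_eq_mul, Ideal.mul_top]

lemma ofList_eq_of_perm {l l' : List R} (h : l.Perm l') : Ideal.ofList l = Ideal.ofList l' :=
  congrArg Ideal.span (Set.ext fun _ => h.mem_iff)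

variable [IsNoetherianRing R] [IsLocalRing R]

lemma le_radical_sup_span_singleton {I : Ideal R} {a y : R}
    (ham : a ∈ maximalIdeal R)
    (ha : maximalIdeal R ≤ (I ⊔ Ideal.span {a}).radical)
    (hI : ∀ P ∈ I.minimalPrimes, P ≠ maximalIdeal R → y ∉ P) :
    maximalIdeal R ≤ (I ⊔ Ideal.span {y}).radical := by
  rw [Ideal.radical_eq_sInf]
  refine le_sInf fun Q hQ => ?_
  have hQp := hQ.2
  obtain ⟨P, hP, hPQ⟩ := Ideal.exists_minimalPrimes_le (le_sup_left.trans hQ.1)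
  have hPp : P.IsPrime := hP.isPrime
  by_cases hPm : P = maximalIdeal R
  · exact hPm ▸ hPQ
  have hyQ : y ∈ Q := hQ.1 (Ideal.mem_sup_right (Ideal.mem_span_singleton_self y))
  have hlt : P < Q := lt_of_le_of_ne hPQ fun h => hI P hP hPm (h ▸ hyQ)
  have hQm : Q ≤ maximalIdeal R := le_maximalIdeal hQp.ne_top
  by_contra hmQ
  refine not_lt_lt_of_mem_minimalPrimes (P := P) (Q := Q) (m := maximalIdeal R) (a := a)
    ⟨⟨inferInstance, sup_le (hlt.le.trans hQm) ((Ideal.span_singleton_le_iff_mem _).2 ham)⟩,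
      fun q hq _ => ?_⟩ hlt (lt_of_le_of_ne hQm fun h => hmQ h.ge)
  refine (ha.trans (Ideal.radical_mono ?_)).trans hq.1.isRadical
  exact (sup_le (hP.le.trans le_sup_left) le_sup_right).trans hq.2

lemma exists_common_parameter {I J : Ideal R} {a b : R} (ham : a ∈ maximalIdeal R)
    (ha : maximalIdeal R ≤ (I ⊔ Ideal.span {a}).radical) (hbm : b ∈ maximalIdeal R)
    (hb : maximalIdeal R ≤ (J ⊔ Ideal.span {b}).radical) :
    ∃ y ∈ maximalIdeal R, maximalIdeal R ≤ (I ⊔ Ideal.span {y}).radical ∧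
      maximalIdeal R ≤ (J ⊔ Ideal.span {y}).radical := by
  classical
  let s : Finset (Ideal R) := ((I.finite_minimalPrimes_of_isNoetherianRing R).toFinset ∪
    (J.finite_minimalPrimes_of_isNoetherianRing R).toFinset).filter (· ≠ maximalIdeal R)
  have hs : ∀ P ∈ s, P.IsPrime ∧ P ≠ maximalIdeal R := fun P hP => by
    simp only [s, Finset.mem_filter, Finset.mem_union, Set.Finite.mem_toFinset] at hP
    exact ⟨hP.1.elim (fun h => h.isPrime) (fun h => h.isPrime), hP.2⟩
  have hnot : ¬ (maximalIdeal R : Set R) ⊆ ⋃ P ∈ (s : Set (Ideal R)), (P : Set R) := by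
    intro hsub
    obtain ⟨P, hP, h⟩ := (Ideal.subset_union_prime (f := fun P : Ideal R => P) ⊥ ⊥
      fun P hP _ _ => (hs P hP).1).1 hsub
    exact (hs P hP).2 ((le_maximalIdeal (hs P hP).1.ne_top).antisymm h)
  obtain ⟨y, hy, hys⟩ := Set.not_subset.1 hnot
  simp only [Set.mem_iUnion, not_exists] at hys
  refine ⟨y, hy, le_radical_sup_span_singleton ham ha fun P hP hPm => hys P ?_,
    le_radical_sup_span_singleton hbm hb fun P hP hPm => hys P ?_⟩
  · simpa [s, hPm] using Or.inl hP
  · simpa [s, hPm] using Or.inr hP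

lemma isWeaklyRegular_of_radical (js as xs : List R) (hlen : as.length = xs.length)
    (hjs : ∀ r ∈ js, r ∈ maximalIdeal R) (has : ∀ r ∈ as, r ∈ maximalIdeal R)
    (hxs : ∀ r ∈ xs, r ∈ maximalIdeal R)
    (ha : maximalIdeal R ≤ (Ideal.ofList (js ++ as)).radical)
    (hx : maximalIdeal R ≤ (Ideal.ofList (js ++ xs)).radical)
    (h : IsWeaklyRegular R (js ++ as)) : IsWeaklyRegular R (js ++ xs) := by
  induction as using List.reverseRecOn generalizing js xs with
  | nil =>
    rwa [List.eq_nil_of_length_eq_zero hlen.symm]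
  | append_singleton as a ih =>
    induction xs using List.reverseRecOn with
    | nil => simp at hlen
    | append_singleton xs x _ =>
      have ham : a ∈ maximalIdeal R := has a (by simp)
      have hxm : x ∈ maximalIdeal R := hxs x (by simp)
      rw [← List.append_assoc, isWeaklyRegular_concat_iff] at h
      rw [← List.append_assoc, Ideal.ofList_append, Ideal.ofList_singleton] at ha hx
      obtain ⟨y, hy, hya, hyx⟩ := exists_common_parameter ham ha hxm hx
      have hperm : ∀ l : List R, (js ++ l ++ [y]).Perm ((y :: js) ++ l) := fun l =>
        List.perm_append_singleton y (js ++ l)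
      have hrad : ∀ l : List R,
          Ideal.ofList (js ++ l) ⊔ Ideal.span {y} = Ideal.ofList ((y :: js) ++ l) := fun l => by
        rw [← ofList_eq_of_perm (hperm l), Ideal.ofList_append (js ++ l), Ideal.ofList_singleton]
      have hmem : ∀ {l : List R}, (∀ r ∈ l, r ∈ maximalIdeal R) →
          ∀ r ∈ js ++ l ++ [y], r ∈ maximalIdeal R := fun hl r hr => by
        simp only [List.mem_append, List.mem_singleton] at hr
        obtain (hr | hr) | rfl := hr
        exacts [hjs r hr, hl r hr, hy]
      have has' : ∀ r ∈ as, r ∈ maximalIdeal R := fun r hr => has r (by simp [hr])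
      have hxs' : ∀ r ∈ xs, r ∈ maximalIdeal R := fun r hr => hxs r (by simp [hr])
      have h1 : IsWeaklyRegular R (js ++ as ++ [y]) := isWeaklyRegular_concat_iff.2
        ⟨h.1, isSMulRegular_of_mem_radical (hya ham) h.2⟩
      have h2 := ih (y :: js) xs (by simpa using hlen)
        (fun r hr => (List.mem_cons.1 hr).elim (fun h => h ▸ hy) (hjs r)) has' hxs'
        (hrad as ▸ hya) (hrad xs ▸ hyx)
        (IsLocalRing.isWeaklyRegular_of_perm_of_subset_maximalIdeal h1 (hperm as) (hmem has'))
      have h3 := IsLocalRing.isWeaklyRegular_of_perm_of_subset_maximalIdeal h2 (hperm xs).symm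
        (fun r hr => hmem hxs' r ((hperm xs).mem_iff.2 hr))
      rw [isWeaklyRegular_concat_iff] at h3
      rw [← List.append_assoc, isWeaklyRegular_concat_iff]
      exact ⟨h3.1, isSMulRegular_of_mem_radical (hx hy) h3.2⟩

end

section

open IsLocalRing RingTheory.Sequence

variable {R : Type*} [CommRing R]

lemma isWeaklyRegular_ofFn {n : ℕ} {x : Fin n → R}
    (h : ∀ j t, t * x j ∈ Ideal.span (x '' {i | i < j}) → t ∈ Ideal.span (x '' {i | i < j})) :
    IsWeaklyRegular R (List.ofFn x) := by
  rw [isWeaklyRegular_iff_Fin]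
  intro i
  have hi : (i : ℕ) < n := by simpa using i.2
  have key : Ideal.ofList ((List.ofFn x).take i) = Ideal.span (x '' {j | j < ⟨i, hi⟩}) := by
    refine congrArg Ideal.span (Set.ext fun a => ?_)
    simp only [Set.mem_ofPred_eq, List.mem_take_iff_getElem, Set.mem_image, List.getElem_ofFn,
      List.length_ofFn, Fin.lt_def]
    constructor
    · rintro ⟨j, hj, rfl⟩
      exact ⟨⟨j, (lt_min_iff.1 hj).2⟩, (lt_min_iff.1 hj).1, rfl⟩
    · rintro ⟨j, hj, rfl⟩
      exact ⟨j, lt_min hj j.2, rfl⟩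
  rw [isSMulRegular_quotient_iff_mem_of_smul_mem, key]
  intro t ht
  rw [smul_eq_mul, Ideal.mul_top] at ht ⊢
  refine h ⟨i, hi⟩ t ?_
  rw [mul_comm]
  simpa using ht

lemma exists_eq_sum_of_mem_span_image {n : ℕ} {x : Fin n → R} {s : Finset (Fin n)} {a : R}
    (ha : a ∈ Ideal.span (x '' s)) : ∃ r : Fin n → R, a = ∑ i ∈ s, r i * x i := by
  obtain ⟨r, hr⟩ := (Submodule.mem_span_image_finset_iff_exists_fun R).1 ha
  classical
  refine ⟨fun i => if h : i ∈ s then r ⟨i, h⟩ else 0, ?_⟩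
  rw [← hr, ← Finset.sum_coe_sort s]
  exact Finset.sum_congr rfl fun i _ => by simp

variable [IsNoetherianRing R] [IsLocalRing R]

lemma exists_gen_radical_eq_maximalIdeal : ∃ (d : ℕ) (y : Fin d → R),
    ringKrullDim R = d ∧ (∀ i, y i ∈ maximalIdeal R) ∧ maximalIdeal R ≤ (gen y).radical := by
  obtain ⟨s, hs, hc⟩ := Ideal.exists_finset_card_eq_height_of_isNoetherianRing (maximalIdeal R)
  have hgen : gen (fun i => (s.equivFin.symm i : R)) = Ideal.span (s : Set R) := by
    refine congrArg Ideal.span (Set.ext fun a => ⟨?_, fun ha => ?_⟩)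
    · rintro ⟨i, rfl⟩
      exact (s.equivFin.symm i).2
    · exact ⟨s.equivFin ⟨a, ha⟩, by simp⟩
  refine ⟨s.card, fun i => s.equivFin.symm i, ?_, fun i => ?_, ?_⟩
  · rw [← maximalIdeal_height_eq_ringKrullDim, ← hc]
    rfl
  · exact hs.1.2 (Ideal.subset_span (s.equivFin.symm i).2)
  · rw [hgen, Ideal.radical_eq_sInf]
    exact le_sInf fun q hq => hs.2 ⟨hq.2, hq.1⟩ (le_maximalIdeal hq.2.ne_top)

lemma exists_gen_radical_eq_maximalIdeal_of_mem {a : R} (ha : a ∈ maximalIdeal R)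
    (hreg : a ∈ nonZeroDivisors R) : ∃ (d : ℕ) (x : Fin (d + 1) → R),
    ringKrullDim R = (d + 1 : ℕ) ∧ x 0 = a ∧ (∀ i, x i ∈ maximalIdeal R) ∧
      maximalIdeal R ≤ (gen x).radical := by
  have hsurj : Function.Surjective (Ideal.Quotient.mk (Ideal.span {a})) :=
    Ideal.Quotient.mk_surjective
  have : Nontrivial (R ⧸ Ideal.span {a}) := Ideal.Quotient.nontrivial_iff.2 fun h =>
    (maximalIdeal.isMaximal R).ne_top
      (top_le_iff.1 (h.ge.trans ((Ideal.span_singleton_le_iff_mem _).2 ha)))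
  have : IsLocalRing (R ⧸ Ideal.span {a}) := IsLocalRing.of_surjective' _ hsurj
  have hloc : IsLocalHom (Ideal.Quotient.mk (Ideal.span {a})) := hsurj.isLocalHom _
  have hmem : ∀ b, Ideal.Quotient.mk (Ideal.span {a}) b ∈ maximalIdeal (R ⧸ Ideal.span {a}) ↔
      b ∈ maximalIdeal R := fun b => by
    simp only [mem_maximalIdeal, mem_nonunits_iff, isUnit_map_iff]
  obtain ⟨d, y, hd, hy, hrad⟩ := exists_gen_radical_eq_maximalIdeal (R := R ⧸ Ideal.span {a})
  choose w hw using fun i => hsurj (y i)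
  refine ⟨d, Fin.cons a w, ?_, rfl, fun i => ?_, fun b hb => ?_⟩
  · rw [← ringKrullDim_quotient_span_singleton_succ_eq_ringKrullDim_of_mem_nonZeroDivisors hreg ha,
      hd]
    rfl
  · induction i using Fin.cases with
    | zero => exact ha
    | succ i => exact (hmem _).1 ((hw i).symm ▸ hy i)
  · obtain ⟨k, hk⟩ := hrad ((hmem b).2 hb)
    refine ⟨k, ?_⟩
    have hgen : gen y = (gen w).map (Ideal.Quotient.mk (Ideal.span {a})) := by
      rw [gen, gen, Ideal.map_span, ← Set.range_comp]
      exact congrArg _ (congrArg _ (funext fun i => (hw i).symm))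
    rw [hgen, ← map_pow, ← Ideal.mem_comap, Ideal.comap_map_of_surjective _ hsurj,
      ← RingHom.ker_eq_comap_bot, Ideal.mk_ker] at hk
    have hle : gen w ⊔ Ideal.span {a} ≤ gen (Fin.cons a w : Fin (d + 1) → R) :=
      sup_le (Ideal.span_mono (Set.range_subset_iff.2 fun i => ⟨i.succ, rfl⟩))
        ((Ideal.span_singleton_le_iff_mem _).2 (Ideal.subset_span ⟨0, rfl⟩))
    exact hle hk

end

lemma exists_gen_eq_maximalIdeal {S : Type*} [CommRing S] [IsLocalRing S] [CharZero S]
    (hS : IsRegularLocal S) {p : ℕ} (hp : p ≠ 0) (hpS : (p : S) ∈ IsLocalRing.maximalIdeal S) :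
    ∃ (d : ℕ) (z : Fin (d + 1) → S), ((d + 1 : ℕ) : WithBot ℕ∞) ≤ ringKrullDim S ∧
      gen z = IsLocalRing.maximalIdeal S := by
  obtain ⟨-, s, hs, hc⟩ := hS
  have hs0 : s.card ≠ 0 := fun h => by
    rw [Finset.card_eq_zero.1 h, Finset.coe_empty, Ideal.span_empty] at hs
    rw [← hs, Ideal.mem_bot] at hpS
    exact hp (Nat.cast_eq_zero.1 hpS)
  obtain ⟨d, hd⟩ := Nat.exists_eq_succ_of_ne_zero hs0
  refine ⟨d, fun i => (s.equivFinOfCardEq hd).symm i, by rw [← hc, hd], ?_⟩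
  rw [← hs]
  refine congrArg Ideal.span (Set.ext fun a => ⟨?_, fun ha => ?_⟩)
  · rintro ⟨i, rfl⟩
    exact ((s.equivFinOfCardEq hd).symm i).2
  · exact ⟨s.equivFinOfCardEq hd ⟨a, ha⟩, by simp⟩

end PureRegular

open PureRegular

/-- If `(R,𝔪) → (S,𝔫)` is a pure local homomorphism of Noetherian local rings with `S` a
regular local ring of mixed characteristic, then `R` is Cohen-Macaulay: every system of
parameters of `R` is a regular sequence on `R`. -/
theorem cohenMacaulay_of_pure_into_regular (R : Type u) (S : Type v) [CommRing R] [CommRing S]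
    [IsNoetherianRing R] [IsNoetherianRing S] [IsLocalRing R] [IsLocalRing S] [Algebra R S]
    (hloc : IsLocalHom (algebraMap R S)) (hpure : IsPureMap R S)
    (hregS : IsRegularLocal S) (hmixedS : MixedCharLocal S) :
    ∀ xs : List R, IsSOP R xs → RingTheory.Sequence.IsWeaklyRegular R xs := by
  obtain ⟨hchar, p, hp0, hp⟩ := hmixedS
  have : Fact p.Prime :=
    ⟨(CharP.char_is_prime_or_zero (IsLocalRing.ResidueField S) p).resolve_right hp0.ne'⟩
  have hpS : (p : S) ∈ IsLocalRing.maximalIdeal S := by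
    rw [← IsLocalRing.residue_eq_zero_iff, map_natCast, CharP.cast_eq_zero]
  obtain ⟨d', z, hd', hz⟩ := exists_gen_eq_maximalIdeal hregS hp0.ne' hpS
  have hqr : QuasiRegular z ⊥ := quasiRegular_of_gen_eq_maximalIdeal hd' hz
  have hmax : (gen z).IsMaximal := hz ▸ inferInstance
  have : IsDomain S := hqr.isDomain hmax.isPrime fun a ha =>
    (Submodule.mem_bot S).1 (mem_of_forall_mem_sup_pow hmax.ne_top fun L =>
      Ideal.mem_sup_right (ha L))
  have hdesc := mem_of_algebraMap_mem_map_of_pure hpure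
  have hinj : ∀ a : R, algebraMap R S a = 0 → a = 0 := fun a ha =>
    (Submodule.mem_bot R).1 (hdesc ⊥ a (by rw [ha]; exact Ideal.zero_mem _))
  have hmz : (IsLocalRing.maximalIdeal R).map (algebraMap R S) ≤ gen z := by
    rw [hz]
    exact ((IsLocalRing.local_hom_TFAE (algebraMap R S)).out 0 2).1 hloc
  have hpR : (p : R) ∈ IsLocalRing.maximalIdeal R := by
    rw [IsLocalRing.mem_maximalIdeal, mem_nonunits_iff]
    intro h
    have h' := h.map (algebraMap R S)
    rw [map_natCast] at h'
    exact (IsLocalRing.mem_maximalIdeal _).1 hpS h'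
  have hpreg : (p : R) ∈ nonZeroDivisors R := by
    rw [mem_nonZeroDivisors_iff_right]
    refine fun a ha => hinj a ?_
    have := congrArg (algebraMap R S) ha
    rw [map_mul, map_natCast, map_zero] at this
    exact (mul_eq_zero.1 this).resolve_right (Nat.cast_ne_zero.2 hp0.ne')
  obtain ⟨d, x, hd, hx0, hx, hrad⟩ := exists_gen_radical_eq_maximalIdeal_of_mem hpR hpreg
  obtain ⟨k, hk⟩ := Ideal.exists_pow_le_of_le_radical_of_fg hrad
    (IsNoetherian.noetherian (IsLocalRing.maximalIdeal R))
  have hreg : RingTheory.Sequence.IsWeaklyRegular R (List.ofFn x) := by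
    refine isWeaklyRegular_ofFn fun j t ht => ?_
    obtain ⟨r, hr⟩ := exists_eq_sum_of_mem_span_image (s := Finset.univ.filter (· < j))
      (a := t * x j) (by simpa using ht)
    have := colon_of_pure hqr hmax (hz ▸ hpS) (IsLocalRing.maximalIdeal.isMaximal R)
      (IsNoetherian.noetherian _) hmz hx hk hx0 hdesc
      (fun e he hl w => pow_notMem_span_sub_pow hd.ge hx hrad he hl w) j (Function.update r j t) (by
        rw [Function.update_self, hr]
        refine Finset.sum_congr rfl fun i hi => ?_
        rw [Function.update_of_ne (Finset.mem_filter.1 hi).2.ne])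
    rwa [Function.update_self] at this
  rintro xs ⟨hxs, hlen, hxrad⟩
  refine isWeaklyRegular_of_radical [] (List.ofFn x) xs ?_ (by simp) ?_ hxs ?_ hxrad.ge hreg
  · rw [hd] at hlen
    rw [List.length_ofFn]
    exact_mod_cast hlen.symm
  · rw [List.forall_mem_ofFn_iff]
    exact hx
  · refine hrad.trans (Ideal.radical_mono (Ideal.span_mono ?_))
    rintro _ ⟨i, rfl⟩
    exact List.mem_ofFn.2 ⟨i, rfl⟩
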